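/- Let N ∈ {1,2,4}, let λ ≥ 0 be an integer, and let p ≥ 3 be a prime with 𝔭 dividing p. Let f be a weakly holomorphic modular form of weight λ+1/2 on Γ₀(4N) such that every Fourier coefficient a_f(n) at ∞ lies in L and is 𝔭-integral, and such that the constant term of f at every cusp vanishes, i.e. c_σ(0) = 0 for every σ ∈ SL₂(ℤ). Assume that λ ≡ 2 (mod (p−1)/2), or that N = 1 and λ ≡ 3 (mod (p−1)/2). Then for every positive integer j there exists a positive integer b such that a_f(p^b·n) ≡ 0 (mod 𝔭^j) for every integer n. -/

import Mathlib

open Complex UpperHalfPlane Matrix MatrixGroups CongruenceSubgroup Filter Topology Manifold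
open scoped Real NumberField

set_option synthInstance.maxHeartbeats 1000000
set_option maxHeartbeats 1000000

noncomputable section

/-- The Jacobi theta function `θ(τ) = Σ_{n ∈ ℤ} e^{2πin²τ}`. -/
def Theta (τ : ℍ) : ℂ := ∑' n : ℤ, Complex.exp (2 * Real.pi * Complex.I * (n : ℂ) ^ 2 * (τ : ℂ))

/-- `cτ + d` for `σ = (a,b;c,d) ∈ SL₂(ℤ)`. -/
def denomC (σ : SL(2, ℤ)) (τ : ℍ) : ℂ := (σ 1 0 : ℂ) * (τ : ℂ) + (σ 1 1 : ℂ)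

/-- `f` admits at the cusp `σ∞` an expansion `(cτ+d)^{-k} f(στ) = Σ_n c(n) e^{2πinτ/M}`
(principal branch) with coefficients `c`, width `M > 0`, coefficients vanishing below some `s₀`,
the series converging absolutely, and uniformly on `{Im τ ≥ y₀}` for every `y₀ > 0`. -/
def CuspExpansion (k : ℂ) (f : ℍ → ℂ) (σ : SL(2, ℤ)) (M : ℕ) (c : ℤ → ℂ) : Prop :=
  0 < M ∧ (∃ s₀ : ℤ, ∀ n : ℤ, n < s₀ → c n = 0) ∧
  ∀ y₀ : ℝ, 0 < y₀ →
    (∀ τ : ℍ, y₀ ≤ τ.im →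
      Summable fun n : ℤ => ‖c n * Complex.exp (2 * Real.pi * Complex.I * n * τ / M)‖) ∧
    TendstoUniformlyOn
      (fun (s : Finset ℤ) (τ : ℍ) =>
        ∑ n ∈ s, c n * Complex.exp (2 * Real.pi * Complex.I * n * τ / M))
      (fun τ => (denomC σ τ) ^ (-k) * f (σ • τ))
      Filter.atTop {τ : ℍ | y₀ ≤ τ.im}

/-- Weakly holomorphic modular form of weight `lam + 1/2` on `Γ₀(4N)`. -/
structure IsWeaklyHolo (N : ℕ) (lam : ℤ) (f : ℍ → ℂ) : Prop where
  holo : MDifferentiable 𝓘(ℂ) 𝓘(ℂ) f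
  transf : ∀ γ ∈ Gamma0 (4 * N), ∀ τ : ℍ,
    f (γ • τ) = (Theta (γ • τ) / Theta τ) ^ (2 * lam + 1 : ℤ) * f τ
  cusp : ∀ σ : SL(2, ℤ), ∃ (M : ℕ) (c : ℤ → ℂ), CuspExpansion ((lam : ℂ) + 1 / 2) f σ M c

/-- Holomorphic modular form of weight `lam + 1/2` on `Γ₀(4N)`: at every cusp one can take the
expansion to start at `0`. -/
structure IsHoloForm (N : ℕ) (lam : ℤ) (f : ℍ → ℂ) : Prop where
  holo : MDifferentiable 𝓘(ℂ) 𝓘(ℂ) f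
  transf : ∀ γ ∈ Gamma0 (4 * N), ∀ τ : ℍ,
    f (γ • τ) = (Theta (γ • τ) / Theta τ) ^ (2 * lam + 1 : ℤ) * f τ
  cusp : ∀ σ : SL(2, ℤ), ∃ (M : ℕ) (c : ℤ → ℂ),
    CuspExpansion ((lam : ℂ) + 1 / 2) f σ M c ∧ ∀ n : ℤ, n < 0 → c n = 0

/-- Cusp form of weight `lam + 1/2` on `Γ₀(4N)`: holomorphic form all of whose slashes tend to
`0` as `Im τ → ∞`. -/
structure IsCuspFormHalf (N : ℕ) (lam : ℤ) (f : ℍ → ℂ) : Prop where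
  toIsHoloForm : IsHoloForm N lam f
  decay : ∀ σ : SL(2, ℤ),
    Filter.Tendsto (fun τ : ℍ => (denomC σ τ) ^ (-((lam : ℂ) + 1 / 2)) * f (σ • τ))
      (Filter.comap UpperHalfPlane.im Filter.atTop) (nhds 0)

/-- `f(τ) = Σ_{n ∈ ℤ} a(n) e^{2πinτ}` is the Fourier expansion of `f` at `∞`. -/
def FourierAtInfty (f : ℍ → ℂ) (a : ℤ → ℂ) : Prop :=
  ∀ τ : ℍ, HasSum (fun n : ℤ => a n * Complex.exp (2 * Real.pi * Complex.I * n * τ)) (f τ)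

/-- `x ≡ y (mod 𝔭^j)` for elements of `ℂ` lying in `L`: `(x - y)·b = a` with `a ∈ 𝔭^j`,
`b ∉ 𝔭`, i.e. `v_𝔭(x - y) ≥ j`. -/
def CongMod (L : Subfield ℂ) (P : Ideal (𝓞 L)) (j : ℕ) (x y : ℂ) : Prop :=
  ∃ a b : 𝓞 L, a ∈ P ^ j ∧ b ∉ P ∧ (x - y) * ((b : L) : ℂ) = ((a : L) : ℂ)

/-- `x` is `𝔭`-integral: `x·b = a` with `a ∈ 𝒪_L`, `b ∈ 𝒪_L ∖ 𝔭`. -/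
def PIntegral (L : Subfield ℂ) (P : Ideal (𝓞 L)) (x : ℂ) : Prop :=
  ∃ a b : 𝓞 L, b ∉ P ∧ x * ((b : L) : ℂ) = ((a : L) : ℂ)

/-- The affine map `τ ↦ r τ + t` of the upper half plane, for `r > 0`. -/
def affMap (r t : ℝ) (τ : ℍ) : ℍ := ofComplex (r * τ + t)

lemma coe_affMap {r : ℝ} (hr : 0 < r) (t : ℝ) (τ : ℍ) : (affMap r t τ : ℂ) = r * τ + t := by
  have : 0 < ((r : ℂ) * τ + t).im := by
    simpa using mul_pos hr τ.im_pos
  rw [affMap, ofComplex_apply_of_im_pos this]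

/-- `F` has the expansion `F τ = Σ_{n ≥ 0} x_n e^{2πinτ/h}` on the upper half plane. -/
def HasExp (h : ℕ) (x : PowerSeries ℂ) (F : ℍ → ℂ) : Prop :=
  ∀ τ : ℍ, HasSum (fun n : ℕ => PowerSeries.coeff n x * Function.Periodic.qParam h τ ^ n) (F τ)

namespace HasExp

variable {h : ℕ} {x y : PowerSeries ℂ} {F G : ℍ → ℂ}

lemma congr_fun (hF : HasExp h x F) (e : ∀ τ, G τ = F τ) : HasExp h x G := by
  intro τ; rw [e]; exact hF τ

lemma add (hF : HasExp h x F) (hG : HasExp h y G) : HasExp h (x + y) (fun τ => F τ + G τ) := by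
  intro τ
  simpa [add_mul] using (hF τ).add (hG τ)

lemma mul (hF : HasExp h x F) (hG : HasExp h y G) : HasExp h (x * y) (fun τ => F τ * G τ) := by
  intro τ
  have h1 := (hF τ).summable.norm
  have h2 := (hG τ).summable.norm
  have h3 := (summable_norm_sum_mul_antidiagonal_of_summable_norm h1 h2).of_norm
  have h4 := tsum_mul_tsum_eq_tsum_sum_antidiagonal_of_summable_norm h1 h2
  rw [(hF τ).tsum_eq, (hG τ).tsum_eq] at h4
  have h5 := h3.hasSum
  rw [← h4] at h5
  refine h5.congr_fun fun n => ?_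
  rw [PowerSeries.coeff_mul, Finset.sum_mul]
  refine Finset.sum_congr rfl fun kl hkl => ?_
  rw [← Finset.HasAntidiagonal.mem_antidiagonal.1 hkl, pow_add]
  ring

lemma const (h : ℕ) (c : ℂ) : HasExp h (PowerSeries.C c) (fun _ => c) := by
  intro τ
  convert hasSum_single (f := fun n : ℕ => PowerSeries.coeff n (PowerSeries.C c) *
    Function.Periodic.qParam h τ ^ n) 0 ?_ using 1
  · simp
  · intro n hn
    simp [PowerSeries.coeff_C, hn]

lemma one (h : ℕ) : HasExp h 1 (fun _ => 1) := by
  simpa using const h 1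

lemma const_mul (c : ℂ) (hF : HasExp h x F) :
    HasExp h (PowerSeries.C c * x) (fun τ => c * F τ) := (const h c).mul hF

lemma neg (hF : HasExp h x F) : HasExp h (-x) (fun τ => -F τ) := by
  intro τ
  simpa using (hF τ).neg

lemma sub (hF : HasExp h x F) (hG : HasExp h y G) : HasExp h (x - y) (fun τ => F τ - G τ) := by
  simpa [sub_eq_add_neg] using hF.add hG.neg

lemma pow (hF : HasExp h x F) (n : ℕ) : HasExp h (x ^ n) (fun τ => F τ ^ n) := by
  induction n with
  | zero => simpa using one h
  | succ n ih => simpa [pow_succ] using ih.mul hF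

lemma sum {ι : Type*} (s : Finset ι) {x : ι → PowerSeries ℂ} {F : ι → ℍ → ℂ}
    (hF : ∀ i ∈ s, HasExp h (x i) (F i)) : HasExp h (∑ i ∈ s, x i) (fun τ => ∑ i ∈ s, F i τ) := by
  intro τ
  have := hasSum_sum (fun i hi => hF i hi τ)
  refine this.congr_fun fun n => ?_
  simp [Finset.sum_mul]

lemma expand (hF : HasExp h x F) {k : ℕ} (hk : k ≠ 0) :
    HasExp (k * h) (PowerSeries.expand k hk x) F := by
  intro τ
  have inj : Function.Injective (fun n : ℕ => k * n) := fun a b e => by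
    simpa [hk] using e
  have key := (inj.hasSum_iff (f := fun n : ℕ => PowerSeries.coeff n (PowerSeries.expand k hk x) *
    Function.Periodic.qParam (k * h : ℕ) τ ^ n) (a := F τ) ?_).1
  · apply key
    refine (hF τ).congr_fun fun n => ?_
    simp only [Function.comp_apply, PowerSeries.coeff_expand_mul, pow_mul]
    congr 2
    rw [Function.Periodic.qParam, Function.Periodic.qParam, ← Complex.exp_nat_mul]
    congr 1
    push_cast
    have : (k : ℂ) ≠ 0 := by exact_mod_cast hk
    rw [mul_div_assoc', mul_div_mul_left _ _ this]
  · intro n hn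
    rw [PowerSeries.coeff_expand_of_not_dvd, zero_mul]
    rintro ⟨m, rfl⟩
    exact hn ⟨m, rfl⟩

lemma comp_mul (hF : HasExp h x F) {k : ℕ} (hk : k ≠ 0) :
    HasExp h (PowerSeries.expand k hk x) (fun τ => F (affMap k 0 τ)) := by
  intro τ
  have inj : Function.Injective (fun n : ℕ => k * n) := fun a b e => by
    simpa [hk] using e
  have key := (inj.hasSum_iff (f := fun n : ℕ => PowerSeries.coeff n (PowerSeries.expand k hk x) *
    Function.Periodic.qParam h τ ^ n) (a := F (affMap k 0 τ)) ?_).1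
  · apply key
    refine (hF _).congr_fun fun n => ?_
    simp only [Function.comp_apply, PowerSeries.coeff_expand_mul, pow_mul]
    congr 2
    rw [Function.Periodic.qParam, Function.Periodic.qParam, ← Complex.exp_nat_mul,
      coe_affMap (by positivity)]
    congr 1
    push_cast
    ring
  · intro n hn
    rw [PowerSeries.coeff_expand_of_not_dvd, zero_mul]
    rintro ⟨m, rfl⟩
    exact hn ⟨m, rfl⟩

lemma comp_div (hF : HasExp h x F) {k : ℕ} (hk : k ≠ 0) (t : ℝ) :
    HasExp (k * h) (PowerSeries.rescale (Complex.exp (2 * π * Complex.I * t / (k * h))) x)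
      (fun τ => F (affMap (k : ℝ)⁻¹ (t / k) τ)) := by
  intro τ
  refine (hF _).congr_fun fun n => ?_
  rw [PowerSeries.coeff_rescale, mul_comm (_ ^ n), mul_assoc, ← mul_pow]
  congr 2
  rw [Function.Periodic.qParam, Function.Periodic.qParam, ← Complex.exp_add,
    coe_affMap (by positivity)]
  congr 1
  push_cast
  ring

lemma periodic (hh : 0 < h) (hF : HasExp h x F) : Function.Periodic (F ∘ ofComplex) (h : ℝ) := by
  intro z
  by_cases hz : 0 < z.im
  · have hz' : 0 < (z + (h : ℝ)).im := by simpa using hz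
    simp only [Function.comp_apply, ofComplex_apply_of_im_pos hz, ofComplex_apply_of_im_pos hz']
    refine (hF _).unique ((hF _).congr_fun fun n => ?_)
    congr 2
    rw [Function.Periodic.qParam, Function.Periodic.qParam]
    rw [Complex.exp_eq_exp_iff_exists_int]
    refine ⟨1, ?_⟩
    have : (h : ℂ) ≠ 0 := by exact_mod_cast hh.ne'
    push_cast
    field_simp
  · have hz' : ¬ 0 < (z + (h : ℝ)).im := by simpa using hz
    simp only [Function.comp_apply]
    rw [ofComplex_apply_eq_of_im_nonpos (not_lt.1 hz) (not_lt.1 hz')]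

lemma bounded (hh : 0 < h) (hF : HasExp h x F) : IsBoundedAtImInfty F :=
  UpperHalfPlane.isBoundedAtImInfty_of_hasSum_qExpansion (h := h) (by exact_mod_cast hh) hF

lemma of_periodic (hh : 0 < h) (hper : Function.Periodic (F ∘ ofComplex) (h : ℝ))
    (hol : MDifferentiable 𝓘(ℂ) 𝓘(ℂ) F) (hb : IsBoundedAtImInfty F) :
    HasExp h (qExpansion h F) F :=
  fun τ => hasSum_qExpansion (by exact_mod_cast hh) hper hol hb τ

lemma powerSeries (hh : 0 < h) (hF : HasExp h x F) :
    ∃ g : ℂ → ℂ, HasFPowerSeriesOnBall g (.ofScalars ℂ fun n => PowerSeries.coeff n x) 0 1 ∧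
      ∀ τ : ℍ, F τ = g (Function.Periodic.qParam h τ) := by
  have hh' : (0 : ℝ) < h := by exact_mod_cast hh
  have hsum : ∀ q : ℂ, ‖q‖ < 1 → Summable fun n : ℕ => PowerSeries.coeff n x * q ^ n := by
    intro q hq
    rcases eq_or_ne q 0 with rfl | hq0
    · refine summable_of_ne_finset_zero (s := {0}) fun n hn => ?_
      simp at hn
      simp [hn]
    · have him : 0 < (Function.Periodic.invQParam h q).im := by
        rw [Function.Periodic.im_invQParam]
        have := Real.log_neg (norm_pos_iff.2 hq0) hq
        have h2 : -(h : ℝ) / (2 * π) < 0 := by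
          apply div_neg_of_neg_of_pos <;> [linarith; positivity]
        exact mul_pos_of_neg_of_neg h2 this
      have := (hF ⟨_, him⟩).summable
      simpa [Function.Periodic.qParam_right_inv hh'.ne' hq0] using this
  refine ⟨fun q => ∑' n : ℕ, PowerSeries.coeff n x * q ^ n, ⟨?_, by norm_num, ?_⟩, ?_⟩
  · refine ENNReal.le_of_forall_nnreal_lt fun r hr => ?_
    refine FormalMultilinearSeries.le_radius_of_summable_norm _ ?_
    have hr1 : ‖((r : ℝ) : ℂ)‖ < 1 := by
      simpa using hr
    refine ((hsum _ hr1).norm).congr fun n => ?_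
    simp
  · intro q hq
    have hq1 : ‖q‖ < 1 := by
      rwa [mem_eball_zero_iff, ← ofReal_norm, ENNReal.ofReal_lt_one] at hq
    simp only [zero_add]
    refine (hsum q hq1).hasSum.congr_fun fun n => ?_
    simp [mul_comm]
  · intro τ
    exact (hF τ).tsum_eq.symm

lemma mdifferentiable (hh : 0 < h) (hF : HasExp h x F) : MDifferentiable 𝓘(ℂ) 𝓘(ℂ) F := by
  have hh' : (0 : ℝ) < h := by exact_mod_cast hh
  obtain ⟨g, hg, e⟩ := hF.powerSeries hh
  rw [UpperHalfPlane.mdifferentiable_iff]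
  have : DifferentiableOn ℂ (fun z => g (Function.Periodic.qParam h z)) {z : ℂ | 0 < z.im} := by
    intro z hz
    have h1 : DifferentiableAt ℂ g (Function.Periodic.qParam h z) := by
      refine (hg.analyticAt_of_mem ?_).differentiableAt
      have := Function.Periodic.norm_qParam_lt_one hh' hz
      rwa [mem_eball_zero_iff, ← ofReal_norm, ENNReal.ofReal_lt_one]
    exact (h1.comp z (Function.Periodic.differentiable_qParam z)).differentiableWithinAt
  refine this.congr fun z hz => ?_
  simp only [Function.comp_apply]
  rw [e, ofComplex_apply_of_im_pos hz]

lemma unique (hh : 0 < h) (hF : HasExp h x F) (hF' : HasExp h y F) : x = y := by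
  have hh' : (0 : ℝ) < h := by exact_mod_cast hh
  have han := UpperHalfPlane.analyticAt_cuspFunction_zero (h := h) hh' (hF.periodic hh)
    (hF.mdifferentiable hh) (hF.bounded hh)
  ext n
  have h1 := (UpperHalfPlane.hasFPowerSeriesOnBall_cuspFunction hh' han hF).hasFPowerSeriesAt
  have h2 := (UpperHalfPlane.hasFPowerSeriesOnBall_cuspFunction hh' han hF').hasFPowerSeriesAt
  simpa using congr_arg (FormalMultilinearSeries.coeff · n) (h1.eq_formalMultilinearSeries h2)

lemma tendsto (hh : 0 < h) (hF : HasExp h x F) :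
    Tendsto F atImInfty (𝓝 (PowerSeries.coeff 0 x)) := by
  have hh' : (0 : ℝ) < h := by exact_mod_cast hh
  obtain ⟨g, hg, e⟩ := hF.powerSeries hh
  have h0 : g 0 = PowerSeries.coeff 0 x := by
    have := hg.hasSum (y := 0) (by simp)
    simp only [zero_add] at this
    rw [← this.tsum_eq, tsum_eq_single 0]
    · simp
    · intro n hn
      simp [hn]
  rw [← h0, show F = g ∘ fun τ : ℍ => Function.Periodic.qParam h τ from funext e]
  exact hg.hasFPowerSeriesAt.continuousAt.tendsto.comp
    (qParam_tendsto_atImInfty hh')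

lemma inv (hh : 0 < h) (hF : HasExp h x F) (hne : ∀ τ, F τ ≠ 0)
    (h0 : PowerSeries.coeff 0 x ≠ 0) : HasExp h x⁻¹ (fun τ => (F τ)⁻¹) := by
  have hper := hF.periodic hh
  have hper' : Function.Periodic ((fun τ => (F τ)⁻¹) ∘ ofComplex) (h : ℝ) := fun z => by
    have := hper z
    simp only [Function.comp_apply] at this ⊢
    rw [this]
  have hol : MDifferentiable 𝓘(ℂ) 𝓘(ℂ) (fun τ => (F τ)⁻¹) := by
    have := hF.mdifferentiable hh
    rw [UpperHalfPlane.mdifferentiable_iff] at this ⊢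
    exact this.inv fun z _ => hne _
  have hb : IsBoundedAtImInfty (fun τ => (F τ)⁻¹) :=
    ((hF.tendsto hh).inv₀ h0).isBigO_one ℝ
  have key := of_periodic hh hper' hol hb
  have h1 : x * qExpansion h (fun τ => (F τ)⁻¹) = 1 := by
    refine unique hh ((hF.mul key).congr_fun (G := fun _ => 1) fun τ => ?_) (one h)
    rw [mul_inv_cancel₀ (hne τ)]
  have h2 : x⁻¹ = qExpansion h (fun τ => (F τ)⁻¹) := by
    rw [PowerSeries.inv_eq_iff_mul_eq_one, mul_comm, h1]
    rwa [PowerSeries.coeff_zero_eq_constantCoeff_apply] at h0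
  rwa [h2]

lemma descend (hh : 0 < h) {k : ℕ} (hk : k ≠ 0) (hF : HasExp (k * h) x F)
    (hper : ∀ τ, F (affMap 1 h τ) = F τ) : ∃ y, HasExp h y F ∧ x = PowerSeries.expand k hk y := by
  have hkh : 0 < k * h := by positivity
  have hper' : Function.Periodic (F ∘ ofComplex) (h : ℝ) := by
    intro z
    by_cases hz : 0 < z.im
    · have := hper ⟨z, hz⟩
      simp only [Function.comp_apply, ofComplex_apply_of_im_pos hz, ← this, affMap]
      simp
    · have hz' : ¬ 0 < (z + (h : ℝ)).im := by simpa using hz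
      simp only [Function.comp_apply]
      rw [ofComplex_apply_eq_of_im_nonpos (not_lt.1 hz) (not_lt.1 hz')]
  have key := of_periodic hh hper' (hF.mdifferentiable hkh) (hF.bounded hkh)
  exact ⟨_, key, hF.unique hkh (key.expand hk)⟩

end HasExp

/-- `R` is a subring of `ℂ` in which every integer prime to `p` is invertible and which is closed
under extraction of roots. -/
structure LocalRootClosed (p : ℕ) (R : Subring ℂ) : Prop where
  inv_mem : ∀ n : ℕ, ¬ p ∣ n → ((n : ℂ)⁻¹) ∈ R
  root_mem : ∀ (k : ℕ) (z : ℂ), 0 < k → z ^ k ∈ R → z ∈ R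

/-- The additive group `p^m R`. -/
def powIdeal (p m : ℕ) (R : Subring ℂ) : AddSubgroup ℂ :=
  R.toAddSubgroup.map (AddMonoidHom.mulLeft ((p : ℂ) ^ m))

section powIdeal

variable {p m : ℕ} {R : Subring ℂ} {c d : ℂ}

lemma mem_powIdeal : c ∈ powIdeal p m R ↔ ∃ z ∈ R, (p : ℂ) ^ m * z = c := Iff.rfl

lemma mem_powIdeal_zero : c ∈ powIdeal p 0 R ↔ c ∈ R := by
  simp [mem_powIdeal]

lemma powIdeal_le : powIdeal p m R ≤ R.toAddSubgroup := by
  rintro _ ⟨z, hz, rfl⟩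
  exact R.mul_mem (R.pow_mem (natCast_mem R p) m) hz

lemma powIdeal_anti {m' : ℕ} (h : m ≤ m') : powIdeal p m' R ≤ powIdeal p m R := by
  rintro _ ⟨z, hz, rfl⟩
  refine ⟨(p : ℂ) ^ (m' - m) * z, R.mul_mem (R.pow_mem (natCast_mem R p) _) hz, ?_⟩
  simp only [AddMonoidHom.coe_mulLeft]
  rw [← mul_assoc, ← pow_add, Nat.add_sub_cancel' h]

lemma mul_mem_powIdeal_add {m' : ℕ} (hc : c ∈ powIdeal p m R) (hd : d ∈ powIdeal p m' R) :
    c * d ∈ powIdeal p (m + m') R := by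
  obtain ⟨z, hz, rfl⟩ := hc
  obtain ⟨w, hw, rfl⟩ := hd
  refine ⟨z * w, R.mul_mem hz hw, ?_⟩
  simp only [AddMonoidHom.coe_mulLeft]
  ring

lemma mul_mem_powIdeal_right (hc : c ∈ powIdeal p m R) (hd : d ∈ R) :
    c * d ∈ powIdeal p m R :=
  mul_mem_powIdeal_add hc (mem_powIdeal_zero.2 hd)

lemma mul_mem_powIdeal_left (hc : c ∈ R) (hd : d ∈ powIdeal p m R) :
    c * d ∈ powIdeal p m R := by
  rw [mul_comm]; exact mul_mem_powIdeal_right hd hc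

end powIdeal

/-- The ring of power series with coefficients in `R` whose `i`-th coefficient lies in `p^m R`
whenever `q ∤ i`. -/
def sparseSeries (p m q : ℕ) (R : Subring ℂ) : Subring (PowerSeries ℂ) where
  carrier := {x | ∀ i, PowerSeries.coeff i x ∈ R ∧
    (¬ q ∣ i → PowerSeries.coeff i x ∈ powIdeal p m R)}
  zero_mem' i := by simp [R.zero_mem, (powIdeal p m R).zero_mem]
  one_mem' i := by
    rw [PowerSeries.coeff_one]
    split_ifs with h
    · simp [h, R.one_mem]
    · simp [R.zero_mem, (powIdeal p m R).zero_mem]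
  add_mem' hx hy i := by
    rw [map_add]
    exact ⟨R.add_mem (hx i).1 (hy i).1,
      fun h => (powIdeal p m R).add_mem ((hx i).2 h) ((hy i).2 h)⟩
  neg_mem' hx i := by
    rw [map_neg]
    exact ⟨R.neg_mem (hx i).1, fun h => (powIdeal p m R).neg_mem ((hx i).2 h)⟩
  mul_mem' hx hy i := by
    rw [PowerSeries.coeff_mul]
    refine ⟨R.sum_mem fun jk _ => R.mul_mem (hx _).1 (hy _).1,
      fun h => AddSubgroup.sum_mem _ fun jk hjk => ?_⟩
    have e : jk.1 + jk.2 = i := Finset.HasAntidiagonal.mem_antidiagonal.1 hjk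
    by_cases h1 : q ∣ jk.1
    · have h2 : ¬ q ∣ jk.2 := fun h2 => h (e ▸ dvd_add h1 h2)
      exact mul_mem_powIdeal_left (hx _).1 ((hy _).2 h2)
    · exact mul_mem_powIdeal_right ((hx _).2 h1) (hy _).1

section sparse

variable {p m q : ℕ} {R : Subring ℂ} {x y : PowerSeries ℂ}

lemma mem_sparseSeries : x ∈ sparseSeries p m q R ↔ ∀ i, PowerSeries.coeff i x ∈ R ∧
    (¬ q ∣ i → PowerSeries.coeff i x ∈ powIdeal p m R) := Iff.rfl

lemma mem_sparseSeries_one : x ∈ sparseSeries p m 1 R ↔ ∀ i, PowerSeries.coeff i x ∈ R := by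
  simp [mem_sparseSeries]

lemma sparseSeries_le_one (m' : ℕ) : sparseSeries p m q R ≤ sparseSeries p m' 1 R :=
  fun _ hx => mem_sparseSeries_one.2 fun i => (hx i).1

lemma inv_mem_sparseSeries (hx : x ∈ sparseSeries p m q R) (h0 : (PowerSeries.coeff 0 x)⁻¹ ∈ R) :
    x⁻¹ ∈ sparseSeries p m q R := by
  rw [PowerSeries.coeff_zero_eq_constantCoeff_apply] at h0
  intro n
  induction n using Nat.strong_induction_on with
  | _ n ih =>
    rw [PowerSeries.coeff_inv]
    split_ifs with hn
    · simpa [hn] using h0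
    · have key : ∀ jk ∈ Finset.HasAntidiagonal.antidiagonal n, jk.2 < n →
          (PowerSeries.coeff jk.1 x * PowerSeries.coeff jk.2 x⁻¹ ∈ R ∧
          (¬ q ∣ n → PowerSeries.coeff jk.1 x * PowerSeries.coeff jk.2 x⁻¹ ∈ powIdeal p m R)) := by
        intro jk hjk hlt
        refine ⟨R.mul_mem (hx _).1 (ih _ hlt).1, fun h => ?_⟩
        have e : jk.1 + jk.2 = n := Finset.HasAntidiagonal.mem_antidiagonal.1 hjk
        by_cases h1 : q ∣ jk.1
        · have h2 : ¬ q ∣ jk.2 := fun h2 => h (e ▸ dvd_add h1 h2)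
          exact mul_mem_powIdeal_left (hx _).1 ((ih _ hlt).2 h2)
        · exact mul_mem_powIdeal_right ((hx _).2 h1) (ih _ hlt).1
      refine ⟨R.mul_mem (R.neg_mem h0) (R.sum_mem fun jk hjk => ?_),
        fun h => mul_mem_powIdeal_left (R.neg_mem h0) (AddSubgroup.sum_mem _ fun jk hjk => ?_)⟩
      · split_ifs with hlt
        · exact (key jk hjk hlt).1
        · exact R.zero_mem
      · split_ifs with hlt
        · exact (key jk hjk hlt).2 h
        · exact AddSubgroup.zero_mem _

lemma expand_mem_sparseSeries (hx : x ∈ sparseSeries p m q R) {k : ℕ} (hk : k ≠ 0) :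
    PowerSeries.expand k hk x ∈ sparseSeries p m q R := by
  intro i
  by_cases hi : k ∣ i
  · obtain ⟨j, rfl⟩ := hi
    rw [PowerSeries.coeff_expand_mul]
    exact ⟨(hx j).1, fun h => (hx j).2 fun h' => h (h'.mul_left k)⟩
  · rw [PowerSeries.coeff_expand_of_not_dvd _ _ _ hi]
    exact ⟨R.zero_mem, fun _ => AddSubgroup.zero_mem _⟩

lemma C_mem_sparseSeries {c : ℂ} (hc : c ∈ R) : PowerSeries.C c ∈ sparseSeries p m q R := by
  intro i
  rw [PowerSeries.coeff_C]
  split_ifs with h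
  · simp [h, hc]
  · exact ⟨R.zero_mem, fun _ => AddSubgroup.zero_mem _⟩

/-- Powers `x^(p^b)` of an integral series are sparse modulo powers of `p`. -/
lemma pow_mem_sparseSeries (hp : p.Prime) (hR : LocalRootClosed p R)
    (hx : ∀ i, PowerSeries.coeff i x ∈ R)
    {b b' : ℕ} (hb : b' + m ≤ b + 1) : x ^ p ^ b ∈ sparseSeries p m (p ^ b') R := by
  have hx' : x ∈ sparseSeries p m 1 R := mem_sparseSeries_one.2 hx
  intro i
  refine ⟨mem_sparseSeries_one.1 (Subring.pow_mem _ hx' _) i, fun hi => ?_⟩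
  have hi0 : i ≠ 0 := by rintro rfl; simp at hi
  obtain ⟨v, u, hu, rfl⟩ := Nat.exists_eq_pow_mul_and_not_dvd hi0 p hp.ne_one
  have hv : v < b' := by
    by_contra! h
    exact hi ((pow_dvd_pow p h).mul_right u)
  have hu0 : u ≠ 0 := by rintro rfl; simp at hu
  have hp0 : (p : ℂ) ≠ 0 := by exact_mod_cast hp.ne_zero
  have hu0' : (u : ℂ) ≠ 0 := by exact_mod_cast hu0
  have hder : ∀ j, PowerSeries.coeff j (PowerSeries.derivative ℂ x) ∈ R := by
    intro j
    rw [PowerSeries.coeff_derivative]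
    exact R.mul_mem (hx _) (R.add_mem (natCast_mem R _) R.one_mem)
  have hd : PowerSeries.derivative ℂ (x ^ p ^ b) =
      (p ^ b : ℕ) • (x ^ (p ^ b - 1) * PowerSeries.derivative ℂ x) := by
    rw [Derivation.leibniz_pow]
    simp
  have h1 := congrArg (PowerSeries.coeff (p ^ v * u - 1)) hd
  have hpos : 0 < p ^ v * u := Nat.pos_of_ne_zero hi0
  rw [PowerSeries.coeff_derivative, map_nsmul, Nat.sub_add_cancel hpos] at h1
  have hr : PowerSeries.coeff (p ^ v * u - 1) (x ^ (p ^ b - 1) * PowerSeries.derivative ℂ x) ∈ R :=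
    mem_sparseSeries_one.1 (Subring.mul_mem _ (Subring.pow_mem _ hx' _)
      (mem_sparseSeries_one.2 hder)) _
  set r := PowerSeries.coeff (p ^ v * u - 1) (x ^ (p ^ b - 1) * PowerSeries.derivative ℂ x)
  have h2 : ((p ^ v * u - 1 : ℕ) : ℂ) + 1 = p ^ v * u := by
    rw [Nat.cast_sub hpos]; push_cast; ring
  rw [h2] at h1
  obtain ⟨k, rfl⟩ : ∃ k, b = v + m + k := ⟨b - v - m, by omega⟩
  refine ⟨p ^ k * ((u : ℂ)⁻¹ * r), R.mul_mem (R.pow_mem (natCast_mem R _) _)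
    (R.mul_mem (hR.inv_mem u hu) hr), ?_⟩
  simp only [AddMonoidHom.coe_mulLeft]
  have h3 : ((p : ℂ) ^ v * u) ≠ 0 := mul_ne_zero (pow_ne_zero _ hp0) hu0'
  apply mul_right_cancel₀ h3
  rw [h1]
  simp only [nsmul_eq_mul]
  push_cast
  field_simp
  ring

end sparse

lemma exists_dvd_of_prime_ideal {A : Type*} [CommRing A] [IsDedekindDomain A] (P : Ideal A)
    [P.IsPrime] (hP : P ≠ ⊥) (a b : A) : ∃ s c : A, s ∉ P ∧ (s * a = b * c ∨ s * b = a * c) := by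
  have hdvr : IsDiscreteValuationRing (Localization.AtPrime P) :=
    IsLocalization.AtPrime.isDiscreteValuationRing_of_dedekind_domain A hP _
  have key : ∀ a b : A, algebraMap A (Localization.AtPrime P) b ∣
      algebraMap A (Localization.AtPrime P) a → ∃ s c : A, s ∉ P ∧ s * a = b * c := by
    rintro a b ⟨e, he⟩
    obtain ⟨c, s, rfl⟩ := IsLocalization.exists_mk'_eq P.primeCompl e
    rw [IsLocalization.mul_mk'_eq_mk'_of_mul, eq_comm, IsLocalization.mk'_eq_iff_eq_mul,
      ← map_mul] at he
    have hinj := IsLocalization.injective (Localization.AtPrime P) (P.primeCompl_le_nonZeroDivisors)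
    exact ⟨s, c, s.2, by rw [mul_comm, ← hinj he]⟩
  rcases ValuationRing.dvd_total (algebraMap A (Localization.AtPrime P) b)
    (algebraMap A (Localization.AtPrime P) a) with h | h
  · obtain ⟨s, c, h1, h2⟩ := key a b h
    exact ⟨s, c, h1, Or.inl h2⟩
  · obtain ⟨s, c, h1, h2⟩ := key b a h
    exact ⟨s, c, h1, Or.inr h2⟩

lemma exists_localRootClosed (p : ℕ) (hp : p.Prime) (L : Subfield ℂ) [NumberField L]
    (P : Ideal (𝓞 L)) (hPprime : P.IsPrime) (hPp : (p : 𝓞 L) ∈ P) :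
    ∃ R : Subring ℂ, LocalRootClosed p R ∧ (∀ z, PIntegral L P z → z ∈ R) ∧
      (∀ z ∈ L, ∀ m, z ∈ powIdeal p m R → CongMod L P m z 0) ∧
      ∃ ψ : ℂ →+ ℂ, (∀ z ∈ R, ∀ w, ψ (z * w) = z * ψ w) ∧ (∀ z ∈ R, ψ z = z) ∧
        ∀ w, ∃ D : ℕ, (p : ℂ) ^ D * ψ w ∈ R := by
  have hp0 : (p : ℂ) ≠ 0 := by exact_mod_cast hp.ne_zero
  have hPbot : P ≠ ⊥ := by
    rintro rfl
    have : (p : 𝓞 L) = 0 := by simpa using hPp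
    exact hp.ne_zero (by exact_mod_cast this)
  have hPmax : P.IsMaximal := hPprime.isMaximal hPbot
  set φ : 𝓞 L →+* ℂ := L.subtype.comp (algebraMap (𝓞 L) L) with hφ
  have hφinj : Function.Injective φ :=
    (Subtype.val_injective).comp (FaithfulSMul.algebraMap_injective (𝓞 L) L)
  have hφapp : ∀ z : 𝓞 L, φ z = ((z : L) : ℂ) := fun _ => rfl
  have hbij : Function.Bijective φ.rangeRestrict :=
    ⟨fun a b h => hφinj (show φ a = φ b from congrArg (Subtype.val : φ.range → ℂ) h), φ.rangeRestrict_surjective⟩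
  have hI : P.map φ.rangeRestrict ≠ ⊤ := by
    intro h
    have := Ideal.comap_map_of_bijective φ.rangeRestrict hbij (I := P)
    rw [h, Ideal.comap_top] at this
    exact hPprime.ne_top this.symm
  obtain ⟨B, hAB, hIB⟩ := Ideal.image_subset_nonunits_valuationSubring _ hI
  have hmemB : ∀ z : 𝓞 L, φ z ∈ B := fun z => hAB ⟨z, rfl⟩
  have hnon : ∀ z ∈ P, B.valuation (φ z) < 1 := by
    intro z hz
    rw [← ValuationSubring.mem_nonunits_iff]
    exact hIB ⟨φ.rangeRestrict z, Ideal.mem_map_of_mem _ hz, rfl⟩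
  have hle : ∀ z : 𝓞 L, B.valuation (φ z) ≤ 1 := fun z => (B.valuation_le_one_iff _).2 (hmemB z)
  have hunit : ∀ z ∉ P, B.valuation (φ z) = 1 := by
    intro z hz
    obtain ⟨y, i, hi, e⟩ := hPmax.exists_inv hz
    refine le_antisymm (hle z) ?_
    by_contra! hlt
    have h1 : B.valuation (φ (y * z + i)) < 1 := by
      rw [map_add]
      refine B.valuation.map_add_lt ?_ (hnon i hi)
      rw [map_mul, map_mul]
      exact (mul_le_of_le_one_left' (hle y)).trans_lt hlt
    rw [e] at h1
    simp at h1
  set K := algebraicClosure ℚ ℂ with hK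
  have hKmem : ∀ z : ℂ, z ∈ K ↔ IsAlgebraic ℚ z := fun z => mem_algebraicClosure_iff
  have hLK : ∀ z ∈ L, z ∈ K := by
    intro z hz
    rw [hKmem]
    have h1 : IsAlgebraic ℚ (⟨z, hz⟩ : L) := Algebra.IsAlgebraic.isAlgebraic _
    obtain ⟨q, hq0, hq⟩ := h1
    refine ⟨q, hq0, ?_⟩
    have := congrArg L.subtype hq
    rw [Polynomial.aeval_def, Polynomial.hom_eval₂, map_zero] at this
    rw [Polynomial.aeval_def, ← this]
    congr 1
  have hvn : ∀ n : ℕ, ¬ p ∣ n → B.valuation (n : ℂ) = 1 := by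
    intro n hn
    have : (n : 𝓞 L) ∉ P := by
      intro h
      have hco : IsCoprime (p : ℤ) (n : ℤ) :=
        Nat.isCoprime_iff_coprime.2 ((Nat.Prime.coprime_iff_not_dvd hp).2 hn)
      obtain ⟨u, v, e⟩ := hco
      apply hPprime.ne_top
      rw [Ideal.eq_top_iff_one]
      have e' : (u : 𝓞 L) * p + v * n = 1 := by exact_mod_cast congrArg (Int.cast : ℤ → 𝓞 L) e
      rw [← e']
      exact P.add_mem (P.mul_mem_left _ hPp) (P.mul_mem_left _ h)
    have h2 := hunit _ this
    simpa using h2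
  have h_int : ∀ z : ℂ, IsIntegral ℤ z → z ∈ B := by
    intro z hz
    have h1 : IsIntegral B z := hz.tower_top
    obtain ⟨y, rfl⟩ := IsIntegrallyClosed.isIntegral_iff.1 h1
    exact y.2
  refine ⟨B.toSubring ⊓ K.toSubfield.toSubring, ⟨?_, ?_⟩, ?_, ?_, ?_⟩
  · intro n hn
    refine ⟨?_, K.inv_mem (natCast_mem K n)⟩
    change _ ∈ B
    rw [← B.valuation_le_one_iff, map_inv₀, hvn n hn, inv_one]
  · intro k z hk hz
    refine ⟨?_, ?_⟩
    · have h1 : z ^ k ∈ B := hz.1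
      change _ ∈ B
      rw [← B.valuation_le_one_iff, map_pow] at h1
      rw [← B.valuation_le_one_iff]
      exact (pow_le_one_iff hk.ne').1 h1
    · have h1 : z ^ k ∈ K := hz.2
      change z ∈ K
      rw [hKmem] at h1 ⊢
      exact h1.of_pow hk
  · rintro z ⟨a, b, hb, e⟩
    have hv := hunit b hb
    have hb0 : ((b : L) : ℂ) ≠ 0 := by
      intro h
      rw [hφapp, h] at hv
      simp at hv
    have hz : z = ((a : L) : ℂ) / ((b : L) : ℂ) := by
      rw [← e, mul_div_cancel_right₀ _ hb0]
    refine ⟨?_, hLK z (hz ▸ L.div_mem (a : L).2 (b : L).2)⟩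
    change _ ∈ B
    rw [← B.valuation_le_one_iff, hz, map_div₀]
    rw [hφapp] at hv
    rw [hv, div_one]
    exact hle a
  · rintro _ hzL m ⟨w, hw, rfl⟩
    simp only [AddMonoidHom.coe_mulLeft] at hzL ⊢
    have hwL : w ∈ L := by
      have : w = (p : ℂ) ^ m * w / (p : ℂ) ^ m := by field_simp
      rw [this]
      exact L.div_mem hzL (pow_mem (natCast_mem L p) m)
    have hwB : B.valuation w ≤ 1 := (B.valuation_le_one_iff _).2 hw.1
    obtain ⟨a, b, hb0, hab⟩ := IsFractionRing.div_surjective (A := 𝓞 L) (⟨w, hwL⟩ : L)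
    have hb0' : ((b : L) : ℂ) ≠ 0 := by
      intro h
      apply nonZeroDivisors.ne_zero hb0
      apply hφinj
      rw [hφapp, h, map_zero]
    have hab' : w * ((b : L) : ℂ) = ((a : L) : ℂ) := by
      have := congrArg Subtype.val hab
      simp only at this
      rw [← this]
      push_cast
      field_simp
    obtain ⟨s, c, hs, h⟩ := exists_dvd_of_prime_ideal P hPbot a b
    have hsum : ∃ u v : 𝓞 L, v ∉ P ∧ w * ((v : L) : ℂ) = ((u : L) : ℂ) := by
      rcases h with h | h
      · refine ⟨c, s, hs, ?_⟩
        have := congrArg φ h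
        rw [map_mul, map_mul, hφapp, hφapp, hφapp, hφapp] at this
        apply mul_right_cancel₀ hb0'
        linear_combination ((s : L) : ℂ) * hab' + this
      · have := congrArg φ h
        rw [map_mul, map_mul, hφapp, hφapp, hφapp, hφapp] at this
        have h2 : w * ((c : L) : ℂ) = ((s : L) : ℂ) := by
          apply mul_right_cancel₀ hb0'
          linear_combination ((c : L) : ℂ) * hab' - this
        refine ⟨s, c, fun hc => ?_, h2⟩
        have h3 := hunit s hs
        rw [hφapp, ← h2, map_mul] at h3
        have h4 := (mul_le_of_le_one_left' hwB).trans_lt (hnon c hc)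
        rw [hφapp] at h4
        exact h4.ne h3
    obtain ⟨u, v, hv, e⟩ := hsum
    refine ⟨p ^ m * u, v, Ideal.mul_mem_right _ _ (Ideal.pow_mem_pow hPp m), hv, ?_⟩
    rw [sub_zero, mul_assoc, e]
    push_cast
    rfl
  · obtain ⟨g, hg⟩ := LinearMap.exists_leftInverse_of_injective (Algebra.linearMap K ℂ)
      (LinearMap.ker_eq_bot.2 (FaithfulSMul.algebraMap_injective K ℂ))
    have hg' : ∀ z : K, g (z : ℂ) = z := fun z => by
      have := LinearMap.congr_fun hg z
      simpa using this
    refine ⟨(Algebra.linearMap K ℂ).toAddMonoidHom.comp g.toAddMonoidHom, ?_, ?_, ?_⟩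
    · intro z hz w
      have hzK : z ∈ K := hz.2
      have : g (z * w) = (⟨z, hzK⟩ : K) * g w := by
        have := g.map_smul (⟨z, hzK⟩ : K) w
        simpa [Algebra.smul_def] using this
      have h2 := congrArg (fun t : K => (t : ℂ)) this
      simpa using h2
    · intro z hz
      have hzK : z ∈ K := hz.2
      have := congrArg (fun t : K => (t : ℂ)) (hg' ⟨z, hzK⟩)
      simpa using this
    · intro w
      set y : K := g w
      have hyalg : IsAlgebraic ℤ (y : ℂ) := by
        rw [IsFractionRing.isAlgebraic_iff ℤ ℚ ℂ]
        exact (hKmem _).1 y.2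
      obtain ⟨n, hn0, hn⟩ := hyalg.exists_integral_multiple
      have hn0' : n.natAbs ≠ 0 := by simpa using hn0
      obtain ⟨D, n', hn', e⟩ := Nat.exists_eq_pow_mul_and_not_dvd hn0' p hp.ne_one
      refine ⟨D, ?_, K.mul_mem (K.pow_mem (natCast_mem K p) D) y.2⟩
      change (p : ℂ) ^ D * (y : ℂ) ∈ B
      have h1 : B.valuation (n • (y : ℂ)) ≤ 1 := (B.valuation_le_one_iff _).2 (h_int _ hn)
      rw [← B.valuation_le_one_iff]
      have h2 : B.valuation ((n.natAbs : ℂ) * y) ≤ 1 := by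
        rcases Int.natAbs_eq n with h | h
        · have h3 : (n : ℂ) = (n.natAbs : ℂ) := by
            rw [← Int.cast_natCast, ← h]
          rwa [zsmul_eq_mul, h3] at h1
        · have h3 : (n : ℂ) = -(n.natAbs : ℂ) := by
            rw [← Int.cast_natCast, ← Int.cast_neg, ← h]
          rwa [zsmul_eq_mul, h3, neg_mul, Valuation.map_neg] at h1
      rw [e] at h2
      push_cast at h2
      rw [mul_right_comm, map_mul, hvn n' hn', mul_one] at h2
      exact h2

/-- `F` transforms like a modular form of weight `k` on `SL₂(ℤ)`. -/
def LevelOneInv (k : ℕ) (F : ℍ → ℂ) : Prop :=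
  ∀ (σ : SL(2, ℤ)) (τ : ℍ), F (σ • τ) = denomC σ τ ^ k * F τ

lemma denomC_eq_denom (σ : SL(2, ℤ)) (τ : ℍ) : denomC σ τ = denom σ τ := by
  simp [denomC, denom]

lemma denomC_ne_zero (σ : SL(2, ℤ)) (τ : ℍ) : denomC σ τ ≠ 0 := by
  rw [denomC_eq_denom]
  exact denom_ne_zero _ _

open scoped ModularForm in
lemma slash_eq_iff (k : ℕ) (F : ℍ → ℂ) (σ : SL(2, ℤ)) :
    F ∣[(k : ℤ)] σ = F ↔ ∀ τ, F (σ • τ) = denomC σ τ ^ k * F τ := by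
  rw [funext_iff]
  refine forall_congr' fun τ => ?_
  have h := denomC_ne_zero σ τ
  rw [ModularForm.SL_slash_apply, ← denomC_eq_denom, _root_.zpow_neg, zpow_natCast,
    mul_inv_eq_iff_eq_mul₀ (pow_ne_zero _ h), mul_comm]

lemma affMap_one_one (τ : ℍ) : affMap 1 1 τ = ModularGroup.T • τ := by
  apply UpperHalfPlane.ext
  rw [coe_affMap one_pos, modular_T_smul, coe_vadd]
  push_cast; ring

lemma coe_S_smul (τ : ℍ) : ((ModularGroup.S • τ : ℍ) : ℂ) = -(τ : ℂ)⁻¹ := by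
  rw [modular_S_smul]
  simp [inv_neg]

lemma LevelOneInv.of_S_of_T {k : ℕ} {F : ℍ → ℂ} (hT : ∀ τ, F (affMap 1 1 τ) = F τ)
    (hS : ∀ τ, F (ModularGroup.S • τ) = (τ : ℂ) ^ k * F τ) : LevelOneInv k F := by
  intro σ
  rw [← slash_eq_iff]
  apply SlashInvariantForm.slash_action_generators_SL2Z
  · rw [slash_eq_iff]
    intro τ
    rw [hS]
    simp [denomC, ModularGroup.S]
  · rw [slash_eq_iff]
    intro τ
    rw [← affMap_one_one, hT]
    simp [denomC, ModularGroup.T]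

lemma LevelOneInv.S {k : ℕ} {F : ℍ → ℂ} (h : LevelOneInv k F) (τ : ℍ) :
    F (ModularGroup.S • τ) = (τ : ℂ) ^ k * F τ := by
  rw [h]
  simp [denomC, ModularGroup.S]

lemma LevelOneInv.mul {k l : ℕ} {F G : ℍ → ℂ} (hF : LevelOneInv k F) (hG : LevelOneInv l G) :
    LevelOneInv (k + l) (fun τ => F τ * G τ) := by
  intro σ τ
  simp only [hF σ τ, hG σ τ]
  ring

lemma LevelOneInv.pow {k : ℕ} {F : ℍ → ℂ} (hF : LevelOneInv k F) (n : ℕ) :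
    LevelOneInv (k * n) (fun τ => F τ ^ n) := by
  intro σ τ
  simp only [hF σ τ]
  ring

lemma exists_bernoulli_inv {p : ℕ} (hp : p.Prime) {R : Subring ℂ} (hR : LocalRootClosed p R)
    (k : ℕ) (hk : 0 < k) (h : p - 1 ∣ 2 * k) : ((bernoulli (2 * k) : ℚ) : ℂ)⁻¹ ∈ powIdeal p 1 R := by
  obtain ⟨z, hz⟩ := Bernoulli.vonStaudt_clausen k
  set s := Finset.filter (fun q => q.Prime ∧ (q - 1) ∣ 2 * k) (Finset.range (2 * k + 2)) with hs
  have hps : p ∈ s := by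
    rw [hs, Finset.mem_filter, Finset.mem_range]
    refine ⟨?_, hp, h⟩
    have := Nat.le_of_dvd (by omega) h
    omega
  rw [← Finset.add_sum_erase s _ hps] at hz
  have hprime : ∀ q ∈ s.erase p, q.Prime ∧ q ≠ p := fun q hq =>
    ⟨(Finset.mem_filter.1 (Finset.mem_of_mem_erase hq)).2.1, Finset.ne_of_mem_erase hq⟩
  have hD : ¬ p ∣ ∏ q ∈ s.erase p, q := by
    rw [hp.prime.dvd_finsetProd_iff]
    rintro ⟨q, hq, hpq⟩
    exact (hprime q hq).2 ((Nat.prime_dvd_prime_iff_eq hp (hprime q hq).1).1 hpq).symm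
  set D : ℕ := ∏ q ∈ s.erase p, q with hDdef
  obtain ⟨t, ht⟩ : ∃ t : ℕ, (D : ℚ) * ∑ q ∈ s.erase p, (1 : ℚ) / q = t := by
    refine ⟨∑ q ∈ s.erase p, ∏ q' ∈ (s.erase p).erase q, q', ?_⟩
    rw [Finset.mul_sum, Nat.cast_sum]
    refine Finset.sum_congr rfl fun q hq => ?_
    have : (q : ℚ) ≠ 0 := by exact_mod_cast (hprime q hq).1.ne_zero
    rw [hDdef, ← Finset.mul_prod_erase _ _ hq]
    push_cast
    field_simp
  have hp0 : (p : ℚ) ≠ 0 := by exact_mod_cast hp.ne_zero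
  set n : ℤ := p * z * D - D - p * t with hn
  have hn' : (p : ℚ) * D * bernoulli (2 * k) = n := by
    rw [hn]
    push_cast
    rw [← ht, hz]
    field_simp
    ring
  have hpn : ¬ p ∣ n.natAbs := by
    rw [← Int.natCast_dvd]
    intro hdvd
    apply hD
    have : (p : ℤ) ∣ D := by
      have h2 : (D : ℤ) = p * (z * D - t) - n := by rw [hn]; ring
      rw [h2]
      exact dvd_sub (dvd_mul_right _ _) hdvd
    exact_mod_cast this
  have hn0 : n ≠ 0 := by
    rintro h0
    simp [h0] at hpn
  have hninv : ((n : ℂ))⁻¹ ∈ R := by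
    rcases Int.natAbs_eq n with h1 | h1
    · rw [h1, Int.cast_natCast]
      exact hR.inv_mem _ hpn
    · rw [h1, Int.cast_neg, Int.cast_natCast, inv_neg]
      exact R.neg_mem (hR.inv_mem _ hpn)
  refine ⟨D * (n : ℂ)⁻¹, R.mul_mem (natCast_mem R D) hninv, ?_⟩
  have hnC : (p : ℂ) * D * (bernoulli (2 * k) : ℚ) = n := by exact_mod_cast congrArg (Rat.cast : ℚ → ℂ) hn'
  have hn0' : (n : ℂ) ≠ 0 := by exact_mod_cast hn0
  have hB0 : ((bernoulli (2 * k) : ℚ) : ℂ) ≠ 0 := by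
    intro h0
    rw [h0, mul_zero] at hnC
    exact hn0' hnC.symm
  simp only [AddMonoidHom.coe_mulLeft, pow_one]
  field_simp
  rw [hnC]

/-- Multiples of `p - 1` are weights of Eisenstein series congruent to `1` modulo `p`. -/
lemma exists_eisenstein {p : ℕ} (hp : p.Prime) {R : Subring ℂ} (hR : LocalRootClosed p R)
    (k : ℕ) (hk : 2 ≤ k) (h : p - 1 ∣ 2 * k) :
    ∃ E x, HasExp 1 x E ∧ LevelOneInv (2 * k) E ∧ x ∈ sparseSeries p 1 0 R ∧
      PowerSeries.coeff 0 x = 1 := by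
  have hk3 : 3 ≤ 2 * k := by omega
  have hk2 : Even (2 * k) := even_two_mul k
  refine ⟨ModularForm.E hk3, qExpansion 1 (ModularForm.E hk3), ?_, ?_, ?_,
    EisensteinSeries.E_qExpansion_coeff_zero hk3 hk2⟩
  · have hper := SlashInvariantFormClass.periodic_comp_ofComplex (ModularForm.E hk3)
      one_mem_strictPeriods_SL
    rw [← Nat.cast_one] at hper
    have := HasExp.of_periodic (h := 1) one_pos hper
      (ModularFormClass.holo (ModularForm.E hk3)) (ModularFormClass.bdd_at_infty _)
    rwa [Nat.cast_one] at this
  · intro σ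
    rw [← slash_eq_iff]
    exact SlashInvariantForm.slash_action_eqn _ _ (MonoidHom.mem_range.mpr ⟨σ, rfl⟩)
  · intro i
    have key : i ≠ 0 → PowerSeries.coeff i (qExpansion 1 (ModularForm.E hk3)) ∈ powIdeal p 1 R := by
      intro hi
      rw [EisensteinSeries.E_qExpansion_coeff hk3 hk2, if_neg hi, div_eq_mul_inv, neg_mul]
      refine neg_mem (mul_mem_powIdeal_right (mul_mem_powIdeal_left ?_
        (exists_bernoulli_inv hp hR k (by omega) h)) (natCast_mem R _))
      exact R.mul_mem (ofNat_mem R 2) (natCast_mem R _)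
    refine ⟨?_, fun hi => key (by simpa using hi)⟩
    rcases eq_or_ne i 0 with rfl | hi
    · rw [EisensteinSeries.E_qExpansion_coeff_zero hk3 hk2]
      exact R.one_mem
    · exact powIdeal_le (key hi)

section heckeOrbit

variable (p : ℕ)

/-- The translates of a level one form under the integral matrices of determinant `p`. -/
def heckeTerm (k : ℕ) (G : ℍ → ℂ) : Option (ZMod p) → ℍ → ℂ
  | none => fun τ => (p : ℂ) ^ k * G (affMap p 0 τ)
  | some i => fun τ => G (affMap (p : ℝ)⁻¹ ((i.val : ℝ) / p) τ)

/-- The permutation of the Hecke translates induced by `S`. -/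
def heckeSwap [Fact p.Prime] : Equiv.Perm (Option (ZMod p)) :=
  Function.Involutive.toPerm
    (fun j => j.elim (some 0) fun i => if i = 0 then none else some (-i⁻¹)) (by
      rintro (_ | i)
      · simp
      · by_cases h : i = 0 <;> simp [h, inv_neg])

variable {p} {k : ℕ} {G : ℍ → ℂ}

lemma apply_affMap_intCast {x : PowerSeries ℂ} (h : HasExp 1 x G) {τ τ' : ℍ} (n : ℤ)
    (e : (τ' : ℂ) = τ + n) : G τ' = G τ := by
  have hper := (h.periodic one_pos).int_mul n (τ : ℂ)
  simp only [Function.comp_apply, ofComplex_apply, Nat.cast_one, ofReal_one, mul_one] at hper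
  rw [← hper, ← e, ofComplex_apply]

lemma heckeTerm_T [Fact p.Prime] {x : PowerSeries ℂ} (h : HasExp 1 x G) (j : Option (ZMod p)) (τ : ℍ) :
    heckeTerm p k G j (affMap 1 1 τ) = heckeTerm p k G (Equiv.optionCongr (Equiv.addRight 1) j) τ := by
  have hp0 : (0 : ℝ) < p := by exact_mod_cast (Fact.out : p.Prime).pos
  have hp0' : (p : ℂ) ≠ 0 := by exact_mod_cast (Fact.out : p.Prime).ne_zero
  rcases j with _ | i
  · simp only [heckeTerm, Equiv.optionCongr_apply, Option.map_none]
    congr 1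
    refine apply_affMap_intCast h p ?_
    rw [coe_affMap hp0, coe_affMap hp0, coe_affMap one_pos]
    push_cast
    ring
  · simp only [heckeTerm, Equiv.optionCongr_apply, Option.map_some, Equiv.coe_addRight]
    have hd : (p : ℤ) ∣ (i.val : ℤ) + 1 - (i + 1).val := by
      rw [← ZMod.intCast_zmod_eq_zero_iff_dvd]
      simp
    obtain ⟨n, hn⟩ := hd
    refine apply_affMap_intCast h n ?_
    rw [coe_affMap (inv_pos.2 hp0), coe_affMap (inv_pos.2 hp0), coe_affMap one_pos]
    have hn' : ((i.val : ℂ)) + 1 - ((i + 1).val : ℂ) = p * n := by exact_mod_cast hn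
    push_cast
    field_simp
    linear_combination hn'

lemma heckeTerm_S [Fact p.Prime] (h : LevelOneInv k G) (j : Option (ZMod p)) (τ : ℍ) :
    heckeTerm p k G j (ModularGroup.S • τ) = (τ : ℂ) ^ k * heckeTerm p k G (heckeSwap p j) τ := by
  have hp0 : (0 : ℝ) < p := by exact_mod_cast (Fact.out : p.Prime).pos
  have hp0' : (p : ℂ) ≠ 0 := by exact_mod_cast (Fact.out : p.Prime).ne_zero
  have hτ : (τ : ℂ) ≠ 0 := τ.ne_zero
  rcases j with _ | i
  · have e : affMap p 0 (ModularGroup.S • τ) = ModularGroup.S • affMap (p : ℝ)⁻¹ 0 τ := by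
      apply UpperHalfPlane.ext
      rw [coe_affMap hp0, coe_S_smul, coe_S_smul, coe_affMap (inv_pos.2 hp0)]
      push_cast
      simp only [add_zero]
      field_simp
    have e2 : heckeSwap p none = some 0 := rfl
    rw [e2]
    simp only [heckeTerm]
    rw [e, h.S, coe_affMap (inv_pos.2 hp0)]
    simp only [ZMod.val_zero, Nat.cast_zero, zero_div]
    push_cast
    rw [add_zero, mul_pow, inv_pow]
    field_simp
  · by_cases hi : i = 0
    · subst hi
      have e2 : heckeSwap p (some 0) = none := if_pos rfl
      have e : affMap (p : ℝ)⁻¹ 0 (ModularGroup.S • τ) = ModularGroup.S • affMap p 0 τ := by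
        apply UpperHalfPlane.ext
        rw [coe_affMap (inv_pos.2 hp0), coe_S_smul, coe_S_smul, coe_affMap hp0]
        push_cast
        simp only [add_zero]
        field_simp
      rw [e2]
      simp only [heckeTerm, ZMod.val_zero, Nat.cast_zero, zero_div]
      rw [e, h.S, coe_affMap hp0]
      push_cast
      ring
    · have e2 : heckeSwap p (some i) = some (-i⁻¹) := if_neg hi
      rw [e2]
      simp only [heckeTerm]
      set i' : ZMod p := -i⁻¹ with hi'
      have hd : (p : ℤ) ∣ (i.val : ℤ) * i'.val + 1 := by
        rw [← ZMod.intCast_zmod_eq_zero_iff_dvd]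
        push_cast
        rw [ZMod.natCast_zmod_val, ZMod.natCast_zmod_val, hi']
        field_simp
        simp
      obtain ⟨n, hn⟩ := hd
      let γ : SL(2, ℤ) := ⟨!![i.val, -n; p, -i'.val], by rw [Matrix.det_fin_two_of]; linarith⟩
      have hden : denomC γ (affMap (p : ℝ)⁻¹ ((i'.val : ℝ) / p) τ) = τ := by
        rw [denomC, coe_affMap (inv_pos.2 hp0)]
        simp [γ, -ZMod.natCast_val]
        field_simp
        ring
      have e : affMap (p : ℝ)⁻¹ ((i.val : ℝ) / p) (ModularGroup.S • τ) =
          γ • affMap (p : ℝ)⁻¹ ((i'.val : ℝ) / p) τ := by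
        apply UpperHalfPlane.ext
        have h1 := hden
        rw [coe_affMap (inv_pos.2 hp0), coe_S_smul, specialLinearGroup_apply]
        rw [denomC] at h1
        simp only [algebraMap_int_eq, eq_intCast, ofReal_intCast]
        rw [h1, coe_affMap (inv_pos.2 hp0)]
        have hn' : ((i.val : ℂ)) * (i'.val : ℂ) + 1 = p * n := by exact_mod_cast hn
        simp [γ, -ZMod.natCast_val]
        field_simp
        linear_combination -hn'
      rw [e, h, hden]

end heckeOrbit

section

variable {p m q : ℕ} {R : Subring ℂ} {x y : PowerSeries ℂ}

lemma C_mul_mem_sparseSeries {c : ℂ} (hc : c ∈ powIdeal p m R)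
    (hx : ∀ i, PowerSeries.coeff i x ∈ R) (q : ℕ) : PowerSeries.C c * x ∈ sparseSeries p m q R := by
  intro i
  have : PowerSeries.coeff i (PowerSeries.C c * x) ∈ powIdeal p m R := by
    rw [PowerSeries.coeff_C_mul]
    exact mul_mem_powIdeal_right hc (hx i)
  exact ⟨powIdeal_le this, fun _ => this⟩

lemma sparseSeries_zero_le (q : ℕ) : sparseSeries p m 0 R ≤ sparseSeries p m q R :=
  fun _ hx i => ⟨(hx i).1, fun h => (hx i).2 fun h0 => h (by rw [zero_dvd_iff.1 h0]; exact dvd_zero q)⟩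

/-- Integral series with coefficients in `p^m R` are `p^m` times an integral series. -/
lemma exists_eq_C_mul_of_mem_powIdeal (hx : ∀ i, PowerSeries.coeff i x ∈ powIdeal p m R) :
    ∃ y : PowerSeries ℂ, (∀ i, PowerSeries.coeff i y ∈ R) ∧ x = PowerSeries.C ((p : ℂ) ^ m) * y := by
  choose z hz e using hx
  refine ⟨PowerSeries.mk z, fun i => by rw [PowerSeries.coeff_mk]; exact hz i, ?_⟩
  ext i
  rw [PowerSeries.coeff_C_mul, PowerSeries.coeff_mk]
  exact (e i).symm

lemma pow_mem_sparseSeries_zero (hx : x ∈ sparseSeries p 1 0 R) (k : ℕ) :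
    x ^ p ^ k ∈ sparseSeries p (k + 1) 0 R := by
  have hx1 : x ∈ sparseSeries p 0 1 R := sparseSeries_le_one 0 hx
  have hc : PowerSeries.C (PowerSeries.coeff 0 x) ∈ sparseSeries p 0 1 R :=
    C_mem_sparseSeries (hx 0).1
  obtain ⟨y, hy, e⟩ := exists_eq_C_mul_of_mem_powIdeal (p := p) (m := 1) (R := R)
    (x := x - PowerSeries.C (PowerSeries.coeff 0 x)) (fun i => by
      rw [map_sub, PowerSeries.coeff_C]
      split_ifs with h
      · rw [h, sub_self]
        exact zero_mem _
      · rw [sub_zero]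
        exact (hx i).2 (by simpa using h))
  have hpC : PowerSeries.C ((p : ℂ) ^ 1) = (p : PowerSeries ℂ) := by simp
  have hdvd : ((p : sparseSeries p 0 1 R)) ∣ (⟨x, hx1⟩ : sparseSeries p 0 1 R) - ⟨_, hc⟩ := by
    refine ⟨⟨y, mem_sparseSeries_one.2 hy⟩, ?_⟩
    apply Subtype.ext
    rw [hpC] at e
    simpa using e
  obtain ⟨z, hz⟩ := dvd_sub_pow_of_dvd_sub hdvd k
  have hz' := congrArg Subtype.val hz
  simp only [AddSubgroupClass.coe_sub, SubmonoidClass.coe_pow, MulMemClass.coe_mul] at hz'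
  rw [eq_add_of_sub_eq hz']
  refine add_mem ?_ (pow_mem (C_mem_sparseSeries (hx 0).1) _)
  have h3 : ((p : sparseSeries p 0 1 R) : PowerSeries ℂ) = PowerSeries.C (p : ℂ) := by simp
  rw [h3, ← map_pow]
  refine C_mul_mem_sparseSeries ⟨1, R.one_mem, by simp⟩ (mem_sparseSeries_one.1 z.2) _

end

/-- Level one forms with `R`-integral expansion `x` supported on multiples of `q` modulo `p^m`,
constant modulo `p`, with invertible constant term. -/
structure SparseForm (p m q : ℕ) (R : Subring ℂ) (k : ℕ) (F : ℍ → ℂ) (x : PowerSeries ℂ) : Prop where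
  hasExp : HasExp 1 x F
  inv : LevelOneInv k F
  sparse : x ∈ sparseSeries p m q R
  congr : x ∈ sparseSeries p 1 0 R
  ne_zero : PowerSeries.coeff 0 x ≠ 0
  inv_mem : (PowerSeries.coeff 0 x)⁻¹ ∈ R

namespace SparseForm

variable {p m q : ℕ} {R : Subring ℂ} {k l : ℕ} {F G : ℍ → ℂ} {x y : PowerSeries ℂ}

lemma mul (hF : SparseForm p m q R k F x) (hG : SparseForm p m q R l G y) :
    SparseForm p m q R (k + l) (fun τ => F τ * G τ) (x * y) where
  hasExp := hF.hasExp.mul hG.hasExp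
  inv := hF.inv.mul hG.inv
  sparse := mul_mem hF.sparse hG.sparse
  congr := mul_mem hF.congr hG.congr
  ne_zero := by
    have h1 := hF.ne_zero
    have h2 := hG.ne_zero
    rw [PowerSeries.coeff_zero_eq_constantCoeff_apply] at h1 h2 ⊢
    rw [map_mul]
    exact mul_ne_zero h1 h2
  inv_mem := by
    have h1 := hF.inv_mem
    have h2 := hG.inv_mem
    rw [PowerSeries.coeff_zero_eq_constantCoeff_apply] at h1 h2 ⊢
    rw [map_mul, mul_inv]
    exact mul_mem h1 h2

lemma pow_aux (hF : SparseForm p 0 1 R k F x) (n : ℕ) (h : x ^ n ∈ sparseSeries p m q R) :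
    SparseForm p m q R (k * n) (fun τ => F τ ^ n) (x ^ n) where
  hasExp := hF.hasExp.pow n
  inv := hF.inv.pow n
  sparse := h
  congr := pow_mem hF.congr n
  ne_zero := by
    have h1 := hF.ne_zero
    rw [PowerSeries.coeff_zero_eq_constantCoeff_apply] at h1 ⊢
    rw [map_pow]
    exact pow_ne_zero _ h1
  inv_mem := by
    have h1 := hF.inv_mem
    rw [PowerSeries.coeff_zero_eq_constantCoeff_apply] at h1 ⊢
    rw [map_pow, ← inv_pow]
    exact pow_mem h1 n

lemma pow (hF : SparseForm p 0 1 R k F x) (n : ℕ) :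
    SparseForm p m 1 R (k * n) (fun τ => F τ ^ n) (x ^ n) :=
  hF.pow_aux n (pow_mem (sparseSeries_le_one _ hF.sparse) n)

lemma pow_of_dvd (hF : SparseForm p 0 1 R k F x) {n : ℕ} (hn : p ^ m ∣ n) :
    SparseForm p m q R (k * n) (fun τ => F τ ^ n) (x ^ n) := by
  obtain ⟨n', rfl⟩ := hn
  refine hF.pow_aux _ ?_
  rw [pow_mul]
  refine pow_mem (fun i => ?_) n'
  have h := sparseSeries_zero_le q (pow_mem_sparseSeries_zero hF.congr m) i
  exact ⟨h.1, fun hi => powIdeal_anti (Nat.le_succ m) (h.2 hi)⟩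

end SparseForm

lemma heckeTerm_hasExp {p : ℕ} (hp : p ≠ 0) (k : ℕ) {G : ℍ → ℂ} {x : PowerSeries ℂ} (h : HasExp 1 x G)
    (i : ZMod p) : HasExp p
      (PowerSeries.rescale (Complex.exp (2 * π * Complex.I * (i.val : ℝ) / (p * (1 : ℕ)))) x)
      (heckeTerm p k G (some i)) := by
  have := h.comp_div hp (i.val : ℝ)
  rwa [mul_one] at this

lemma exp_root_mem {p : ℕ} (hp : p ≠ 0) {R : Subring ℂ} (hR : LocalRootClosed p R) (t : ℕ) :
    Complex.exp (2 * π * Complex.I * (t : ℝ) / (p * (1 : ℕ))) ∈ R := by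
  refine hR.root_mem p _ (Nat.pos_of_ne_zero hp) ?_
  rw [← Complex.exp_nat_mul]
  have hp0 : (p : ℂ) ≠ 0 := by exact_mod_cast hp
  have : (p : ℂ) * (2 * π * Complex.I * (t : ℝ) / (p * (1 : ℕ))) = t * (2 * π * Complex.I) := by
    push_cast
    field_simp
  rw [this, Complex.exp_nat_mul, Complex.exp_two_pi_mul_I, one_pow]
  exact R.one_mem

lemma SparseForm.hecke_step {p m q e k : ℕ} (hp : p.Prime) {R : Subring ℂ} (hR : LocalRootClosed p R)
    {E K : ℍ → ℂ} {x y : PowerSeries ℂ} (he : 0 < e) (hE : SparseForm p 0 1 R e E y)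
    (hy : PowerSeries.coeff 0 y = 1) (hm : 1 ≤ m)
    (hK : SparseForm p m q R k K x) {M : ℕ} (hM : p ^ m ∣ M) (hkM : k + m ≤ M) :
    ∃ K' x', SparseForm p m (p * q) R (k + e * M) K' x' := by
  have := Fact.mk hp
  have hp0 : p ≠ 0 := hp.ne_zero
  have hp0' : (p : ℂ) ≠ 0 := by exact_mod_cast hp0
  have hyR : ∀ i, PowerSeries.coeff i y ∈ R := fun i => (hE.sparse i).1
  have hxR : ∀ i, PowerSeries.coeff i x ∈ R := fun i => (hK.sparse i).1
  set F : Option (ZMod p) → ℍ → ℂ := fun j τ =>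
    heckeTerm p k K j τ * (E τ - heckeTerm p e E j τ) ^ M with hF
  set K' : ℍ → ℂ := fun τ => ((p : ℂ) ^ k)⁻¹ * ∑ j, F j τ with hK'
  have hT : ∀ τ, K' (affMap 1 1 τ) = K' τ := by
    intro τ
    have hET : E (affMap 1 1 τ) = E τ :=
      apply_affMap_intCast hE.hasExp 1 (by rw [coe_affMap one_pos]; push_cast; ring)
    simp only [hK', hF]
    congr 1
    rw [← Equiv.sum_comp (Equiv.optionCongr (Equiv.addRight (1 : ZMod p)))
      (fun j => heckeTerm p k K j τ * (E τ - heckeTerm p e E j τ) ^ M)]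
    refine Finset.sum_congr rfl fun j _ => ?_
    rw [heckeTerm_T hK.hasExp, heckeTerm_T hE.hasExp, hET]
  have hS : ∀ τ, K' (ModularGroup.S • τ) = (τ : ℂ) ^ (k + e * M) * K' τ := by
    intro τ
    simp only [hK', hF]
    rw [mul_left_comm]
    congr 1
    rw [← Equiv.sum_comp (heckeSwap p)
      (fun j => heckeTerm p k K j τ * (E τ - heckeTerm p e E j τ) ^ M), Finset.mul_sum]
    refine Finset.sum_congr rfl fun j _ => ?_
    rw [heckeTerm_S hK.inv, heckeTerm_S hE.inv, hE.inv.S, ← mul_sub, mul_pow, ← pow_mul, pow_add]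
    ring
  set H := y - PowerSeries.C ((p : ℂ) ^ e) * PowerSeries.expand p hp0 y with hHdef
  set a := PowerSeries.expand p hp0 x * H ^ M with ha
  set ζ : ZMod p → ℂ := fun i => Complex.exp (2 * π * Complex.I * (i.val : ℝ) / (p * (1 : ℕ))) with hζ
  set d : ZMod p → PowerSeries ℂ := fun i => PowerSeries.expand p hp0 y - PowerSeries.rescale (ζ i) y with hd
  set r : ZMod p → PowerSeries ℂ := fun i =>
    PowerSeries.C (((p : ℂ) ^ k)⁻¹) * (PowerSeries.rescale (ζ i) x * d i ^ M) with hr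
  have hexp : HasExp (p * 1) (PowerSeries.expand p hp0 a + ∑ i, r i) K' := by
    have h1 : HasExp 1 a (fun τ => ((p : ℂ) ^ k)⁻¹ * F none τ) := by
      refine ((hK.hasExp.comp_mul hp0).mul ((hE.hasExp.sub
        ((hE.hasExp.comp_mul hp0).const_mul ((p : ℂ) ^ e))).pow M)).congr_fun fun τ => ?_
      simp only [hF, heckeTerm]
      rw [mul_assoc, inv_mul_cancel_left₀ (pow_ne_zero _ hp0')]
    have h2 : ∀ i : ZMod p, HasExp (p * 1) (r i) (fun τ => ((p : ℂ) ^ k)⁻¹ * F (some i) τ) := by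
      intro i
      have h3 := hE.hasExp.expand hp0
      rw [mul_one] at h3 ⊢
      exact ((heckeTerm_hasExp hp0 k hK.hasExp i).mul
        ((h3.sub (heckeTerm_hasExp hp0 e hE.hasExp i)).pow M)).const_mul _
    refine ((h1.expand hp0).add (HasExp.sum Finset.univ fun i _ => h2 i)).congr_fun fun τ => ?_
    simp only [hK', Fintype.sum_option, mul_add, Finset.mul_sum]
  obtain ⟨x', hx', e'⟩ := hexp.descend one_pos hp0 (by simpa using hT)
  have hdp : ∀ i, ∃ d' : PowerSeries ℂ, (∀ j, PowerSeries.coeff j d' ∈ R) ∧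
      d i = PowerSeries.C ((p : ℂ) ^ 1) * d' := by
    intro i
    refine exists_eq_C_mul_of_mem_powIdeal fun j => ?_
    simp only [hd, map_sub, PowerSeries.coeff_rescale]
    rcases eq_or_ne j 0 with rfl | hj
    · rw [PowerSeries.coeff_zero_eq_constantCoeff_apply, PowerSeries.constantCoeff_expand,
        ← PowerSeries.coeff_zero_eq_constantCoeff_apply]
      simp
    · refine sub_mem ?_ (mul_mem_powIdeal_left (pow_mem (exp_root_mem hp0 hR _) j)
        ((hE.congr j).2 (by simpa using hj)))
      exact (expand_mem_sparseSeries hE.congr hp0 j).2 (by simpa using hj)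
  have hrp : ∀ i j, PowerSeries.coeff j (r i) ∈ powIdeal p m R := by
    intro i j
    obtain ⟨d', hd', ed⟩ := hdp i
    have e1 : r i = PowerSeries.C ((p : ℂ) ^ (M - k)) * (PowerSeries.rescale (ζ i) x * d' ^ M) := by
      have e2 : (p : ℂ) ^ (M - k) = ((p : ℂ) ^ k)⁻¹ * (p : ℂ) ^ M := by
        rw [pow_sub₀ _ hp0' (by omega), mul_comm]
      simp only [hr, ed, pow_one]
      rw [e2, mul_pow, ← map_pow, map_mul]
      ring
    rw [e1, PowerSeries.coeff_C_mul]
    refine mul_mem_powIdeal_right (powIdeal_anti (m' := M - k) (by omega) ⟨1, R.one_mem, by simp⟩) ?_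
    refine mem_sparseSeries_one.1 ((sparseSeries p 0 1 R).mul_mem ?_
      (pow_mem (mem_sparseSeries_one.2 hd') M)) j
    refine mem_sparseSeries_one.2 fun l => ?_
    rw [PowerSeries.coeff_rescale]
    exact R.mul_mem (pow_mem (exp_root_mem hp0 hR _) l) (hxR l)
  have hr0 : ∀ i, PowerSeries.coeff 0 (r i) = 0 := by
    intro i
    have hM0 : M ≠ 0 := by omega
    have : PowerSeries.constantCoeff (d i) = 0 := by
      simp only [hd, map_sub, PowerSeries.constantCoeff_expand]
      rw [← PowerSeries.coeff_zero_eq_constantCoeff_apply,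
        ← PowerSeries.coeff_zero_eq_constantCoeff_apply, PowerSeries.coeff_rescale]
      simp
    rw [PowerSeries.coeff_zero_eq_constantCoeff_apply]
    simp only [hr, map_mul, map_pow, this, zero_pow hM0, mul_zero]
  have hcoeff : ∀ n, PowerSeries.coeff n x' =
      PowerSeries.coeff n a + ∑ i, PowerSeries.coeff (p * n) (r i) := by
    intro n
    have := congrArg (PowerSeries.coeff (p * n)) e'
    rw [PowerSeries.coeff_expand_mul, map_add, PowerSeries.coeff_expand_mul, map_sum] at this
    exact this.symm
  have hHs : H ∈ sparseSeries p 1 0 R := by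
    refine sub_mem hE.congr (C_mul_mem_sparseSeries ?_ (fun i => ?_) 0)
    · exact powIdeal_anti (m' := e) he ⟨1, R.one_mem, by simp⟩
    · exact (expand_mem_sparseSeries hE.sparse hp0 i).1
  have hHM : H ^ M ∈ sparseSeries p m 0 R := by
    obtain ⟨n', rfl⟩ := hM
    rw [pow_mul]
    refine pow_mem (fun i => ?_) n'
    have h := pow_mem_sparseSeries_zero hHs m i
    exact ⟨h.1, fun hi => powIdeal_anti (Nat.le_succ m) (h.2 hi)⟩
  have ha1 : a ∈ sparseSeries p m (p * q) R := by
    refine mul_mem ?_ (sparseSeries_zero_le _ hHM)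
    intro i
    refine ⟨(expand_mem_sparseSeries hK.sparse hp0 i).1, fun hi => ?_⟩
    by_cases hpi : p ∣ i
    · obtain ⟨j, rfl⟩ := hpi
      rw [PowerSeries.coeff_expand_mul]
      exact (hK.sparse j).2 fun h => hi (mul_dvd_mul_left p h)
    · rw [PowerSeries.coeff_expand_of_not_dvd _ _ _ hpi]
      exact zero_mem _
  have ha2 : a ∈ sparseSeries p 1 0 R :=
    mul_mem (expand_mem_sparseSeries hK.congr hp0) (pow_mem hHs M)
  have hrs : ∀ n, ∑ i, PowerSeries.coeff (p * n) (r i) ∈ powIdeal p m R :=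
    fun n => sum_mem fun i _ => hrp i _
  have hx0 : PowerSeries.coeff 0 x' = PowerSeries.coeff 0 x * (1 - (p : ℂ) ^ e) ^ M := by
    rw [hcoeff, mul_zero, Finset.sum_congr rfl fun i _ => hr0 i, Finset.sum_const_zero, add_zero]
    rw [PowerSeries.coeff_zero_eq_constantCoeff_apply] at hy ⊢
    rw [ha, hHdef]
    simp [hy, PowerSeries.constantCoeff_expand]
  have hpe1 : 1 < p ^ e := Nat.one_lt_pow he.ne' hp.one_lt
  have hpe : (1 - (p : ℂ) ^ e) = -((p ^ e - 1 : ℕ) : ℂ) := by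
    rw [Nat.cast_sub hpe1.le]
    push_cast
    ring
  have hpe0 : ((p ^ e - 1 : ℕ) : ℂ) ≠ 0 := by
    have : p ^ e - 1 ≠ 0 := by omega
    exact_mod_cast this
  refine ⟨K', x', hx', LevelOneInv.of_S_of_T hT hS, ?_, ?_, ?_, ?_⟩
  · intro n
    rw [hcoeff]
    exact ⟨add_mem (ha1 n).1 (powIdeal_le (hrs n)), fun h => add_mem ((ha1 n).2 h) (hrs n)⟩
  · intro n
    rw [hcoeff]
    exact ⟨add_mem (ha2 n).1 (powIdeal_le (hrs n)),
      fun h => add_mem ((ha2 n).2 h) (powIdeal_anti hm (hrs n))⟩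
  · rw [hx0, hpe]
    exact mul_ne_zero hK.ne_zero (pow_ne_zero _ (neg_ne_zero.2 hpe0))
  · rw [hx0, hpe, mul_inv, ← inv_pow, inv_neg]
    refine R.mul_mem hK.inv_mem (pow_mem (R.neg_mem (hR.inv_mem _ ?_)) M)
    intro h
    have h2 : p ∣ p ^ e := dvd_pow_self p he.ne'
    have h3 : p ∣ 1 := by
      have := Nat.dvd_sub h2 h
      rwa [Nat.sub_sub_self hpe1.le] at this
    exact hp.one_lt.not_ge (Nat.le_of_dvd one_pos h3)

section

variable {p m : ℕ} {R : Subring ℂ}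

lemma exists_sparseForm_of_eisenstein (hp : p.Prime) (hR : LocalRootClosed p R) (hm : 1 ≤ m)
    {e : ℕ} (he : 0 < e) {E : ℍ → ℂ} {y : PowerSeries ℂ} (hE : SparseForm p 0 1 R e E y)
    (hy : PowerSeries.coeff 0 y = 1) (n k : ℕ) :
    ∃ W₀ : ℕ, ∀ W ≥ W₀, ∃ F x, SparseForm p m (p ^ n) R (e * (k + p ^ m * W)) F x := by
  induction n with
  | zero => exact ⟨0, fun W _ => ⟨_, _, hE.pow _⟩⟩
  | succ n ih =>
    obtain ⟨W₀, h⟩ := ih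
    obtain ⟨F, x, hF⟩ := h W₀ le_rfl
    refine ⟨W₀ + (e * (k + p ^ m * W₀) + m), fun W hW => ?_⟩
    obtain ⟨W', rfl⟩ := Nat.exists_eq_add_of_le (le_trans (Nat.le_add_right _ _) hW)
    have hp1 : 1 ≤ p ^ m := Nat.one_le_pow _ _ hp.pos
    have hW' : e * (k + p ^ m * W₀) + m ≤ p ^ m * W' := by
      calc _ ≤ W' := by omega
        _ ≤ p ^ m * W' := Nat.le_mul_of_pos_left _ hp1
    obtain ⟨K, z, hK⟩ := SparseForm.hecke_step hp hR he hE hy hm hF (Dvd.intro W' rfl) hW'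
    refine ⟨K, z, ?_⟩
    have e1 : e * (k + p ^ m * (W₀ + W')) = e * (k + p ^ m * W₀) + e * (p ^ m * W') := by ring
    rwa [e1, pow_succ']

/-- For every large weight divisible by `p - 1` there is a level one form, with coefficients
divisible by `p ^ m` away from exponents divisible by `p ^ b`, and with unit constant term. -/
lemma exists_sparseForm (hp : p.Prime) (hp3 : 3 ≤ p) (hR : LocalRootClosed p R) (hm : 1 ≤ m)
    (b : ℕ) : ∃ κ₀ : ℕ, ∀ κ ≥ κ₀, p - 1 ∣ κ → ∃ F x, SparseForm p m (p ^ b) R κ F x := by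
  have hodd : Odd p := hp.odd_of_ne_two (by omega)
  obtain ⟨w, hw⟩ : ∃ w, p = 2 * w + 1 := hodd
  have key : ∀ k : ℕ, 2 ≤ k → p - 1 ∣ 2 * k → ∃ E y, SparseForm p 0 1 R (2 * k) E y ∧
      PowerSeries.coeff 0 y = 1 := by
    intro k hk hd
    obtain ⟨E, y, h1, h2, h3, h4⟩ := exists_eisenstein hp hR k hk hd
    exact ⟨E, y, ⟨h1, h2, sparseSeries_le_one 0 h3, h3, by simp [h4], by simp [h4]⟩, h4⟩
  obtain ⟨E, y, hE, hy⟩ := key (2 * w) (by omega) (by rw [hw]; exact ⟨2, by simp; ring⟩)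
  obtain ⟨E', y', hE', hy'⟩ := key (3 * w) (by omega) (by rw [hw]; exact ⟨3, by simp; ring⟩)
  choose W₀ hW₀ using exists_sparseForm_of_eisenstein hp hR hm (by omega) hE hy b
  set Wm := (Finset.range (p ^ m)).sup W₀ with hWm
  have hpm : 0 < p ^ m := pow_pos hp.pos _
  refine ⟨(p - 1) * (3 * p ^ m + 2 * (p ^ m * (Wm + 1))), fun κ hκ ⟨u, hu⟩ => ?_⟩
  have hu1 : 3 * p ^ m + 2 * (p ^ m * (Wm + 1)) ≤ u := by
    rw [hu] at hκ
    exact Nat.le_of_mul_le_mul_left hκ (by omega)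
  obtain ⟨δ, t, hδ, ht⟩ : ∃ δ t : ℕ, δ ≤ 1 ∧ u = 2 * t + 3 * (p ^ m * δ) := by
    obtain ⟨s, hs⟩ : Odd (p ^ m) := (hp.odd_of_ne_two (by omega)).pow
    rcases Nat.even_or_odd' u with ⟨v, hv | hv⟩
    · exact ⟨0, v, by omega, by omega⟩
    · exact ⟨1, v - 3 * s - 1, le_rfl, by rw [mul_one]; omega⟩
  have ht1 : p ^ m * (Wm + 1) ≤ t := by
    have : p ^ m * δ ≤ p ^ m := by
      calc _ ≤ p ^ m * 1 := Nat.mul_le_mul_left _ hδ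
        _ = _ := mul_one _
    omega
  have hW : W₀ (t % p ^ m) ≤ t / p ^ m := by
    have h1 : W₀ (t % p ^ m) ≤ Wm :=
      Finset.le_sup (f := W₀) (Finset.mem_range.2 (Nat.mod_lt _ hpm))
    have h2 : Wm + 1 ≤ t / p ^ m := (Nat.le_div_iff_mul_le hpm).2 (by linarith)
    omega
  obtain ⟨F, x, hF⟩ := hW₀ (t % p ^ m) (t / p ^ m) hW
  rw [Nat.mod_add_div] at hF
  have h := hF.mul (hE'.pow_of_dvd (q := p ^ b) (Dvd.intro δ rfl))
  have e1 : κ = 2 * (2 * w) * t + 2 * (3 * w) * (p ^ m * δ) := by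
    rw [hu, ht, hw, Nat.add_sub_cancel]
    ring
  rw [e1]
  exact ⟨_, _, h⟩

end

/-- The odd part `Σ_{n ∈ ℤ} e^{2πi(n+1/2)²τ}` of `Σ_{n ∈ ℤ} e^{πin²τ/2}`. -/
def Theta1 (τ : ℍ) : ℂ := jacobiTheta (τ / 2) - jacobiTheta (2 * τ)

lemma Theta_eq_jacobiTheta (τ : ℍ) : Theta τ = jacobiTheta (2 * τ) := by
  rw [Theta, jacobiTheta]
  refine tsum_congr fun n => ?_
  congr 1
  ring

/-- The series `Σ_{n ≥ 1} X^{n²}`. -/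
def squareSeries : PowerSeries ℂ := PowerSeries.mk fun n => if n ≠ 0 ∧ IsSquare n then 1 else 0

/-- The series `Σ_{k ≥ 0} X^{k(k+1)}`. -/
def oddSquareSeries : PowerSeries ℂ := PowerSeries.mk fun n => if IsSquare (4 * n + 1) then 1 else 0

lemma squareSeries_hasExp {h : ℕ} (hh : 0 < h) :
    HasExp h squareSeries (fun τ => (jacobiTheta (2 * τ / h) - 1) / 2) := by
  intro τ
  have him : 0 < (2 * (τ : ℂ) / h).im := by
    have h1 : (2 * (τ : ℂ) / h) = ((2 / h : ℝ) : ℂ) * τ := by push_cast; ring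
    rw [h1, Complex.im_ofReal_mul]
    have : (0 : ℝ) < h := by exact_mod_cast hh
    exact mul_pos (by positivity) τ.im_pos
  have h1 := hasSum_nat_jacobiTheta him
  have hinj : Function.Injective fun n : ℕ => (n + 1) ^ 2 := by
    intro a b hab
    have := Nat.pow_left_injective two_ne_zero hab
    omega
  rw [← hinj.hasSum_iff]
  · refine h1.congr_fun fun n => ?_
    have e : IsSquare ((n + 1) ^ 2) := ⟨n + 1, sq _⟩
    simp only [Function.comp_apply, squareSeries, PowerSeries.coeff_mk]
    rw [if_pos ⟨by positivity, e⟩, one_mul, Function.Periodic.qParam, ← Complex.exp_nat_mul]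
    congr 1
    push_cast
    ring
  · intro m hm
    rw [squareSeries, PowerSeries.coeff_mk, if_neg, zero_mul]
    rintro ⟨h0, k, rfl⟩
    refine hm ⟨k - 1, ?_⟩
    have : k ≠ 0 := by rintro rfl; simp at h0
    simp only
    rw [Nat.sub_add_cancel (by omega), sq]

lemma Theta_hasExp : HasExp 1 (1 + PowerSeries.C 2 * squareSeries) Theta := by
  refine ((HasExp.one 1).add ((squareSeries_hasExp one_pos).const_mul 2)).congr_fun fun τ => ?_
  rw [Theta_eq_jacobiTheta]
  simp
  ring

lemma isSquare_four_mul_iff (k : ℕ) : IsSquare (4 * k) ↔ IsSquare k := by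
  constructor
  · rintro ⟨r, hr⟩
    have h2 : 2 ∣ r := by
      have : 2 ∣ r * r := ⟨2 * k, by omega⟩
      simpa using (Nat.prime_two.dvd_mul.1 this)
    obtain ⟨s, rfl⟩ := h2
    exact ⟨s, by linarith⟩
  · rintro ⟨r, rfl⟩
    exact ⟨2 * r, by ring⟩

lemma squareSeries_sub_expand :
    squareSeries - PowerSeries.expand 4 four_ne_zero squareSeries =
      PowerSeries.X * PowerSeries.expand 4 four_ne_zero oddSquareSeries := by
  have hsq : ∀ m, IsSquare m → m % 4 = 0 ∨ m % 4 = 1 := by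
    rintro m ⟨r, rfl⟩
    have : r % 4 < 4 := Nat.mod_lt _ (by norm_num)
    rw [Nat.mul_mod]
    interval_cases r % 4 <;> simp
  ext m
  obtain ⟨k, r, hr, rfl⟩ : ∃ k r, r < 4 ∧ m = 4 * k + r :=
    ⟨m / 4, m % 4, Nat.mod_lt _ (by norm_num), (Nat.div_add_mod m 4).symm⟩
  rw [map_sub]
  interval_cases r
  · rw [add_zero, PowerSeries.coeff_expand_mul]
    have : PowerSeries.coeff (4 * k)
        (PowerSeries.X * PowerSeries.expand 4 four_ne_zero oddSquareSeries) = 0 := by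
      cases k with
      | zero => simp
      | succ k =>
        rw [show 4 * (k + 1) = (4 * k + 3) + 1 by ring, PowerSeries.coeff_succ_X_mul,
          PowerSeries.coeff_expand_of_not_dvd _ _ _ (by omega)]
    rw [this, squareSeries, PowerSeries.coeff_mk, PowerSeries.coeff_mk]
    simp [isSquare_four_mul_iff]
  · rw [PowerSeries.coeff_succ_X_mul, PowerSeries.coeff_expand_mul,
      PowerSeries.coeff_expand_of_not_dvd _ _ _ (by omega)]
    simp [squareSeries, oddSquareSeries]
  · rw [show 4 * k + 2 = (4 * k + 1) + 1 by ring, PowerSeries.coeff_succ_X_mul,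
      PowerSeries.coeff_expand_of_not_dvd _ _ _ (by omega),
      PowerSeries.coeff_expand_of_not_dvd _ _ _ (by omega), squareSeries, PowerSeries.coeff_mk,
      if_neg fun h => by have := hsq _ h.2; omega, sub_zero]
  · rw [show 4 * k + 3 = (4 * k + 2) + 1 by ring, PowerSeries.coeff_succ_X_mul,
      PowerSeries.coeff_expand_of_not_dvd _ _ _ (by omega),
      PowerSeries.coeff_expand_of_not_dvd _ _ _ (by omega), squareSeries, PowerSeries.coeff_mk,
      if_neg fun h => by have := hsq _ h.2; omega, sub_zero]

lemma half_Theta1_hasExp :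
    HasExp 4 (PowerSeries.X * PowerSeries.expand 4 four_ne_zero oddSquareSeries)
      (fun τ => Theta1 τ / 2) := by
  have h1 := (squareSeries_hasExp (h := 1) one_pos).expand four_ne_zero
  rw [mul_one] at h1
  rw [← squareSeries_sub_expand]
  refine ((squareSeries_hasExp (h := 4) (by norm_num)).sub h1).congr_fun fun τ => ?_
  have e : (2 * (τ : ℂ) / (4 : ℕ)) = τ / 2 := by push_cast; ring
  simp only [Theta1, e, Nat.cast_one, div_one]
  ring

/-- The function `q^{-1/4} Σ_{k ≥ 0} q^{(k+1/2)²}`. -/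
def thetaUnit (τ : ℍ) : ℂ := Theta1 τ / 2 * (Function.Periodic.qParam 4 τ)⁻¹

lemma Theta1_eq (τ : ℍ) : Theta1 τ = 2 * (Function.Periodic.qParam 4 τ * thetaUnit τ) := by
  have : Function.Periodic.qParam 4 (τ : ℂ) ≠ 0 := Complex.exp_ne_zero _
  rw [thetaUnit]
  field_simp

lemma thetaUnit_hasExp : HasExp 1 oddSquareSeries thetaUnit := by
  intro τ
  have h := half_Theta1_hasExp τ
  have hq : Function.Periodic.qParam 4 (τ : ℂ) ≠ 0 := Complex.exp_ne_zero _
  have hq4 : Function.Periodic.qParam 4 (τ : ℂ) ^ 4 = Function.Periodic.qParam 1 (τ : ℂ) := by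
    simp only [Function.Periodic.qParam]
    rw [← Complex.exp_nat_mul]
    congr 1
    push_cast
    ring
  have hinj : Function.Injective fun k : ℕ => 4 * k + 1 := fun a b hab => by
    simp only at hab; omega
  rw [← hinj.hasSum_iff] at h
  · refine (h.mul_right (Function.Periodic.qParam 4 (τ : ℂ))⁻¹).congr_fun fun n => ?_
    simp only [Function.comp_apply, PowerSeries.coeff_succ_X_mul, PowerSeries.coeff_expand_mul]
    push_cast
    rw [pow_succ, pow_mul, hq4]
    field_simp
  · intro m hm
    have : PowerSeries.coeff m
        (PowerSeries.X * PowerSeries.expand 4 four_ne_zero oddSquareSeries) = 0 := by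
      cases m with
      | zero => simp
      | succ m =>
        rw [PowerSeries.coeff_succ_X_mul]
        by_cases hd : 4 ∣ m
        · obtain ⟨k, rfl⟩ := hd
          exact (hm ⟨k, rfl⟩).elim
        · exact PowerSeries.coeff_expand_of_not_dvd _ _ _ hd
    rw [this, zero_mul]

lemma Theta_T (τ : ℍ) : Theta (ModularGroup.T • τ) = Theta τ := by
  rw [← affMap_one_one]
  exact apply_affMap_intCast Theta_hasExp 1 (by rw [coe_affMap one_pos]; simp)

lemma Theta1_T (τ : ℍ) : Theta1 (ModularGroup.T • τ) = Complex.I * Theta1 τ := by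
  rw [← affMap_one_one, Theta1_eq, Theta1_eq τ,
    apply_affMap_intCast thetaUnit_hasExp 1 (τ := τ) (by rw [coe_affMap one_pos]; simp)]
  have : Function.Periodic.qParam 4 (affMap 1 1 τ : ℂ) =
      Complex.I * Function.Periodic.qParam 4 (τ : ℂ) := by
    rw [coe_affMap one_pos]
    simp only [Function.Periodic.qParam]
    rw [show 2 * π * Complex.I * ((1 : ℝ) * τ + (1 : ℝ)) / (4 : ℝ) =
      π / 2 * Complex.I + 2 * π * Complex.I * τ / (4 : ℝ) by push_cast; ring, Complex.exp_add,
      Complex.exp_pi_div_two_mul_I]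
  rw [this]
  ring

/-- The factor `(-iτ/2)^{1/2}` in the inversion formula of the theta functions. -/
def thetaFactor (τ : ℍ) : ℂ := (-Complex.I * (affMap (1 / 2) 0 τ : ℂ)) ^ (1 / 2 : ℂ)

lemma thetaFactor_sq (τ : ℍ) : thetaFactor τ ^ 2 = (2 * Complex.I)⁻¹ * τ := by
  rw [thetaFactor, ← Complex.cpow_nat_mul, coe_affMap (by norm_num)]
  have : (2 * Complex.I)⁻¹ = -Complex.I / 2 := by
    rw [mul_inv, Complex.inv_I]; ring
  rw [this]
  norm_num
  ring

lemma continuous_thetaFactor : Continuous thetaFactor := by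
  refine Continuous.cpow ?_ continuous_const fun τ => ?_
  · simp only [coe_affMap (show (0 : ℝ) < 1 / 2 by norm_num)]
    fun_prop
  · left
    simpa using (affMap (1 / 2) 0 τ).im_pos

lemma jacobiTheta_inv (τ : ℍ) : jacobiTheta (-(τ : ℂ)⁻¹) =
    (-Complex.I * τ) ^ (1 / 2 : ℂ) * jacobiTheta τ := by
  rw [← coe_S_smul, jacobiTheta_S_smul]

lemma Theta_S (τ : ℍ) :
    Theta (ModularGroup.S • τ) = thetaFactor τ * (Theta τ + Theta1 τ) := by
  have h := jacobiTheta_inv (affMap (1 / 2) 0 τ)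
  have e1 : (affMap (1 / 2) 0 τ : ℂ) = τ / 2 := by
    rw [coe_affMap (by norm_num)]; push_cast; ring
  rw [Theta_eq_jacobiTheta, coe_S_smul, Theta1, Theta_eq_jacobiTheta, thetaFactor, add_sub_cancel,
    ← e1, ← h, e1]
  congr 1
  rw [inv_div]
  ring

lemma Theta1_S (τ : ℍ) :
    Theta1 (ModularGroup.S • τ) = thetaFactor τ * (Theta τ - Theta1 τ) := by
  have h := jacobiTheta_inv (affMap 2 0 τ)
  have e1 : (affMap (1 / 2) 0 τ : ℂ) = τ / 2 := by
    rw [coe_affMap (by norm_num)]; push_cast; ring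
  have e2 : (affMap 2 0 τ : ℂ) = 2 * τ := by
    rw [coe_affMap (by norm_num)]; push_cast; ring
  have e3 : (-Complex.I * (2 * τ : ℂ)) ^ (1 / 2 : ℂ) = 2 * thetaFactor τ := by
    have hne : -Complex.I * (τ / 2 : ℂ) ≠ 0 := by
      have := ne_zero τ
      simp [this]
    have h4 : -Complex.I * (2 * τ : ℂ) = ((4 : ℝ) : ℂ) * (-Complex.I * (τ / 2 : ℂ)) := by
      push_cast; ring
    have h2 : Complex.exp ((Real.log 4 : ℂ) * (1 / 2 : ℂ)) = 2 := by
      rw [show (4 : ℝ) = 2 ^ 2 by norm_num, Real.log_pow]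
      push_cast
      rw [show (2 : ℂ) * (Real.log 2 : ℂ) * (1 / 2) = (Real.log 2 : ℝ) by ring, ← Complex.ofReal_exp,
        Real.exp_log two_pos]
      simp
    rw [thetaFactor, e1, h4, Complex.cpow_def_of_ne_zero (mul_ne_zero (by norm_num) hne),
      Complex.cpow_def_of_ne_zero hne, Complex.log_ofReal_mul (by norm_num) hne, add_mul,
      Complex.exp_add, h2]
  have h5 := Theta_S τ
  rw [Theta_eq_jacobiTheta] at h5
  have e4 : ((ModularGroup.S • τ : ℍ) : ℂ) / 2 = -(affMap 2 0 τ : ℂ)⁻¹ := by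
    rw [coe_S_smul, e2, mul_inv]; ring
  rw [Theta1, h5, e4, h, e2, e3, ← Theta_eq_jacobiTheta]
  ring

lemma constantCoeff_oddSquareSeries : PowerSeries.constantCoeff oddSquareSeries = 1 := by
  rw [← PowerSeries.coeff_zero_eq_constantCoeff_apply, oddSquareSeries, PowerSeries.coeff_mk]
  simp

lemma constantCoeff_squareSeries : PowerSeries.constantCoeff squareSeries = 0 := by
  rw [← PowerSeries.coeff_zero_eq_constantCoeff_apply, squareSeries, PowerSeries.coeff_mk]
  simp

lemma qParam_hasExp (h : ℕ) : HasExp h PowerSeries.X (fun τ => Function.Periodic.qParam h τ) := by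
  intro τ
  have := hasSum_ite_eq (1 : ℕ) (Function.Periodic.qParam h (τ : ℂ))
  refine this.congr_fun fun n => ?_
  rw [PowerSeries.coeff_X]
  split_ifs with hn
  · simp [hn]
  · simp

lemma Theta1_pow_four (τ : ℍ) :
    Theta1 τ ^ 4 = 16 * (Function.Periodic.qParam 1 τ * thetaUnit τ ^ 4) := by
  have hq4 : Function.Periodic.qParam 4 (τ : ℂ) ^ 4 = Function.Periodic.qParam 1 (τ : ℂ) := by
    simp only [Function.Periodic.qParam]
    rw [← Complex.exp_nat_mul]
    congr 1
    push_cast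
    ring
  rw [Theta1_eq, ← hq4]
  ring

lemma Theta1_pow_four_hasExp : HasExp 1 (PowerSeries.C 16 * (PowerSeries.X * oddSquareSeries ^ 4))
    (fun τ => Theta1 τ ^ 4) := by
  refine (((qParam_hasExp 1).mul (thetaUnit_hasExp.pow 4)).const_mul 16).congr_fun fun τ => ?_
  rw [Theta1_pow_four]
  simp

/-- The fourth power of `θ θ₁ (θ⁴ - θ₁⁴)` is a cusp form of weight `12`. -/
lemma exists_cuspForm_theta :
    ∃ D : CuspForm 𝒮ℒ 12, ∃ x : PowerSeries ℂ, HasExp 1 x D ∧ PowerSeries.coeff 1 x = 16 ∧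
      ∀ τ, D τ = (Theta τ * Theta1 τ * (Theta τ ^ 4 - Theta1 τ ^ 4)) ^ 4 := by
  set F : ℍ → ℂ := fun τ => (Theta τ * Theta1 τ * (Theta τ ^ 4 - Theta1 τ ^ 4)) ^ 4 with hF
  set t := 1 + PowerSeries.C 2 * squareSeries with ht
  have ht0 : PowerSeries.constantCoeff t = 1 := by
    simp [ht, constantCoeff_squareSeries]
  set w := PowerSeries.C (16 : ℂ) * (PowerSeries.X * oddSquareSeries ^ 4) with hw
  have hexp : HasExp 1 (t ^ 4 * w * (t ^ 4 - w) ^ 4) F :=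
    (((Theta_hasExp.pow 4).mul Theta1_pow_four_hasExp).mul
      (((Theta_hasExp.pow 4).sub Theta1_pow_four_hasExp).pow 4)).congr_fun fun τ => by
        simp only [hF]; ring
  have hinv : LevelOneInv 12 F := by
    refine LevelOneInv.of_S_of_T (fun τ => ?_) fun τ => ?_
    · simp only [hF, affMap_one_one, Theta_T, Theta1_T]
      rw [mul_pow Complex.I, Complex.I_pow_four]
      linear_combination (Theta τ * Theta1 τ * (Theta τ ^ 4 - Theta1 τ ^ 4)) ^ 4 * Complex.I_pow_four
    · simp only [hF, Theta_S, Theta1_S]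
      have h1 : (thetaFactor τ ^ 2) ^ 12 * 4096 = (τ : ℂ) ^ 12 := by
        have : ((2 * Complex.I)⁻¹) ^ 12 * 4096 = 1 := by
          rw [mul_inv, Complex.inv_I]
          have : Complex.I ^ 12 = 1 := by rw [show 12 = 4 * 3 by rfl, pow_mul, Complex.I_pow_four, one_pow]
          rw [mul_pow, neg_pow, this]
          norm_num
        rw [thetaFactor_sq, mul_pow]
        linear_combination (τ : ℂ) ^ 12 * this
      rw [← h1]
      ring
  have hz : PowerSeries.constantCoeff (t ^ 4 * w * (t ^ 4 - w) ^ 4) = 0 := by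
    simp [hw]
  have h16 : PowerSeries.coeff 1 (t ^ 4 * w * (t ^ 4 - w) ^ 4) = 16 := by
    have : t ^ 4 * w * (t ^ 4 - w) ^ 4 =
        PowerSeries.X * (PowerSeries.C 16 * (t ^ 4 * oddSquareSeries ^ 4 * (t ^ 4 - w) ^ 4)) := by
      rw [hw]; ring
    rw [this, show 1 = 0 + 1 by rfl, PowerSeries.coeff_succ_X_mul,
      PowerSeries.coeff_zero_eq_constantCoeff_apply]
    simp [ht0, constantCoeff_oddSquareSeries, hw]
  have hslash := fun σ => (slash_eq_iff 12 F σ).2 (hinv σ)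
  refine ⟨{ toFun := F
            slash_action_eq' := ?_
            holo' := hexp.mdifferentiable one_pos
            zero_at_cusps' := ?_ }, _, hexp, h16, fun τ => rfl⟩
  · rintro _ ⟨A, rfl⟩
    exact hslash A
  · intro c hc
    rw [Subgroup.IsArithmetic.isCusp_iff_isCusp_SL2Z] at hc
    rw [OnePoint.isZeroAt_iff_forall_SL2Z hc]
    intro γ _
    have h := hexp.tendsto one_pos
    rw [PowerSeries.coeff_zero_eq_constantCoeff_apply, hz] at h
    have e := hslash γ
    simp only [Nat.cast_ofNat] at e
    rw [e]
    exact h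

lemma theta_prod_ne_zero (τ : ℍ) :
    Theta τ * Theta1 τ * (Theta τ ^ 4 - Theta1 τ ^ 4) ≠ 0 := by
  obtain ⟨D, x, hD, hx, e⟩ := exists_cuspForm_theta
  obtain ⟨c, hc⟩ := CuspForm.exists_smul_discriminant_of_weight_eq_twelve D
  have hc0 : c ≠ 0 := by
    rintro rfl
    have h0 : HasExp 1 (PowerSeries.C 0) D :=
      (HasExp.const 1 0).congr_fun fun τ => by rw [← hc]; simp
    have := hD.unique one_pos h0
    rw [this] at hx
    simp at hx
  intro h
  have h1 : D τ = 0 := by rw [e, h]; simp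
  rw [← hc] at h1
  simp only [_root_.smul_apply, smul_eq_mul, mul_eq_zero] at h1
  exact h1.elim hc0 (ModularForm.discriminant_ne_zero τ)

lemma Theta_ne_zero (τ : ℍ) : Theta τ ≠ 0 := fun h => theta_prod_ne_zero τ (by simp [h])

lemma Theta1_ne_zero (τ : ℍ) : Theta1 τ ≠ 0 := fun h => theta_prod_ne_zero τ (by simp [h])

/-- The values at a primitive vector `(a, c)` modulo `4`, and the values `u` of the leading
coefficients of the two theta functions at the corresponding cusp. -/
structure ThetaCusp (κ : ℂ) (a c : ZMod 4) (u v : ℂ) : Prop where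
  prim : a * a = 1 ∨ c * c = 1
  of_zero : c = 0 → v = 0 ∧ κ * u ^ 2 = (ZMod.χ₄ a : ℤ)
  of_two : c = 2 → u = 0 ∧ κ * v ^ 2 = (ZMod.χ₄ a : ℤ)
  of_odd : c * c = 1 → v = Complex.I ^ (a * c).val * u ∧ 2 * Complex.I * κ * u ^ 2 = (ZMod.χ₄ c : ℤ)

lemma zmod_four_odd_iff (c : ZMod 4) : c * c = 1 ↔ c = 1 ∨ c = 3 := by
  revert c; decide

lemma ThetaCusp.S {κ : ℂ} {a c : ZMod 4} {u v : ℂ} (h : ThetaCusp κ a c u v) :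
    ThetaCusp ((2 * Complex.I)⁻¹ * κ) (-c) a (u + v) (u - v) := by
  have hI : Complex.I ^ 2 = -1 := Complex.I_sq
  have hI3 : Complex.I ^ 3 = -Complex.I := Complex.I_pow_three
  have hinv : (2 * Complex.I)⁻¹ = -Complex.I / 2 := by rw [mul_inv, Complex.inv_I]; ring
  obtain ⟨h1, h2, h3, h4⟩ := h
  have key : ∀ a c : ZMod 4, (a = 0 ∨ a = 2 ∨ a * a = 1) ∧ (c = 0 ∨ c = 2 ∨ c * c = 1) := by decide
  refine ⟨?_, ?_, ?_, ?_⟩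
  · rw [neg_mul_neg]; exact h1.symm
  · rintro rfl
    have hc : c * c = 1 := h1.resolve_left (by decide)
    obtain ⟨e1, e2⟩ := h4 hc
    have e3 : (ZMod.χ₄ (-c) : ℤ) = -ZMod.χ₄ c := by
      rw [zmod_four_odd_iff] at hc; rcases hc with rfl | rfl <;> rfl
    simp only [zero_mul, ZMod.val_zero, pow_zero, one_mul] at e1
    subst e1
    refine ⟨sub_self _, ?_⟩
    rw [e3, hinv]
    push_cast
    linear_combination -e2
  · rintro rfl
    have hc : c * c = 1 := h1.resolve_left (by decide)
    obtain ⟨e1, e2⟩ := h4 hc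
    have e3 : (ZMod.χ₄ (-c) : ℤ) = -ZMod.χ₄ c := by
      rw [zmod_four_odd_iff] at hc; rcases hc with rfl | rfl <;> rfl
    have e4 : 2 * c = 2 := by
      rw [zmod_four_odd_iff] at hc; rcases hc with rfl | rfl <;> rfl
    rw [e4, show (2 : ZMod 4).val = 2 from rfl, hI] at e1
    subst e1
    refine ⟨by ring, ?_⟩
    rw [e3, hinv]
    push_cast
    linear_combination -e2
  · intro ha
    have e0 : 2 * Complex.I * ((2 * Complex.I)⁻¹ * κ) = κ := by
      rw [mul_inv_cancel_left₀ (by simp)]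
    rw [e0]
    rcases (key a c).2 with rfl | rfl | hc
    · obtain ⟨rfl, e2⟩ := h2 rfl
      simp [e2]
    · obtain ⟨rfl, e2⟩ := h3 rfl
      have e4 : -2 * a = 2 := by
        rw [zmod_four_odd_iff] at ha; rcases ha with rfl | rfl <;> rfl
      rw [e4, show (2 : ZMod 4).val = 2 from rfl, hI]
      exact ⟨by ring, by simpa using e2⟩
    · obtain ⟨e1, e2⟩ := h4 hc
      have : (a * c = 1 ∧ -c * a = 3 ∧ ZMod.χ₄ a = ZMod.χ₄ c) ∨
          (a * c = 3 ∧ -c * a = 1 ∧ ZMod.χ₄ a = -ZMod.χ₄ c) := by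
        rw [zmod_four_odd_iff] at ha hc
        rcases ha with rfl | rfl <;> rcases hc with rfl | rfl <;> decide
      rcases this with ⟨e3, e4, e5⟩ | ⟨e3, e4, e5⟩
      · rw [e3, show (1 : ZMod 4).val = 1 from rfl, pow_one] at e1
        rw [e4, e5, ← e2, show (3 : ZMod 4).val = 3 from rfl, hI3, e1]
        exact ⟨by linear_combination u * hI, by linear_combination κ * u ^ 2 * hI⟩
      · rw [e3, show (3 : ZMod 4).val = 3 from rfl, hI3] at e1
        rw [e4, e5, show (1 : ZMod 4).val = 1 from rfl, pow_one, e1]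
        push_cast
        rw [← e2]
        exact ⟨by linear_combination u * hI, by linear_combination κ * u ^ 2 * hI⟩

lemma ThetaCusp.T {κ : ℂ} {a c : ZMod 4} {u v : ℂ} (h : ThetaCusp κ a c u v) :
    ThetaCusp κ (a + c) c u (Complex.I * v) := by
  have hI : Complex.I ^ 2 = -1 := Complex.I_sq
  obtain ⟨h1, h2, h3, h4⟩ := h
  refine ⟨?_, ?_, ?_, ?_⟩
  · revert h1; clear * -; revert a c; decide
  · rintro rfl
    obtain ⟨rfl, e⟩ := h2 rfl
    simp [e]
  · rintro rfl
    obtain ⟨rfl, e⟩ := h3 rfl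
    have : (ZMod.χ₄ (a + 2) : ℤ) = -ZMod.χ₄ a := by clear * -; revert a; decide
    refine ⟨rfl, ?_⟩
    rw [this]
    push_cast
    rw [← e]
    linear_combination κ * v ^ 2 * hI
  · intro hc
    obtain ⟨rfl, e⟩ := h4 hc
    refine ⟨?_, e⟩
    rw [add_mul, hc]
    have : ∀ x : ZMod 4, Complex.I ^ (x + 1).val = Complex.I * Complex.I ^ x.val := by
      intro x
      have h4 := Complex.I_pow_four
      fin_cases x
      · exact pow_succ' _ 0
      · exact pow_succ' _ 1
      · exact pow_succ' _ 2
      · change Complex.I ^ 0 = Complex.I * Complex.I ^ 3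
        linear_combination -h4
    rw [this]
    ring

lemma coe_smul_eq_div (σ : SL(2, ℤ)) (τ : ℍ) :
    ((σ • τ : ℍ) : ℂ) = ((σ 0 0 : ℂ) * (τ : ℂ) + (σ 0 1 : ℂ)) / denomC σ τ := by
  rw [UpperHalfPlane.specialLinearGroup_apply]
  simp [denomC]

lemma denomC_mul (σ σ' : SL(2, ℤ)) (τ : ℍ) :
    denomC (σ * σ') τ = denomC σ (σ' • τ) * denomC σ' τ := by
  have h := denomC_ne_zero σ' τ
  have e1 : denomC σ (σ' • τ) = (σ 1 0 : ℂ) * ((σ' • τ : ℍ) : ℂ) + (σ 1 1 : ℂ) := rfl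
  have e2 : denomC σ' τ = (σ' 1 0 : ℂ) * (τ : ℂ) + (σ' 1 1 : ℂ) := rfl
  have e3 : ∀ i, (σ * σ') 1 i = σ 1 0 * σ' 0 i + σ 1 1 * σ' 1 i := fun i => by
    change (σ.1 * σ'.1) 1 i = _
    rw [Matrix.mul_apply, Fin.sum_univ_two]
  rw [e1, coe_smul_eq_div, add_mul, mul_assoc, div_mul_cancel₀ _ h, e2, denomC, e3, e3]
  push_cast
  ring

lemma continuous_denomC (σ : SL(2, ℤ)) : Continuous (denomC σ) := by
  unfold denomC; fun_prop

lemma continuous_smul_SL (σ : SL(2, ℤ)) : Continuous fun τ : ℍ => σ • τ := by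
  rw [UpperHalfPlane.isEmbedding_coe.continuous_iff]
  have : ((↑) : ℍ → ℂ) ∘ (fun τ : ℍ => σ • τ) =
      fun τ : ℍ => ((σ 0 0 : ℂ) * (τ : ℂ) + (σ 0 1 : ℂ)) / denomC σ τ :=
    funext fun τ => coe_smul_eq_div σ τ
  rw [this]
  exact Continuous.div (by fun_prop) (continuous_denomC σ) (denomC_ne_zero σ)

/-- The transformation behaviour of the pair of theta functions under `σ`, with entries of the
transformation matrix in `R`. -/
def ThetaTransform (R : Subring ℂ) (σ : SL(2, ℤ)) : Prop :=
  ∃ (μ : ℍ → ℂ) (κ A B C D : ℂ), Continuous μ ∧ κ ∈ R ∧ κ ≠ 0 ∧ A ∈ R ∧ B ∈ R ∧ C ∈ R ∧ D ∈ R ∧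
    (∀ τ, μ τ ^ 2 = κ * denomC σ τ) ∧
    (∀ τ, Theta (σ • τ) = μ τ * (A * Theta τ + B * Theta1 τ)) ∧
    (∀ τ, Theta1 (σ • τ) = μ τ * (C * Theta τ + D * Theta1 τ)) ∧
    ∀ κ' a c u v, ThetaCusp κ' a c u v →
      ThetaCusp (κ * κ') ((σ 0 0 : ℤ) * a + (σ 0 1 : ℤ) * c) ((σ 1 0 : ℤ) * a + (σ 1 1 : ℤ) * c)
        (A * u + B * v) (C * u + D * v)

lemma ThetaTransform.mul {R : Subring ℂ} {σ σ' : SL(2, ℤ)} (h : ThetaTransform R σ)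
    (h' : ThetaTransform R σ') : ThetaTransform R (σ * σ') := by
  obtain ⟨μ, κ, A, B, C, D, h1, h2, h3, hA, hB, hC, hD, h4, h5, h6, h7⟩ := h
  obtain ⟨μ', κ', A', B', C', D', h1', h2', h3', hA', hB', hC', hD', h4', h5', h6', h7'⟩ := h'
  refine ⟨fun τ => μ (σ' • τ) * μ' τ, κ * κ', A * A' + B * C', A * B' + B * D', C * A' + D * C',
    C * B' + D * D', (h1.comp (continuous_smul_SL σ')).mul h1', R.mul_mem h2 h2',
    mul_ne_zero h3 h3', ?_, ?_, ?_, ?_, ?_, ?_, ?_, ?_⟩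
  · exact R.add_mem (R.mul_mem hA hA') (R.mul_mem hB hC')
  · exact R.add_mem (R.mul_mem hA hB') (R.mul_mem hB hD')
  · exact R.add_mem (R.mul_mem hC hA') (R.mul_mem hD hC')
  · exact R.add_mem (R.mul_mem hC hB') (R.mul_mem hD hD')
  · intro τ
    rw [mul_pow, h4, h4', denomC_mul]; ring
  · intro τ
    rw [mul_smul, h5, h5', h6']; ring
  · intro τ
    rw [mul_smul, h6, h5', h6']; ring
  · intro κ'' a c u v hw
    have := h7 _ _ _ _ _ (h7' _ _ _ _ _ hw)
    rw [← mul_assoc] at this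
    convert this using 1
    · simp [Matrix.mul_apply, Fin.sum_univ_two]; ring
    · simp [Matrix.mul_apply, Fin.sum_univ_two]; ring
    · ring
    · ring

lemma thetaTransform_S {R : Subring ℂ} (hI : Complex.I ∈ R) (h2 : (2 : ℂ)⁻¹ ∈ R) :
    ThetaTransform R ModularGroup.S := by
  have e : (2 * Complex.I)⁻¹ ∈ R := by
    rw [mul_inv, Complex.inv_I]
    exact R.mul_mem h2 (R.neg_mem hI)
  refine ⟨thetaFactor, (2 * Complex.I)⁻¹, 1, 1, 1, -1, continuous_thetaFactor, e, by simp, R.one_mem,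
    R.one_mem, R.one_mem, R.neg_mem R.one_mem, fun τ => ?_, fun τ => ?_, fun τ => ?_, ?_⟩
  · rw [thetaFactor_sq]; simp [denomC, ModularGroup.S]
  · rw [Theta_S]; ring
  · rw [Theta1_S]; ring
  · intro κ' a c u v h
    convert h.S using 1
    · simp [ModularGroup.S]
    · simp [ModularGroup.S]
    · ring
    · ring

lemma thetaTransform_T {R : Subring ℂ} (hI : Complex.I ∈ R) : ThetaTransform R ModularGroup.T := by
  refine ⟨fun _ => 1, 1, 1, 0, 0, Complex.I, continuous_const, R.one_mem, one_ne_zero, R.one_mem,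
    R.zero_mem, R.zero_mem, hI, fun τ => ?_, fun τ => ?_, fun τ => ?_, ?_⟩
  · simp [denomC, ModularGroup.T]
  · rw [Theta_T]; ring
  · rw [Theta1_T]; ring
  · intro κ' a c u v h
    convert h.T using 1
    · ring
    · simp [ModularGroup.T]
    · simp [ModularGroup.T]
    · ring
    · ring

lemma thetaTransform {R : Subring ℂ} (hI : Complex.I ∈ R) (h2 : (2 : ℂ)⁻¹ ∈ R) (σ : SL(2, ℤ)) :
    ThetaTransform R σ := by
  have hS := thetaTransform_S hI h2
  have hT := thetaTransform_T hI
  have eS : ModularGroup.S⁻¹ = ModularGroup.S * (ModularGroup.S * ModularGroup.S) := by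
    refine inv_eq_of_mul_eq_one_right (Subtype.ext ?_)
    decide
  have eT : ModularGroup.T⁻¹ = ModularGroup.S * (ModularGroup.T * (ModularGroup.S *
      (ModularGroup.T * (ModularGroup.S * (ModularGroup.S * ModularGroup.S))))) := by
    refine inv_eq_of_mul_eq_one_right (Subtype.ext ?_)
    decide
  have hS' : ThetaTransform R ModularGroup.S⁻¹ := by rw [eS]; exact hS.mul (hS.mul hS)
  have hT' : ThetaTransform R ModularGroup.T⁻¹ := by
    rw [eT]; exact hS.mul (hT.mul (hS.mul (hT.mul (hS.mul (hS.mul hS)))))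
  have hmem : σ ∈ Subgroup.closure {ModularGroup.S, ModularGroup.T} := by
    simp [SpecialLinearGroup.SL2Z_generators]
  induction hmem using Subgroup.closure_induction_left with
  | one => have := hS'.mul hS; rwa [inv_mul_cancel] at this
  | mul_left x hx y _ hy =>
    rcases hx with rfl | rfl
    exacts [hS.mul hy, hT.mul hy]
  | inv_mul_cancel x hx y _ hy =>
    rcases hx with rfl | rfl
    exacts [hS'.mul hy, hT'.mul hy]

/-- The principal square root of `cτ + d`. -/
def rootFactor (σ : SL(2, ℤ)) (τ : ℍ) : ℂ := denomC σ τ ^ (1 / 2 : ℂ)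

lemma rootFactor_sq (σ : SL(2, ℤ)) (τ : ℍ) : rootFactor σ τ ^ 2 = denomC σ τ := by
  rw [rootFactor, ← Complex.cpow_nat_mul]
  norm_num

lemma rootFactor_ne_zero (σ : SL(2, ℤ)) (τ : ℍ) : rootFactor σ τ ≠ 0 := by
  intro h
  have := rootFactor_sq σ τ
  rw [h] at this
  exact denomC_ne_zero σ τ (by rw [← this]; ring)

lemma continuous_rootFactor (σ : SL(2, ℤ)) : Continuous (rootFactor σ) := by
  by_cases hc : σ 1 0 = 0
  · have : rootFactor σ = fun _ => (σ 1 1 : ℂ) ^ (1 / 2 : ℂ) := by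
      ext τ; simp [rootFactor, denomC, hc]
    rw [this]
    exact continuous_const
  · refine (continuous_denomC σ).cpow continuous_const fun τ => Or.inr ?_
    have : (denomC σ τ).im = σ 1 0 * τ.im := by simp [denomC]
    rw [this]
    exact mul_ne_zero (by exact_mod_cast hc) τ.im_ne_zero

lemma exists_eq_mul_rootFactor {μ : ℍ → ℂ} (hμ : Continuous μ) {κ : ℂ} (hκ : κ ≠ 0) {σ : SL(2, ℤ)}
    (h : ∀ τ, μ τ ^ 2 = κ * denomC σ τ) : ∃ C, C ^ 2 = κ ∧ ∀ τ, μ τ = C * rootFactor σ τ := by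
  have hC : (κ ^ (1 / 2 : ℂ)) ^ 2 = κ := by
    rw [← Complex.cpow_nat_mul]; norm_num
  have hC0 : κ ^ (1 / 2 : ℂ) ≠ 0 := by
    intro h0; rw [h0] at hC; exact hκ (by rw [← hC]; ring)
  have := (isPreconnected_univ (α := ℍ)).eq_or_eq_neg_of_sq_eq hμ.continuousOn
    (continuous_const.mul (continuous_rootFactor σ) : Continuous fun τ =>
      κ ^ (1 / 2 : ℂ) * rootFactor σ τ).continuousOn (fun τ _ => by
        simp only [Pi.pow_apply]
        rw [h, Pi.mul_apply, mul_pow, rootFactor_sq, hC]) (fun _ => mul_ne_zero hC0 (rootFactor_ne_zero σ _))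
  rcases this with h' | h'
  · exact ⟨_, hC, fun τ => h' (Set.mem_univ τ)⟩
  · exact ⟨-κ ^ (1 / 2 : ℂ), by rw [neg_sq, hC], fun τ => by
      rw [h' (Set.mem_univ τ)]; simp⟩

lemma LocalRootClosed.I_mem {p : ℕ} {R : Subring ℂ} (hR : LocalRootClosed p R) :
    Complex.I ∈ R :=
  hR.root_mem 4 _ (by norm_num) (by rw [Complex.I_pow_four]; exact R.one_mem)

lemma LocalRootClosed.two_inv_mem {p : ℕ} {R : Subring ℂ} (hR : LocalRootClosed p R)
    (hp3 : 3 ≤ p) : (2 : ℂ)⁻¹ ∈ R := by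
  have := hR.inv_mem 2 (fun h => by have := Nat.le_of_dvd (by norm_num) h; omega)
  exact_mod_cast this

lemma ThetaCusp.congr_sq {κ κ' a c u v s} (h : ThetaCusp (κ * κ') a c u v) (hs : s ^ 2 = κ) :
    ThetaCusp κ' a c (s * u) (s * v) := by
  obtain ⟨h1, h2, h3, h4⟩ := h
  subst hs
  refine ⟨h1, fun h => ⟨by rw [(h2 h).1, mul_zero], ?_⟩, fun h => ⟨by rw [(h3 h).1, mul_zero], ?_⟩,
    fun h => ⟨by rw [(h4 h).1]; ring, ?_⟩⟩
  · rw [← (h2 h).2]; ring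
  · rw [← (h3 h).2]; ring
  · rw [← (h4 h).2]; ring

lemma exists_theta_smul {p : ℕ} {R : Subring ℂ} (hp3 : 3 ≤ p) (hR : LocalRootClosed p R)
    (σ : SL(2, ℤ)) : ∃ A ∈ R, ∃ B ∈ R, ∃ C ∈ R, ∃ D ∈ R,
      (∀ τ, Theta (σ • τ) = rootFactor σ τ * (A * Theta τ + B * Theta1 τ)) ∧
      (∀ τ, Theta1 (σ • τ) = rootFactor σ τ * (C * Theta τ + D * Theta1 τ)) ∧
      ∀ κ a c u v, ThetaCusp κ a c u v →
        ThetaCusp κ ((σ 0 0 : ℤ) * a + (σ 0 1 : ℤ) * c) ((σ 1 0 : ℤ) * a + (σ 1 1 : ℤ) * c)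
          (A * u + B * v) (C * u + D * v) := by
  obtain ⟨μ, κ, A, B, C, D, h1, h2, h3, hA, hB, hC, hD, h4, h5, h6, h7⟩ :=
    thetaTransform hR.I_mem (hR.two_inv_mem hp3) σ
  obtain ⟨s, hs, hμ⟩ := exists_eq_mul_rootFactor h1 h3 h4
  have hsR : s ∈ R := hR.root_mem 2 _ (by norm_num) (hs ▸ h2)
  refine ⟨s * A, R.mul_mem hsR hA, s * B, R.mul_mem hsR hB, s * C, R.mul_mem hsR hC, s * D,
    R.mul_mem hsR hD, fun τ => ?_, fun τ => ?_, fun κ' a c u v h => ?_⟩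
  · rw [h5, hμ]; ring
  · rw [h6, hμ]; ring
  · convert (h7 _ _ _ _ _ h).congr_sq hs using 1 <;> ring

lemma thetaCusp_infty : ThetaCusp 1 1 0 1 0 :=
  ⟨by decide, by simp, fun h => absurd h (by decide), fun h => absurd h (by decide)⟩

lemma thetaCusp_zero : ThetaCusp (2 * Complex.I)⁻¹ 0 1 1 1 :=
  ⟨by decide, fun h => absurd h (by decide), fun h => absurd h (by decide), fun _ => by
    refine ⟨by simp, ?_⟩
    rw [one_pow, mul_one, mul_inv_cancel₀ (by simp)]
    simp⟩

lemma thetaCusp_neg_one_two : ThetaCusp (-1) (-1) 2 0 1 :=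
  ⟨by decide, fun h => absurd h (by decide), fun _ => ⟨rfl, by
    rw [show ZMod.χ₄ (-1) = -1 by decide]; simp⟩, fun h => absurd h (by decide)⟩

lemma chi_four_sq {a : ZMod 4} (h : a * a = 1) : (ZMod.χ₄ a : ℤ) ^ 2 = 1 := by
  revert a; decide

lemma theta_smul_of_dvd (σ : SL(2, ℤ)) (h : 4 ∣ σ 1 0) : ∃ w : ℂ,
    w ^ 2 = (ZMod.χ₄ (σ 0 0 : ℤ) : ℤ) ∧ w ^ 4 = 1 ∧
    (∀ τ, Theta (σ • τ) = rootFactor σ τ * w * Theta τ) ∧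
    ∀ τ, Theta1 (σ • τ) = rootFactor σ τ * w *
      Complex.I ^ ((σ 0 1 : ZMod 4) * (σ 1 1 : ZMod 4)).val * Theta1 τ := by
  have hR : LocalRootClosed 3 (⊤ : Subring ℂ) := ⟨fun _ _ => trivial, fun _ _ _ _ => trivial⟩
  obtain ⟨A, -, B, -, C, -, D, -, h1, h2, h3⟩ := exists_theta_smul le_rfl hR σ
  have hc : ((σ 1 0 : ℤ) : ZMod 4) = 0 := by
    exact (ZMod.intCast_zmod_eq_zero_iff_dvd _ 4).mpr (by exact_mod_cast h)
  have e1 := h3 _ _ _ _ _ thetaCusp_infty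
  have e2 := h3 _ _ _ _ _ thetaCusp_zero
  have e3 := h3 _ _ _ _ _ thetaCusp_neg_one_two
  simp only [hc, mul_one, mul_zero, zero_mul, add_zero, zero_add] at e1 e2 e3
  have ha : (σ 0 0 : ZMod 4) * (σ 0 0 : ZMod 4) = 1 := e1.prim.resolve_right (by decide)
  have hd : (σ 1 1 : ZMod 4) * (σ 1 1 : ZMod 4) = 1 := by
    have := congrArg (Int.cast : ℤ → ZMod 4) (Matrix.det_fin_two σ.1 ▸ σ.2)
    push_cast at this
    have h0 : ((σ.1 1 0 : ℤ) : ZMod 4) = 0 := hc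
    rw [h0, mul_zero, sub_zero] at this
    have key : ∀ x y : ZMod 4, x * y = 1 → y * y = 1 := by decide
    exact key _ _ this
  have hd2 : (σ 1 1 : ZMod 4) * 2 = 2 := by
    have key : ∀ x : ZMod 4, x * x = 1 → x * 2 = 2 := by decide
    exact key _ hd
  obtain ⟨rfl, hA⟩ := e1.of_zero rfl
  obtain ⟨rfl, -⟩ := e3.of_two hd2
  obtain ⟨hD, -⟩ := e2.of_odd hd
  rw [one_mul] at hA
  simp only [zero_add, add_zero] at hD
  refine ⟨A, hA, ?_, fun τ => ?_, fun τ => ?_⟩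
  · have : A ^ 4 = (A ^ 2) ^ 2 := by ring
    rw [this, hA]
    exact_mod_cast chi_four_sq ha
  · rw [h1]; ring
  · rw [h2, hD]; ring

lemma theta_smul_of_not_dvd {p : ℕ} {R : Subring ℂ} (hp3 : 3 ≤ p) (hR : LocalRootClosed p R)
    (σ : SL(2, ℤ)) (h : ¬ 4 ∣ σ 1 0) : ∃ C ∈ R, ∃ D ∈ R, C ≠ 0 ∧ C⁻¹ ∈ R ∧
      ∀ τ, Theta1 (σ • τ) = rootFactor σ τ * (C * Theta τ + D * Theta1 τ) := by
  obtain ⟨A, hA, B, hB, C, hC, D, hD, h1, h2, h3⟩ := exists_theta_smul hp3 hR σ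
  have hc : ((σ 1 0 : ℤ) : ZMod 4) ≠ 0 := by
    intro h0
    exact h (by exact_mod_cast (ZMod.intCast_zmod_eq_zero_iff_dvd _ 4).mp h0)
  have e1 := h3 _ _ _ _ _ thetaCusp_infty
  simp only [mul_one, mul_zero, add_zero] at e1
  have key : ∃ k ∈ R, k * C ^ 4 = 1 := by
    have hcc : ∀ c : ZMod 4, c ≠ 0 → c = 2 ∨ c * c = 1 := by decide
    rcases hcc _ hc with h0 | h0
    · have ha := e1.prim.resolve_right (by rw [h0]; decide)
      refine ⟨1, R.one_mem, ?_⟩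
      have := (e1.of_two h0).2
      rw [one_mul] at this
      rw [one_mul, show C ^ 4 = (C ^ 2) ^ 2 by ring, this]
      exact_mod_cast chi_four_sq ha
    · obtain ⟨e2, e3⟩ := e1.of_odd h0
      refine ⟨-4, R.neg_mem (by exact_mod_cast natCast_mem R 4), ?_⟩
      set k := ((σ 0 0 : ZMod 4) * (σ 1 0 : ZMod 4)).val
      have e4 : (Complex.I ^ k) ^ 4 = 1 := by
        rw [← pow_mul, mul_comm, pow_mul, Complex.I_pow_four, one_pow]
      have e5 : (2 * Complex.I * 1 * A ^ 2) ^ 2 = 1 := by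
        rw [e3]; exact_mod_cast chi_four_sq h0
      rw [e2, mul_pow, e4, one_mul, ← e5]
      linear_combination -4 * A ^ 4 * Complex.I_sq
  obtain ⟨k, hk, hk1⟩ := key
  have hC0 : C ≠ 0 := by rintro rfl; simp at hk1
  refine ⟨C, hC, D, hD, hC0, ?_, h2⟩
  have : C⁻¹ = k * C ^ 3 := by
    exact inv_eq_of_mul_eq_one_left (by linear_combination hk1)
  rw [this]
  exact R.mul_mem hk (R.pow_mem hC 3)

lemma Theta_smul_pow_four (σ : SL(2, ℤ)) (h : 4 ∣ σ 1 0) (τ : ℍ) :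
    Theta (σ • τ) ^ 4 = denomC σ τ ^ 2 * Theta τ ^ 4 := by
  obtain ⟨w, -, hw, h1, -⟩ := theta_smul_of_dvd σ h
  rw [h1, ← rootFactor_sq, mul_pow, mul_pow, hw]
  ring

lemma denomC_affMap {α β δ : ℤ} (hα : 0 < α) (hδ : 0 < δ) {σ σ' : SL(2, ℤ)}
    (h10 : σ 1 0 = σ' 1 0 * α) (h11 : σ 1 1 = σ' 1 0 * β + σ' 1 1 * δ) (τ : ℍ) :
    δ * denomC σ' (affMap (α / δ) (β / δ) τ) = denomC σ τ := by
  have hδ' : (δ : ℂ) ≠ 0 := by exact_mod_cast hδ.ne'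
  have hpos : (0 : ℝ) < α / δ := by positivity
  simp only [denomC]
  rw [coe_affMap hpos, h10, h11]
  push_cast
  field_simp
  ring

lemma affMap_smul {N α β δ : ℤ} (hN : 0 < N) (hα : 0 < α) (hδ : 0 < δ) {σ σ' : SL(2, ℤ)}
    (h00 : N * σ 0 0 = σ' 0 0 * α) (h01 : N * σ 0 1 = σ' 0 0 * β + σ' 0 1 * δ)
    (h10 : σ 1 0 = σ' 1 0 * α) (h11 : σ 1 1 = σ' 1 0 * β + σ' 1 1 * δ) (τ : ℍ) :
    affMap N 0 (σ • τ) = σ' • affMap (α / δ) (β / δ) τ := by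
  have hδ' : (δ : ℂ) ≠ 0 := by exact_mod_cast hδ.ne'
  have hpos : (0 : ℝ) < α / δ := by positivity
  have hN' : (0 : ℝ) < N := by exact_mod_cast hN
  have h1 := denomC_ne_zero σ τ
  have h2 := denomC_affMap hα hδ h10 h11 τ
  apply UpperHalfPlane.ext
  rw [coe_affMap hN', coe_smul_eq_div, coe_smul_eq_div, eq_div_iff (denomC_ne_zero _ _),
    coe_affMap hpos]
  have h3 : denomC σ' (affMap (α / δ) (β / δ) τ) = denomC σ τ / δ := by
    rw [← h2]; field_simp
  have h00' : (N * σ 0 0 : ℂ) = σ' 0 0 * α := by exact_mod_cast h00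
  have h01' : (N * σ 0 1 : ℂ) = σ' 0 0 * β + σ' 0 1 * δ := by exact_mod_cast h01
  rw [h3]
  push_cast
  field_simp
  linear_combination (τ : ℂ) * h00' + h01'

/-- The modular form `Θ₁(Nτ)/2`, whose order at `∞` is `N/4`. -/
def Psi (N : ℕ) (τ : ℍ) : ℂ := Theta1 (affMap N 0 τ) / 2

lemma Psi_ne_zero (N : ℕ) (τ : ℍ) : Psi N τ ≠ 0 := div_ne_zero (Theta1_ne_zero _) two_ne_zero

lemma exists_conj_Gamma0 {N : ℕ} (hN : 0 < N) {γ : SL(2, ℤ)} (h : γ ∈ Gamma0 (4 * N)) :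
    ∃ γ' : SL(2, ℤ), 4 ∣ γ' 1 0 ∧ γ' 0 0 = γ 0 0 ∧ γ' 0 1 = N * γ 0 1 ∧ γ' 1 1 = γ 1 1 ∧
      (∀ τ, affMap N 0 (γ • τ) = γ' • affMap N 0 τ) ∧
      ∀ τ, denomC γ' (affMap N 0 τ) = denomC γ τ := by
  obtain ⟨c, hc⟩ : ((4 * N : ℕ) : ℤ) ∣ γ 1 0 :=
    (ZMod.intCast_zmod_eq_zero_iff_dvd _ _).mp (by simpa using Gamma0_mem.mp h)
  have hdet : γ 0 0 * γ 1 1 - γ 0 1 * γ 1 0 = 1 := Matrix.det_fin_two γ.1 ▸ γ.2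
  let γ' : SL(2, ℤ) := ⟨!![γ 0 0, N * γ 0 1; 4 * c, γ 1 1], by
    rw [Matrix.det_fin_two_of]
    rw [hc] at hdet
    push_cast at hdet
    linear_combination hdet⟩
  have e00 : γ' 0 0 = γ 0 0 := rfl
  have e01 : γ' 0 1 = N * γ 0 1 := rfl
  have e10 : γ' 1 0 = 4 * c := rfl
  have e11 : γ' 1 1 = γ 1 1 := rfl
  have hN' : (0 : ℤ) < N := by exact_mod_cast hN
  have h10 : γ 1 0 = γ' 1 0 * N := by rw [hc, e10]; push_cast; ring
  have h11 : γ 1 1 = γ' 1 0 * 0 + γ' 1 1 * 1 := by rw [e11]; ring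
  refine ⟨γ', ⟨c, e10⟩, e00, e01, e11, fun τ => ?_, fun τ => ?_⟩
  · have := affMap_smul (σ := γ) (σ' := γ') hN' hN' one_pos (β := 0) (by rw [e00]; ring)
      (by rw [e01]; ring) h10 h11 τ
    simpa using this
  · have := denomC_affMap (σ := γ) (σ' := γ') hN' one_pos h10 h11 τ
    simpa using this

lemma Theta_eq_add (τ : ℍ) : Theta τ = Theta (affMap 4 0 τ) + Theta1 (affMap 4 0 τ) := by
  rw [Theta_eq_jacobiTheta, Theta_eq_jacobiTheta, Theta1, coe_affMap (by norm_num)]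
  push_cast
  rw [show ((4 : ℂ) * τ + 0) / 2 = 2 * τ by ring]
  ring

lemma Psi_smul {N r : ℕ} (hN : N * r = 4) {γ : SL(2, ℤ)} (hγ : γ ∈ Gamma0 (4 * N)) (τ : ℍ) :
    Psi N (γ • τ) ^ r * Theta τ ^ r = Psi N τ ^ r * Theta (γ • τ) ^ r := by
  have hN0 : 0 < N := Nat.pos_of_ne_zero (by rintro rfl; simp at hN)
  obtain ⟨γ', h4, e00, e01, e11, h5, h6⟩ := exists_conj_Gamma0 hN0 hγ
  have h4γ : 4 ∣ γ 1 0 := by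
    have := (ZMod.intCast_zmod_eq_zero_iff_dvd _ _).mp (by simpa using Gamma0_mem.mp hγ)
    exact dvd_trans ⟨(N : ℤ), by push_cast; ring⟩ this
  obtain ⟨w, hw2, hw4, hT, hT1⟩ := theta_smul_of_dvd γ' h4
  obtain ⟨w', hw2', hw4', hT', -⟩ := theta_smul_of_dvd γ h4γ
  rw [e00] at hw2
  have hrf := rootFactor_sq γ' (affMap N 0 τ)
  rw [h6, ← rootFactor_sq γ τ] at hrf
  simp only [Psi]
  rw [e01] at hT1
  rw [h5, hT1]
  have hIr : (Complex.I ^ (((N * γ 0 1 : ℤ) : ZMod 4) * (γ' 1 1 : ZMod 4)).val) ^ r = 1 := by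
    have hd : 4 ∣ (((N * γ 0 1 : ℤ) : ZMod 4) * (γ' 1 1 : ZMod 4)).val * r := by
      have h0 : (((((N * γ 0 1 : ℤ) : ZMod 4) * (γ' 1 1 : ZMod 4)).val * r : ℕ) : ZMod 4) = 0 := by
        rw [Nat.cast_mul, ZMod.natCast_zmod_val]
        have : ((N * r : ℕ) : ZMod 4) = 0 := by rw [hN]; decide
        push_cast at this ⊢
        linear_combination ((γ 0 1 : ℤ) : ZMod 4) * ((γ' 1 1 : ℤ) : ZMod 4) * this
      exact (ZMod.natCast_eq_zero_iff _ _).mp h0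
    obtain ⟨k, hk⟩ := hd
    rw [← pow_mul, hk, pow_mul, Complex.I_pow_four, one_pow]
  set J := Complex.I ^ (((N * γ 0 1 : ℤ) : ZMod 4) * (γ' 1 1 : ZMod 4)).val
  set ρ' := rootFactor γ' (affMap N 0 τ)
  set ρ := rootFactor γ τ
  have hr : r = 1 ∨ r = 2 ∨ r = 4 := by
    have : r ∣ 4 := ⟨N, by rw [← hN]; ring⟩
    have := Nat.le_of_dvd (by norm_num) this
    interval_cases r <;> simp_all
  rcases hr with rfl | rfl | rfl
  · obtain rfl : N = 4 := by omega
    rw [pow_one] at hIr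
    have key : ∀ τ, Theta τ = Theta (affMap (4 : ℕ) 0 τ) + Theta1 (affMap (4 : ℕ) 0 τ) := fun τ => by
      rw [Nat.cast_ofNat]; exact Theta_eq_add τ
    rw [key (γ • τ), h5, hT, hT1, key τ]
    linear_combination ρ' * w * Theta1 (affMap (4 : ℕ) 0 τ) * Theta (affMap (4 : ℕ) 0 τ) / 2 * hIr
  · rw [hT']
    have : w ^ 2 = w' ^ 2 := by rw [hw2, hw2']
    have e : (ρ' * w * J) ^ 2 = (ρ * w') ^ 2 := by
      rw [mul_pow, hIr, mul_pow, hrf, this, mul_pow, mul_one]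
    linear_combination (Theta1 (affMap N 0 τ) / 2) ^ 2 * Theta τ ^ 2 * e
  · rw [hT']
    have e : (ρ' * w * J) ^ 4 = (ρ * w') ^ 4 := by
      rw [mul_pow, hIr, mul_pow, hw4, mul_pow, hw4']
      linear_combination (ρ' ^ 2 + ρ ^ 2) * hrf
    linear_combination (Theta1 (affMap N 0 τ) / 2) ^ 4 * Theta τ ^ 4 * e

lemma coeff_squareSeries_mem (R : Subring ℂ) (i : ℕ) : PowerSeries.coeff i squareSeries ∈ R := by
  rw [squareSeries, PowerSeries.coeff_mk]
  split_ifs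
  exacts [R.one_mem, R.zero_mem]

lemma oddSquareSeries_mem {p m : ℕ} (R : Subring ℂ) : oddSquareSeries ∈ sparseSeries p m 1 R := by
  rw [mem_sparseSeries_one]
  intro i
  rw [oddSquareSeries, PowerSeries.coeff_mk]
  split_ifs
  exacts [R.one_mem, R.zero_mem]

lemma thetaSeries_mem {p m : ℕ} (R : Subring ℂ) :
    1 + PowerSeries.C 2 * squareSeries ∈ sparseSeries p m 1 R :=
  add_mem (one_mem _) (mul_mem (C_mem_sparseSeries (by exact_mod_cast natCast_mem R 2))
    (mem_sparseSeries_one.2 (coeff_squareSeries_mem R)))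

lemma HasExp.comp_affMap {p m : ℕ} {R : Subring ℂ} (hR : LocalRootClosed p R) {h H : ℕ}
    {x : PowerSeries ℂ} {F : ℍ → ℂ} (hx : x ∈ sparseSeries p m 1 R) (hF : HasExp h x F)
    {α δ : ℕ} (β : ℤ) (hα : 0 < α) (hδ : 0 < δ) (hh : 0 < h) (hH : 0 < H) (hdvd : δ * h ∣ H) :
    ∃ y ∈ sparseSeries p m 1 R, PowerSeries.coeff 0 y = PowerSeries.coeff 0 x ∧
      HasExp H y (fun τ => F (affMap (α / δ) (β / δ) τ)) := by
  obtain ⟨k, hk⟩ := hdvd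
  have hk0 : k ≠ 0 := by rintro rfl; simp at hk; omega
  have hroot : Complex.exp (2 * π * Complex.I * ((β : ℝ) : ℂ) / (δ * h)) ∈ R := by
    refine hR.root_mem (δ * h) _ (by positivity) ?_
    rw [← Complex.exp_nat_mul]
    have h1 : (δ : ℂ) ≠ 0 := by exact_mod_cast hδ.ne'
    have h2 : (h : ℂ) ≠ 0 := by exact_mod_cast hh.ne'
    have : ((δ * h : ℕ) : ℂ) * (2 * π * Complex.I * ((β : ℝ) : ℂ) / (δ * h)) =
        β * (2 * π * Complex.I) := by push_cast; field_simp
    rw [this, Complex.exp_int_mul_two_pi_mul_I]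
    exact R.one_mem
  have h3 := (((hF.comp_div hδ.ne' β).comp_mul hα.ne').expand hk0)
  refine ⟨_, ?_, ?_, (by rw [hk, mul_comm]; exact h3 : HasExp H _ _).congr_fun fun τ => ?_⟩
  · refine expand_mem_sparseSeries (expand_mem_sparseSeries ?_ _) _
    rw [mem_sparseSeries_one] at hx ⊢
    intro i
    rw [PowerSeries.coeff_rescale]
    exact R.mul_mem (R.pow_mem hroot i) (hx i)
  · rw [PowerSeries.coeff_zero_eq_constantCoeff_apply, PowerSeries.constantCoeff_expand,
      PowerSeries.constantCoeff_expand, ← PowerSeries.coeff_zero_eq_constantCoeff_apply,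
      PowerSeries.coeff_rescale, pow_zero, one_mul]
  · congr 1
    apply UpperHalfPlane.ext
    have h1 : (0 : ℝ) < α := by exact_mod_cast hα
    have h2 : (0 : ℝ) < δ := by exact_mod_cast hδ
    rw [coe_affMap (by positivity), coe_affMap (by positivity), coe_affMap h1]
    push_cast
    ring

/-- Factorisation of `(N,0;0,1)σ` as an integral unimodular matrix times an upper triangular
matrix. -/
lemma exists_hermite {N : ℕ} (hN : 0 < N) (hN4 : N ∣ 4) {σ : SL(2, ℤ)}
    (hσ : σ ∉ Gamma0 (4 * N)) :
    ∃ (σ' : SL(2, ℤ)) (α δ : ℕ) (β : ℤ), 0 < α ∧ 0 < δ ∧ δ ∣ N ∧ ¬ 4 ∣ σ' 1 0 ∧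
      (∀ τ, affMap N 0 (σ • τ) = σ' • affMap (α / δ) (β / δ) τ) ∧
      ∀ τ, δ * denomC σ' (affMap (α / δ) (β / δ) τ) = denomC σ τ := by
  have hdet : σ 0 0 * σ 1 1 - σ 0 1 * σ 1 0 = 1 := Matrix.det_fin_two σ.1 ▸ σ.2
  set a := σ 0 0
  set b := σ 0 1
  set c := σ 1 0
  set d := σ 1 1
  obtain ⟨α, hα⟩ : ∃ α, α = Int.gcd N c := ⟨_, rfl⟩
  have hα0 : 0 < α := hα ▸ Int.gcd_pos_of_ne_zero_left _ (by exact_mod_cast hN.ne')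
  obtain ⟨δ, hδ⟩ : (α : ℤ) ∣ N := hα ▸ Int.gcd_dvd_left _ _
  obtain ⟨c', hc'⟩ : (α : ℤ) ∣ c := hα ▸ Int.gcd_dvd_right _ _
  have hδ0 : 0 < δ := by
    have : (0 : ℤ) < α * δ := by rw [← hδ]; exact_mod_cast hN
    exact pos_of_mul_pos_right this (by positivity)
  lift δ to ℕ using hδ0.le
  have hcop : IsCoprime (δ : ℤ) c' := by
    rw [Int.isCoprime_iff_gcd_eq_one]
    have h1 : Int.gcd ((α : ℤ) * δ) (α * c') = α * Int.gcd δ c' := by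
      rw [Int.gcd_mul_left]; simp
    rw [← hδ, ← hc', ← hα] at h1
    exact Nat.eq_of_mul_eq_mul_left hα0 (by rw [← h1, mul_one])
  have hcop' : IsCoprime (δ * a : ℤ) c' := by
    refine hcop.mul_left ⟨d, -(b * α), ?_⟩
    rw [hc'] at hdet
    linear_combination hdet
  obtain ⟨y, x, hxy⟩ := hcop'
  let σ' : SL(2, ℤ) := ⟨!![δ * a, -x; c', y], by
    rw [Matrix.det_fin_two_of]
    linear_combination hxy⟩
  have e00 : σ' 0 0 = δ * a := rfl
  have e01 : σ' 0 1 = -x := rfl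
  have e10 : σ' 1 0 = c' := rfl
  have e11 : σ' 1 1 = y := rfl
  have hα' : (0 : ℤ) < α := by exact_mod_cast hα0
  have hN' : (0 : ℤ) < N := by exact_mod_cast hN
  have f10 : σ 1 0 = σ' 1 0 * α := by rw [e10, mul_comm]; exact hc'
  have f11 : σ 1 1 = σ' 1 0 * (y * N * b + x * d) + σ' 1 1 * δ := by
    rw [e10, e11, hδ]
    change d = _
    rw [hc'] at hdet
    linear_combination (-d) * hxy + y * δ * hdet
  refine ⟨σ', α, δ, y * N * b + x * d, hα0, by exact_mod_cast hδ0,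
    Int.natCast_dvd_natCast.mp ⟨α, by rw [hδ, mul_comm]⟩, ?_, fun τ => ?_, fun τ => ?_⟩
  · rw [e10]
    rintro ⟨c'', rfl⟩
    apply hσ
    have h4 : (N : ℤ) ∣ c := by
      have : (4 : ℤ) ∣ c := ⟨α * c'', by rw [hc']; ring⟩
      exact dvd_trans (by exact_mod_cast hN4) this
    have hαN : α = N := by
      rw [hα]
      simpa using Int.gcd_eq_natAbs_left h4
    rw [Gamma0_mem]
    change ((c : ℤ) : ZMod (4 * N)) = 0
    rw [ZMod.intCast_zmod_eq_zero_iff_dvd]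
    exact ⟨c'', by rw [hc', hαN]; push_cast; ring⟩
  · have := affMap_smul (σ := σ) (σ' := σ') hN' hα' hδ0 (β := y * N * b + x * d)
      (by rw [e00, hδ]; change _ * a = _; ring)
      (by
        rw [e00, e01]
        change _ * b = _
        rw [hδ]
        rw [hc'] at hdet
        linear_combination (-(δ : ℤ) * α * b) * hxy - x * δ * hdet)
      f10 f11 τ
    push_cast at this ⊢
    exact this
  · have := denomC_affMap (σ := σ) (σ' := σ') hα' hδ0 f10 f11 τ
    push_cast at this ⊢
    exact this

lemma exists_cusp_expansion {N p m : ℕ} {R : Subring ℂ} (hN : 0 < N) (hN4 : N ∣ 4) (hp : p.Prime)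
    (hp3 : 3 ≤ p) (hR : LocalRootClosed p R) {σ : SL(2, ℤ)} (hσ : σ ∉ Gamma0 (4 * N)) :
    ∃ x ∈ sparseSeries p m 1 R, ∃ y ∈ sparseSeries p m 1 R, ∃ X Y : ℍ → ℂ,
      HasExp 16 x X ∧ HasExp 16 y Y ∧ PowerSeries.coeff 0 y ≠ 0 ∧ (PowerSeries.coeff 0 y)⁻¹ ∈ R ∧
      (∀ τ, Theta (σ • τ) = rootFactor σ τ * X τ) ∧
      ∀ τ, Psi N (σ • τ) = rootFactor σ τ * Y τ := by
  obtain ⟨A, hA, B, hB, -, -, -, -, h1, -, -⟩ := exists_theta_smul hp3 hR σ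
  obtain ⟨σ', α, δ, β, hα, hδ, hδN, h4, h2, h3⟩ := exists_hermite hN hN4 hσ
  obtain ⟨C, hC, D, hD, hC0, hCinv, h5⟩ := theta_smul_of_not_dvd hp3 hR σ' h4
  have hδ4 : δ ∣ 4 := hδN.trans hN4
  have hδp : ¬ p ∣ δ := fun h => by
    have h' : p ∣ 2 ^ 2 := h.trans hδ4
    have := Nat.le_of_dvd two_pos (hp.dvd_of_dvd_pow h')
    omega
  have hδ0 : (δ : ℂ) ≠ 0 := by exact_mod_cast hδ.ne'
  have h2R : (2 : ℂ) ∈ R := by exact_mod_cast natCast_mem R 2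
  have h2inv := hR.two_inv_mem hp3
  have hX : PowerSeries.X * PowerSeries.expand 4 four_ne_zero oddSquareSeries ∈
      sparseSeries p m 1 R :=
    mul_mem (mem_sparseSeries_one.2 fun i => by
      rw [PowerSeries.coeff_X]; split_ifs; exacts [R.one_mem, R.zero_mem])
      (expand_mem_sparseSeries (oddSquareSeries_mem R) _)
  have hcontμ : Continuous fun τ : ℍ => rootFactor σ' (affMap (α / δ) (β / δ) τ) := by
    refine (continuous_rootFactor σ').comp ?_
    rw [UpperHalfPlane.isEmbedding_coe.continuous_iff]
    have : ((↑) : ℍ → ℂ) ∘ affMap (α / δ) (β / δ) = fun τ : ℍ => ((α / δ : ℝ) : ℂ) * τ + ((β / δ : ℝ) : ℂ) :=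
      funext fun τ => coe_affMap (by positivity) _ τ
    rw [this]
    fun_prop
  obtain ⟨s, hs, hμ⟩ := exists_eq_mul_rootFactor (σ := σ) hcontμ (inv_ne_zero hδ0) (fun τ => by
    rw [rootFactor_sq, ← h3, inv_mul_cancel_left₀ hδ0])
  have hsR : s ∈ R := hR.root_mem 2 _ two_pos (hs ▸ hR.inv_mem δ hδp)
  have hs0 : s ≠ 0 := by rintro rfl; exact inv_ne_zero hδ0 (by rw [← hs]; ring)
  have hsinv : s⁻¹ ∈ R := by
    refine hR.root_mem 2 _ two_pos ?_
    rw [inv_pow, hs, inv_inv]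
    exact natCast_mem R δ
  obtain ⟨u, huR, hu0, hu⟩ := HasExp.comp_affMap (H := 16) hR (thetaSeries_mem (m := m) R)
    Theta_hasExp β hα hδ one_pos (by norm_num) (by rw [mul_one]; exact hδ4.trans (by norm_num))
  obtain ⟨v, hvR, hv0, hv⟩ := HasExp.comp_affMap (H := 16) hR hX half_Theta1_hasExp β hα hδ four_pos
    (by norm_num) (Nat.mul_dvd_mul hδ4 (dvd_refl 4))
  have hy0 : PowerSeries.coeff 0 (PowerSeries.C (s * 2⁻¹ * C) * u + PowerSeries.C (s * D) * v) =
      s * 2⁻¹ * C := by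
    rw [map_add, PowerSeries.coeff_C_mul, PowerSeries.coeff_C_mul, hu0, hv0]
    simp [constantCoeff_squareSeries]
  refine ⟨PowerSeries.C A * (PowerSeries.expand 16 (by norm_num) (1 + PowerSeries.C 2 * squareSeries)) +
      PowerSeries.C (2 * B) * PowerSeries.expand 4 (by norm_num)
        (PowerSeries.X * PowerSeries.expand 4 four_ne_zero oddSquareSeries),
    add_mem (mul_mem (C_mem_sparseSeries hA) (expand_mem_sparseSeries (thetaSeries_mem R) _))
      (mul_mem (C_mem_sparseSeries (R.mul_mem h2R hB)) (expand_mem_sparseSeries hX _)),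
    PowerSeries.C (s * 2⁻¹ * C) * u + PowerSeries.C (s * D) * v,
    add_mem (mul_mem (C_mem_sparseSeries (R.mul_mem (R.mul_mem hsR h2inv) hC)) huR)
      (mul_mem (C_mem_sparseSeries (R.mul_mem hsR hD)) hvR),
    _, _, ((Theta_hasExp.expand _).const_mul A).add ((half_Theta1_hasExp.expand _).const_mul (2 * B)),
    (hu.const_mul _).add (hv.const_mul _), ?_, ?_, fun τ => ?_, fun τ => ?_⟩
  · rw [hy0]
    exact mul_ne_zero (mul_ne_zero hs0 (by norm_num)) hC0
  · rw [hy0, mul_inv, mul_inv, inv_inv]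
    exact R.mul_mem (R.mul_mem hsinv h2R) hCinv
  · rw [h1]; ring
  · rw [Psi, h2, h5, hμ]; ring

lemma Psi_pow_eq {N r : ℕ} (hN : N * r = 4) (τ : ℍ) :
    Psi N τ ^ r = Function.Periodic.qParam 1 τ * thetaUnit (affMap N 0 τ) ^ r := by
  have hN0 : (0 : ℝ) < N := by
    have : N ≠ 0 := by rintro rfl; simp at hN
    exact_mod_cast Nat.pos_of_ne_zero this
  have hNr : (N : ℂ) * r = 4 := by exact_mod_cast hN
  rw [Psi, Theta1_eq, mul_div_cancel_left₀ _ two_ne_zero, mul_pow]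
  congr 1
  simp only [Function.Periodic.qParam]
  rw [← Complex.exp_nat_mul, coe_affMap hN0]
  congr 1
  push_cast
  linear_combination (2 * π * Complex.I * τ / 4) * hNr

lemma thetaUnit_ne_zero (τ : ℍ) : thetaUnit τ ≠ 0 := fun h =>
  Theta1_ne_zero τ (by rw [Theta1_eq, h, mul_zero, mul_zero])

lemma exists_testForm {N r p m b b' s ε n κ lam : ℕ} {R : Subring ℂ} (hN : N * r = 4)
    (hp : p.Prime) (hp3 : 3 ≤ p) (hR : LocalRootClosed p R) (hs : s + ε = r * n)
    (hκ : 2 * κ + 2 * lam = 3 + ε * p ^ b) (hκ2 : 2 ∣ κ) (hb : b' + m ≤ b + 1)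
    {A : ℍ → ℂ} {x : PowerSeries ℂ} (hA : SparseForm p m (p ^ b') R κ A x) :
    ∃ g : ℍ → ℂ, MDifferentiable 𝓘(ℂ) 𝓘(ℂ) g ∧
      (∀ γ ∈ Gamma0 (4 * N), ∀ τ,
        (Theta (γ • τ) / Theta τ) ^ (2 * lam + 1) * g (γ • τ) = denomC γ τ ^ 2 * g τ) ∧
      (∃ z, HasExp 1 z (fun τ => g τ * Function.Periodic.qParam 1 τ ^ (n * p ^ b)) ∧
        PowerSeries.coeff 0 z ≠ 0 ∧ (PowerSeries.coeff 0 z)⁻¹ ∈ R ∧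
        z ∈ sparseSeries p 1 (p ^ b) R ∧ z ∈ sparseSeries p m (p ^ b') R) ∧
      ∀ σ ∉ Gamma0 (4 * N), ∃ z ∈ sparseSeries p m (p ^ b') R, ∃ G, HasExp 16 z G ∧
        ∀ τ, rootFactor σ τ ^ (2 * lam) * g (σ • τ) = rootFactor σ τ ^ 3 * G τ := by
  have hN0 : 0 < N := Nat.pos_of_ne_zero (by rintro rfl; simp at hN)
  refine ⟨fun τ => (Theta τ ^ s / Psi N τ ^ (r * n)) ^ p ^ b * A τ, ?_, fun γ hγ τ => ?_, ?_,
    fun σ hσ => ?_⟩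
  · have h1 := UpperHalfPlane.mdifferentiable_iff.1 (Theta_hasExp.mdifferentiable one_pos)
    have h2 := UpperHalfPlane.mdifferentiable_iff.1
      ((half_Theta1_hasExp.comp_mul hN0.ne').mdifferentiable four_pos)
    have h3 := UpperHalfPlane.mdifferentiable_iff.1 (hA.hasExp.mdifferentiable one_pos)
    rw [UpperHalfPlane.mdifferentiable_iff]
    exact (((h1.pow s).div (h2.pow (r * n)) fun z _ => pow_ne_zero _ (Psi_ne_zero N _)).pow _).mul h3
  · have h1 := Psi_smul hN hγ τ
    have h4γ : 4 ∣ γ 1 0 := by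
      have := (ZMod.intCast_zmod_eq_zero_iff_dvd _ _).mp (by simpa using Gamma0_mem.mp hγ)
      exact dvd_trans ⟨(N : ℤ), by push_cast; ring⟩ this
    have h2 := Theta_smul_pow_four γ h4γ τ
    have t0 := Theta_ne_zero τ
    have t1 := Theta_ne_zero (γ • τ)
    have p0 := Psi_ne_zero N τ
    have p1 := Psi_ne_zero N (γ • τ)
    obtain ⟨ρ, hρ⟩ : ∃ ρ, ρ = Theta (γ • τ) / Theta τ := ⟨_, rfl⟩
    have e1 : Theta (γ • τ) = ρ * Theta τ := by rw [hρ]; field_simp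
    have hρ0 : ρ ≠ 0 := by rw [hρ]; exact div_ne_zero t1 t0
    have e2 : ρ ^ 4 = denomC γ τ ^ 2 := by
      rw [hρ, div_pow, h2]; field_simp
    have e3 : Psi N (γ • τ) ^ r = Psi N τ ^ r * ρ ^ r := by
      rw [e1, mul_pow, ← mul_assoc] at h1
      exact mul_right_cancel₀ (pow_ne_zero r t0) h1
    obtain ⟨l, rfl⟩ := hκ2
    have e4 : ρ ^ (2 * lam + 1) * denomC γ τ ^ (2 * l) = denomC γ τ ^ 2 * ρ ^ (ε * p ^ b) := by
      rw [pow_mul, ← e2, ← pow_mul, ← pow_add, ← pow_add]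
      congr 1
      omega
    have e5 : Theta (γ • τ) ^ s / Psi N (γ • τ) ^ (r * n) =
        Theta τ ^ s / Psi N τ ^ (r * n) * (ρ ^ ε)⁻¹ := by
      rw [pow_mul, e3, e1, mul_pow, mul_pow, ← pow_mul, ← pow_mul, ← hs, pow_add ρ]
      field_simp
    rw [← hρ]
    simp only []
    rw [e5, hA.inv, mul_pow, inv_pow, ← pow_mul]
    calc _ = ρ ^ (2 * lam + 1) * denomC γ τ ^ (2 * l) * (ρ ^ (ε * p ^ b))⁻¹ *
          ((Theta τ ^ s / Psi N τ ^ (r * n)) ^ p ^ b * A τ) := by ring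
      _ = _ := by rw [e4, mul_inv_cancel_right₀ (pow_ne_zero _ hρ0)]
  · set o := PowerSeries.expand N hN0.ne' oddSquareSeries with ho
    have ho0 : PowerSeries.coeff 0 o = 1 := by
      rw [ho, PowerSeries.coeff_zero_eq_constantCoeff_apply, PowerSeries.constantCoeff_expand,
        constantCoeff_oddSquareSeries]
    have hoR : ∀ m', o⁻¹ ∈ sparseSeries p m' 1 R := fun m' =>
      inv_mem_sparseSeries (expand_mem_sparseSeries (oddSquareSeries_mem R) _)
        (by rw [ho0, inv_one]; exact R.one_mem)
    have hV := (thetaUnit_hasExp.comp_mul hN0.ne').inv one_pos (fun τ => thetaUnit_ne_zero _)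
      (by rw [← ho, ho0]; exact one_ne_zero)
    set w := (1 + PowerSeries.C 2 * squareSeries) ^ s * o⁻¹ ^ (r * n) with hw
    have hwR : ∀ i, PowerSeries.coeff i w ∈ R := mem_sparseSeries_one.1
      (mul_mem (pow_mem (thetaSeries_mem R) s) (pow_mem (hoR m) _))
    have hw0 : PowerSeries.constantCoeff w = 1 := by
      have : PowerSeries.constantCoeff o = 1 := by
        rw [← PowerSeries.coeff_zero_eq_constantCoeff_apply]; exact ho0
      rw [hw]
      simp [constantCoeff_squareSeries, PowerSeries.constantCoeff_inv, this]
    have hz0 : PowerSeries.coeff 0 (w ^ p ^ b * x) = PowerSeries.coeff 0 x := by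
      simp [hw0]
    refine ⟨w ^ p ^ b * x, ((((Theta_hasExp.pow s).mul (hV.pow (r * n))).pow (p ^ b)).mul
      hA.hasExp).congr_fun fun τ => ?_, by rw [hz0]; exact hA.ne_zero, by rw [hz0]; exact hA.inv_mem,
      mul_mem (pow_mem_sparseSeries hp hR hwR le_rfl) (sparseSeries_zero_le _ hA.congr),
      mul_mem (pow_mem_sparseSeries hp hR hwR hb) hA.sparse⟩
    have hq : Function.Periodic.qParam 1 (τ : ℂ) ≠ 0 := Complex.exp_ne_zero _
    have hu := thetaUnit_ne_zero (affMap N 0 τ)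
    simp only []
    rw [pow_mul (Psi N τ), Psi_pow_eq hN]
    rw [mul_pow, ← pow_mul (thetaUnit _), inv_pow, pow_mul (Function.Periodic.qParam 1 (τ : ℂ))]
    have : (Theta τ ^ s / (Function.Periodic.qParam 1 (τ : ℂ) ^ n * thetaUnit (affMap N 0 τ) ^ (r * n))) =
        Theta τ ^ s * (thetaUnit (affMap N 0 τ) ^ (r * n))⁻¹ *
          (Function.Periodic.qParam 1 (τ : ℂ) ^ n)⁻¹ := by
      rw [div_eq_mul_inv, mul_inv]; ring
    rw [this, mul_pow _ ((Function.Periodic.qParam 1 (τ : ℂ) ^ n)⁻¹), inv_pow _ (p ^ b)]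
    field_simp
  · obtain ⟨u, hu, v, hv, X, Y, hX, hY, hv0, hvinv, h1, h2⟩ :=
      exists_cusp_expansion (m := m) hN0 ⟨r, hN.symm⟩ hp hp3 hR hσ
    have hY0 : ∀ τ, Y τ ≠ 0 := fun τ h => Psi_ne_zero N (σ • τ) (by rw [h2, h, mul_zero])
    refine ⟨(u ^ s * v⁻¹ ^ (r * n)) ^ p ^ b * PowerSeries.expand 16 (by norm_num) x, ?_, _,
      (((hX.pow s).mul ((hY.inv (by norm_num) hY0 hv0).pow (r * n))).pow (p ^ b)).mul
        (hA.hasExp.expand _), fun τ => ?_⟩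
    · refine mul_mem (pow_mem_sparseSeries hp hR (mem_sparseSeries_one.1 (mul_mem (pow_mem hu _)
        (pow_mem (inv_mem_sparseSeries hv hvinv) _))) hb) (expand_mem_sparseSeries hA.sparse _)
    · have hρ := rootFactor_ne_zero σ τ
      have hY' := hY0 τ
      have e : Theta (σ • τ) ^ s / Psi N (σ • τ) ^ (r * n) =
          X τ ^ s * (Y τ)⁻¹ ^ (r * n) * (rootFactor σ τ ^ ε)⁻¹ := by
        rw [h1, h2, mul_pow, mul_pow, ← hs, pow_add (rootFactor σ τ), inv_pow]
        field_simp
      simp only []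
      rw [e, hA.inv, mul_pow _ ((rootFactor σ τ ^ ε)⁻¹), inv_pow _ (p ^ b), ← pow_mul _ ε,
        ← rootFactor_sq, ← pow_mul]
      have e2 : rootFactor σ τ ^ (2 * lam) * rootFactor σ τ ^ (2 * κ) =
          rootFactor σ τ ^ 3 * rootFactor σ τ ^ (ε * p ^ b) := by
        rw [← pow_add, ← pow_add]; congr 1; omega
      calc _ = rootFactor σ τ ^ (2 * lam) * rootFactor σ τ ^ (2 * κ) *
            (rootFactor σ τ ^ (ε * p ^ b))⁻¹ * ((X τ ^ s * (Y τ)⁻¹ ^ (r * n)) ^ p ^ b * A τ) := by ring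
        _ = _ := by rw [e2, mul_inv_cancel_right₀ (pow_ne_zero _ hρ)]

lemma mem_ball_iff_lt (z : ℂ) :
    z ∈ Metric.ball (2 * Complex.I) (√3) ↔ Complex.normSq z + 1 < 4 * z.im := by
  rw [mem_ball_iff_norm, Real.lt_sqrt (norm_nonneg _), ← Complex.normSq_eq_norm_sq,
    Complex.normSq_apply, Complex.normSq_apply]
  simp only [sub_re, mul_re, re_ofNat, Complex.I_re, im_ofNat, Complex.I_im, sub_im, mul_im]
  constructor <;> intro h <;> nlinarith

lemma im_pos_of_mem_ball {z : ℂ} (hz : z ∈ Metric.ball (2 * Complex.I) (√3)) : 0 < z.im := by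
  have := (mem_ball_iff_lt z).1 hz
  linarith [Complex.normSq_nonneg z]

lemma neg_inv_mem_ball {z : ℂ} (hz : z ∈ Metric.ball (2 * Complex.I) (√3)) :
    -z⁻¹ ∈ Metric.ball (2 * Complex.I) (√3) := by
  have h0 := im_pos_of_mem_ball hz
  have hz0 : z ≠ 0 := by rintro rfl; simp at h0
  have hn : 0 < Complex.normSq z := Complex.normSq_pos.2 hz0
  have := (mem_ball_iff_lt z).1 hz
  rw [mem_ball_iff_lt, Complex.normSq_neg, map_inv₀, neg_im, Complex.inv_im, neg_div, neg_neg]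
  have e : (Complex.normSq z)⁻¹ + 1 = (Complex.normSq z + 1) / Complex.normSq z := by field_simp; ring
  rw [e, ← mul_div_assoc]
  gcongr

/-- The left corner `e^{2πi/3}` of the fundamental domain. -/
def cornerPt : ℍ := ⟨-1 / 2 + √3 / 2 * Complex.I, by simp⟩

lemma coe_cornerPt : (cornerPt : ℂ) = -1 / 2 + √3 / 2 * Complex.I := rfl

lemma add_cornerPt_mem_ball {t : ℝ} (h0 : 0 ≤ t) (h1 : t ≤ 1) :
    (cornerPt : ℂ) + t ∈ Metric.ball (2 * Complex.I) (√3) := by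
  have h3 : √3 * √3 = 3 := Real.mul_self_sqrt (by norm_num)
  have h4 : 1 < √3 := by rw [Real.lt_sqrt] <;> norm_num
  rw [mem_ball_iff_lt, Complex.normSq_apply, coe_cornerPt]
  simp
  nlinarith

lemma neg_inv_cornerPt : -((cornerPt : ℂ) + 1)⁻¹ = cornerPt := by
  have h3 : (√3 : ℂ) * √3 = 3 := by
    rw [← Complex.ofReal_mul, Real.mul_self_sqrt (by norm_num)]; norm_num
  rw [coe_cornerPt, neg_eq_iff_eq_neg, inv_eq_iff_eq_inv, eq_comm]
  refine inv_eq_of_mul_eq_one_right ?_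
  linear_combination (-1 / 4 : ℂ) * Complex.I ^ 2 * h3 - (3 / 4) * Complex.I_sq

lemma continuous_affMap (τ : ℍ) : Continuous fun t : ℝ => affMap 1 t τ := by
  rw [UpperHalfPlane.isOpenEmbedding_coe.isEmbedding.continuous_iff]
  have : UpperHalfPlane.coe ∘ (fun t : ℝ => affMap 1 t τ) = fun t : ℝ => (τ : ℂ) + t := by
    funext t
    simp [coe_affMap one_pos]
  rw [this]
  fun_prop

/-- The integral of a level one, weight two form along the bottom of a fundamental strip. -/
lemma integral_levelOne_eq_zero {F : ℍ → ℂ} (hF : MDifferentiable 𝓘(ℂ) 𝓘(ℂ) F)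
    (hinv : LevelOneInv 2 F) : ∫ t in (0 : ℝ)..1, F (affMap 1 t cornerPt) = 0 := by
  set B := Metric.ball (2 * Complex.I) (√3) with hB
  have hd : DifferentiableOn ℂ (F ∘ ofComplex) B :=
    (UpperHalfPlane.mdifferentiable_iff.1 hF).mono fun z hz => im_pos_of_mem_ball hz
  obtain ⟨Φ, hΦ⟩ := hd.isExactOn_ball
  have hS : ∀ z ∈ B, HasDerivAt (fun w => Φ (-w⁻¹) - Φ w) 0 z := by
    intro z hz
    have h0 := im_pos_of_mem_ball hz
    have hz0 : z ≠ 0 := by rintro rfl; simp at h0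
    have h1 := (hΦ _ (neg_inv_mem_ball hz)).comp z (hasDerivAt_inv hz0).neg
    have e := hinv ModularGroup.S ⟨z, h0⟩
    have e1 : ofComplex (-z⁻¹) = ModularGroup.S • (⟨z, h0⟩ : ℍ) := by
      rw [← ofComplex_apply (ModularGroup.S • (⟨z, h0⟩ : ℍ)), coe_S_smul]
    have e2 : ofComplex z = ⟨z, h0⟩ := ofComplex_apply_of_im_pos h0
    have e3 : denomC ModularGroup.S ⟨z, h0⟩ = z := by simp [denomC, ModularGroup.S]
    refine (h1.sub (hΦ z hz)).congr_deriv ?_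
    rw [Function.comp_apply, Function.comp_apply, e1, e2, e, e3]
    field_simp
    ring
  have hI : Complex.I ∈ B := by rw [hB, mem_ball_iff_lt]; norm_num
  have h1 : (cornerPt : ℂ) + 1 ∈ B := by
    have := add_cornerPt_mem_ball (t := 1) zero_le_one le_rfl
    rwa [ofReal_one] at this
  have hc := Metric.isOpen_ball.is_const_of_deriv_eq_zero (s := B)
    (convex_ball _ _).isPreconnected
    (fun z hz => (hS z hz).differentiableAt.differentiableWithinAt) (fun z hz => (hS z hz).deriv)
    h1 hI
  rw [neg_inv_cornerPt] at hc
  simp only [Complex.inv_I, neg_neg, sub_self] at hc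
  have key : ∀ t ∈ Set.uIcc (0 : ℝ) 1,
      HasDerivAt (fun t : ℝ => Φ ((cornerPt : ℂ) + t)) (F (affMap 1 t cornerPt)) t := by
    intro t ht
    rw [Set.uIcc_of_le zero_le_one] at ht
    have h := hΦ _ (add_cornerPt_mem_ball ht.1 ht.2)
    have h2 := h.comp (t : ℂ) ((hasDerivAt_id (t : ℂ)).const_add (cornerPt : ℂ))
    have h3 := h2.comp_ofReal
    refine h3.congr_deriv ?_
    rw [mul_one, Function.comp_apply, affMap, ofReal_one, one_mul]
  have hcont : Continuous fun t : ℝ => F (affMap 1 t cornerPt) :=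
    hF.continuous.comp (continuous_affMap _)
  rw [intervalIntegral.integral_eq_sub_of_hasDerivAt key (hcont.intervalIntegrable _ _)]
  simp only [ofReal_one, ofReal_zero, add_zero]
  linear_combination -hc

/-- The same integral over any integral number of periods. -/
lemma integral_levelOne_eq_zero' {F : ℍ → ℂ} (hF : MDifferentiable 𝓘(ℂ) 𝓘(ℂ) F)
    (hinv : LevelOneInv 2 F) (n : ℕ) :
    ∫ t in (0 : ℝ)..n, F (affMap 1 t cornerPt) = 0 := by
  have hcont : Continuous fun t : ℝ => F (affMap 1 t cornerPt) :=
    hF.continuous.comp (continuous_affMap _)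
  have hper : Function.Periodic (fun t : ℝ => F (affMap 1 t cornerPt)) 1 := by
    intro t
    have e : affMap 1 (t + 1) cornerPt = affMap 1 1 (affMap 1 t cornerPt) := by
      ext
      simp [coe_affMap one_pos, add_assoc]
    simp only []
    rw [e, affMap_one_one, hinv]
    simp [denomC, ModularGroup.T]
  have := hper.intervalIntegral_add_zsmul_eq n 0 fun _ _ => hcont.intervalIntegrable _ _
  simpa [integral_levelOne_eq_zero hF hinv] using this

open scoped ModularForm in
lemma mdifferentiable_smul_div {F : ℍ → ℂ} (hF : MDifferentiable 𝓘(ℂ) 𝓘(ℂ) F) (σ : SL(2, ℤ)) :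
    MDifferentiable 𝓘(ℂ) 𝓘(ℂ) fun τ => F (σ • τ) / denomC σ τ ^ 2 := by
  have h := MDifferentiable.slash hF 2 (σ : GL (Fin 2) ℝ)
  rw [← ModularForm.SL_slash] at h
  have e : (fun τ => F (σ • τ) / denomC σ τ ^ 2) = F ∣[(2 : ℤ)] σ := by
    funext τ
    rw [ModularForm.SL_slash_apply, ← denomC_eq_denom, _root_.zpow_neg, div_eq_mul_inv]
    norm_cast
  rwa [e]

/-- The residue theorem for weight two forms on a subgroup of finite index: the sum over all cosets
of the integrals of the translates of the form vanishes. -/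
lemma exists_residue_sum (Γ : Subgroup SL(2, ℤ)) [Γ.FiniteIndex] :
    ∃ S : Finset SL(2, ℤ), (∀ σ ∈ S, σ ∉ Γ) ∧ ∀ F : ℍ → ℂ, MDifferentiable 𝓘(ℂ) 𝓘(ℂ) F →
      (∀ γ ∈ Γ, ∀ τ, F (γ • τ) = denomC γ τ ^ 2 * F τ) → ∀ n : ℕ,
      (∫ t in (0 : ℝ)..n, F (affMap 1 t cornerPt)) +
        ∑ σ ∈ S, ∫ t in (0 : ℝ)..n,
          F (σ • affMap 1 t cornerPt) / denomC σ (affMap 1 t cornerPt) ^ 2 = 0 := by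
  classical
  have : Fintype (SL(2, ℤ) ⧸ Γ) := Fintype.ofFinite _
  have hinj : Function.Injective fun q : SL(2, ℤ) ⧸ Γ => q.out⁻¹ := fun q q' h => by
    rw [← q.out_eq', ← q'.out_eq', inv_injective h]
  set o : SL(2, ℤ) ⧸ Γ := ((1 : SL(2, ℤ)) : SL(2, ℤ) ⧸ Γ) with ho
  have hout : ∀ g : SL(2, ℤ), ∃ γ ∈ Γ, ((g : SL(2, ℤ) ⧸ Γ).out)⁻¹ = γ * g⁻¹ := fun g => by
    obtain ⟨γ, hγ⟩ := QuotientGroup.mk_out_eq_mul Γ g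
    exact ⟨(γ : SL(2, ℤ))⁻¹, inv_mem γ.2, by rw [hγ, _root_.mul_inv_rev]⟩
  refine ⟨(Finset.univ.erase o).image fun q => q.out⁻¹, fun σ hσ hmem => ?_, fun F hF hinv n => ?_⟩
  · obtain ⟨q, hq, rfl⟩ := Finset.mem_image.1 hσ
    refine (Finset.mem_erase.1 hq).1 ?_
    rw [← q.out_eq', ho, eq_comm]
    refine QuotientGroup.eq.2 ?_
    simpa using inv_mem hmem
  have hsl : ∀ γ ∈ Γ, ∀ σ τ, F ((γ * σ) • τ) / denomC (γ * σ) τ ^ 2 =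
      F (σ • τ) / denomC σ τ ^ 2 := fun γ hγ σ τ => by
    have h1 := denomC_ne_zero γ (σ • τ)
    rw [mul_smul, hinv γ hγ, denomC_mul, mul_pow, mul_div_mul_left _ _ (pow_ne_zero 2 h1)]
  have hq : ∀ (g : SL(2, ℤ)) τ, F ((g : SL(2, ℤ) ⧸ Γ).out⁻¹ • τ) /
      denomC (g : SL(2, ℤ) ⧸ Γ).out⁻¹ τ ^ 2 = F (g⁻¹ • τ) / denomC g⁻¹ τ ^ 2 := fun g τ => by
    obtain ⟨γ, hγ, e⟩ := hout g
    rw [e, hsl γ hγ]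
  set T : ℍ → ℂ := fun τ => ∑ q : SL(2, ℤ) ⧸ Γ, F (q.out⁻¹ • τ) / denomC q.out⁻¹ τ ^ 2 with hT
  have hTd : MDifferentiable 𝓘(ℂ) 𝓘(ℂ) T := by
    rw [UpperHalfPlane.mdifferentiable_iff]
    have h := fun q : SL(2, ℤ) ⧸ Γ =>
      UpperHalfPlane.mdifferentiable_iff.1 (mdifferentiable_smul_div hF q.out⁻¹)
    exact DifferentiableOn.fun_sum fun q _ => h q
  have hTinv : LevelOneInv 2 T := fun δ τ => by
    simp only [hT]
    rw [Finset.mul_sum, ← Equiv.sum_comp (MulAction.toPerm (δ : SL(2, ℤ)) : Equiv.Perm (SL(2, ℤ) ⧸ Γ))]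
    refine Finset.sum_congr rfl fun q _ => ?_
    have e : (MulAction.toPerm (δ : SL(2, ℤ)) : Equiv.Perm (SL(2, ℤ) ⧸ Γ)) q =
        ((δ * q.out : SL(2, ℤ)) : SL(2, ℤ) ⧸ Γ) := by
      conv_lhs => rw [← q.out_eq']
      rfl
    have h0 := denomC_ne_zero δ τ
    have e2 := denomC_mul q.out⁻¹ (δ⁻¹) (δ • τ)
    have e3 := denomC_mul δ⁻¹ δ τ
    have e4 : denomC (1 : SL(2, ℤ)) τ = 1 := by simp [denomC]
    rw [inv_mul_cancel, e4] at e3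
    rw [e, hq, _root_.mul_inv_rev, e2, mul_smul, inv_smul_smul, eq_inv_of_mul_eq_one_left e3.symm]
    field_simp
  have h0 := integral_levelOne_eq_zero' hTd hTinv n
  have h_int : ∀ q ∈ (Finset.univ : Finset (SL(2, ℤ) ⧸ Γ)), IntervalIntegrable
      (fun t => F (q.out⁻¹ • affMap 1 t cornerPt) / denomC q.out⁻¹ (affMap 1 t cornerPt) ^ 2)
      MeasureTheory.volume 0 n := fun q _ =>
    ((mdifferentiable_smul_div hF q.out⁻¹).continuous.comp
      (continuous_affMap cornerPt)).intervalIntegrable _ _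
  simp only [hT] at h0
  rw [intervalIntegral.integral_finsetSum h_int, ← Finset.add_sum_erase _ _ (Finset.mem_univ o)] at h0
  rw [Finset.sum_image fun _ _ _ _ h => hinj h, ← h0]
  congr 1
  refine intervalIntegral.integral_congr fun t _ => ?_
  simp only [ho]
  rw [hq]
  simp [denomC]

/-- Termwise integration of an absolutely convergent trigonometric series over a period. -/
lemma hasSum_integral_exp {ι : Type*} [Countable ι] {d : ι → ℂ} (hd : Summable fun i => ‖d i‖)
    (l : ι → ℤ) {M : ℕ} (hM : 0 < M) {F : ℝ → ℂ}
    (hF : ∀ t : ℝ,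
      HasSum (fun i => d i * Complex.exp (2 * π * Complex.I * l i * t / M)) (F t)) :
    HasSum (fun i => if l i = 0 then M * d i else 0) (∫ t in (0 : ℝ)..M, F t) := by
  have hM0 : (M : ℂ) ≠ 0 := Nat.cast_ne_zero.2 hM.ne'
  have hn : ∀ i (t : ℝ), ‖d i * Complex.exp (2 * π * Complex.I * l i * t / M)‖ = ‖d i‖ := by
    intro i t
    have e : 2 * π * Complex.I * l i * t / M = ((2 * π * l i * t / M : ℝ) : ℂ) * Complex.I := by
      push_cast; ring
    rw [norm_mul, e, Complex.norm_exp_ofReal_mul_I, mul_one]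
  have h := intervalIntegral.hasSum_integral_of_dominated_convergence (a := (0 : ℝ)) (b := M)
    (μ := MeasureTheory.volume) (f := F)
    (F := fun i t => d i * Complex.exp (2 * π * Complex.I * l i * t / M)) (fun i _ => ‖d i‖)
    (fun i => (by fun_prop : Continuous fun t : ℝ =>
      d i * Complex.exp (2 * π * Complex.I * l i * t / M)).aestronglyMeasurable)
    (fun i => .of_forall fun t _ => (hn i t).le) (.of_forall fun t _ => hd)
    (by simp) (.of_forall fun t _ => hF t)
  have e0 : (fun i => if l i = 0 then M * d i else 0) = fun i => ∫ t in (0 : ℝ)..M,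
      d i * Complex.exp (2 * π * Complex.I * l i * t / M) := by
    funext i
    split_ifs with h0
    · simp [h0]
    · have hc : 2 * π * Complex.I * l i / M ≠ 0 :=
        div_ne_zero (mul_ne_zero Complex.two_pi_I_ne_zero (Int.cast_ne_zero.2 h0)) hM0
      have e : ∀ t : ℝ, 2 * π * Complex.I * l i * t / M = 2 * π * Complex.I * l i / M * t :=
        fun t => by ring
      simp_rw [e]
      rw [intervalIntegral.integral_const_mul, integral_exp_mul_complex hc]
      have e2 : 2 * π * Complex.I * l i / M * ((M : ℝ) : ℂ) = l i * (2 * π * Complex.I) := by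
        push_cast; field_simp
      rw [e2, Complex.exp_int_mul_two_pi_mul_I]
      simp
  rw [e0]
  exact h

lemma hasSum_mul_of_hasSum {ι κ : Type*} {f : ι → ℂ} {g : κ → ℂ} {x y : ℂ} (hf : HasSum f x)
    (hg : HasSum g y) : HasSum (fun i : ι × κ => f i.1 * g i.2) (x * y) :=
  hf.mul hg (summable_mul_of_summable_norm hf.summable.norm hg.summable.norm)

/-- The integral over a period of the product of a Laurent expansion and a power series expansion
extracts the constant term of the product. -/
lemma integral_mul_eq_sum {φ G : ℍ → ℂ} {c : ℤ → ℂ} {s : ℤ} (hs : ∀ k < s, c k = 0) {M h : ℕ}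
    (hM : 0 < M) (hh : 0 < h)
    (hφ : ∀ τ : ℍ, HasSum (fun k : ℤ => c k * Complex.exp (2 * π * Complex.I * k * τ / M)) (φ τ))
    {z : PowerSeries ℂ} (hG : HasExp h z G) {n : ℕ} (hn : 0 < n) (hdvd : M * h ∣ n) (τ : ℍ) :
    ∫ t in (0 : ℝ)..n, φ (affMap 1 t τ) * G (affMap 1 t τ) =
      n * ∑ k ∈ Finset.Icc s 0, c k *
        if (M : ℤ) ∣ k * h then PowerSeries.coeff (-(k * h) / M).toNat z else 0 := by
  obtain ⟨e, rfl⟩ := hdvd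
  have he : 0 < e := Nat.pos_of_ne_zero fun h => by simp [h] at hn
  have hM' : (M : ℤ) ≠ 0 := by exact_mod_cast hM.ne'
  have hM0 : (M : ℂ) ≠ 0 := Nat.cast_ne_zero.2 hM.ne'
  have hh0 : (h : ℂ) ≠ 0 := Nat.cast_ne_zero.2 hh.ne'
  have he0 : (e : ℂ) ≠ 0 := Nat.cast_ne_zero.2 he.ne'
  have hprod : ∀ τ : ℍ, HasSum (fun i : ℤ × ℕ =>
      c i.1 * Complex.exp (2 * π * Complex.I * i.1 * τ / M) *
        (PowerSeries.coeff i.2 z * Function.Periodic.qParam h τ ^ i.2)) (φ τ * G τ) := fun τ => by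
    have h := hasSum_mul_of_hasSum (hφ τ) (hG τ)
    exact h
  have hterm : ∀ (i : ℤ × ℕ) (t : ℝ),
      c i.1 * Complex.exp (2 * π * Complex.I * i.1 * (affMap 1 t τ) / M) *
        (PowerSeries.coeff i.2 z * Function.Periodic.qParam h (affMap 1 t τ) ^ i.2) =
      c i.1 * Complex.exp (2 * π * Complex.I * i.1 * τ / M) *
        (PowerSeries.coeff i.2 z * Function.Periodic.qParam h τ ^ i.2) *
        Complex.exp (2 * π * Complex.I * (((i.1 * h + i.2 * M) * e : ℤ) : ℂ) * t /
          (M * h * e : ℕ)) := fun i t => by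
    have e1 : Complex.exp (2 * π * Complex.I * i.1 * (affMap 1 t τ) / M) =
        Complex.exp (2 * π * Complex.I * i.1 * τ / M) *
          Complex.exp (2 * π * Complex.I * i.1 * t / M) := by
      rw [coe_affMap one_pos, ← Complex.exp_add]
      congr 1
      push_cast
      ring
    have e2 : Function.Periodic.qParam h (affMap 1 t τ) ^ i.2 = Function.Periodic.qParam h τ ^ i.2 *
        Complex.exp (2 * π * Complex.I * i.2 * t / h) := by
      simp only [Function.Periodic.qParam, ← Complex.exp_nat_mul]
      rw [coe_affMap one_pos, ← Complex.exp_add]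
      congr 1
      push_cast
      ring
    have e3 : Complex.exp (2 * π * Complex.I * (((i.1 * h + i.2 * M) * e : ℤ) : ℂ) * t /
          (M * h * e : ℕ)) = Complex.exp (2 * π * Complex.I * i.1 * t / M) *
            Complex.exp (2 * π * Complex.I * i.2 * t / h) := by
      rw [← Complex.exp_add]
      congr 1
      push_cast
      field_simp
    rw [e1, e2, e3]
    ring
  have h1 := hasSum_integral_exp (hprod τ).summable.norm
    (fun i : ℤ × ℕ => (i.1 * h + i.2 * M) * e) hn
    (F := fun t => φ (affMap 1 t τ) * G (affMap 1 t τ)) fun t => by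
      have := hprod (affMap 1 t τ)
      simp only [hterm] at this
      exact this
  set u : Finset (ℤ × ℕ) := (Finset.Icc s 0).image fun k => (k, (-(k * h) / M).toNat) with hu
  have h2 := h1.unique (hasSum_sum_of_ne_finset_zero (s := u) fun i hi => by
    obtain ⟨k, i⟩ := i
    split_ifs with h0
    · have h3 : k * h + i * M = 0 := by
        rcases mul_eq_zero.1 h0 with h | h
        · exact h
        · exact absurd h (by exact_mod_cast he.ne')
      have h4 : c k = 0 := by
        refine hs k (not_le.1 fun hk => hi ?_)
        refine Finset.mem_image.2 ⟨k, Finset.mem_Icc.2 ⟨hk, ?_⟩, ?_⟩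
        · by_contra! hk0
          have : (0 : ℤ) < h := by exact_mod_cast hh
          nlinarith [mul_pos hk0 this, mul_nonneg (Int.natCast_nonneg i) (Int.natCast_nonneg M)]
        · have : -(k * h) = i * M := by linarith
          rw [this, Int.mul_ediv_cancel _ hM', Int.toNat_natCast]
      simp [h4]
    · rfl)
  rw [h2, hu, Finset.sum_image fun _ _ _ _ h => (Prod.mk.inj h).1, Finset.mul_sum]
  refine Finset.sum_congr rfl fun k hk => ?_
  have hk0 := (Finset.mem_Icc.1 hk).2
  by_cases hdv : (M : ℤ) ∣ k * h
  · have h5 : 0 ≤ -(k * h) / (M : ℤ) := Int.ediv_nonneg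
      (by nlinarith [Int.natCast_nonneg h]) (Int.natCast_nonneg M)
    have h6 : k * h + ((-(k * h) / (M : ℤ)).toNat : ℤ) * M = 0 := by
      rw [Int.toNat_of_nonneg h5, Int.ediv_mul_cancel ((dvd_neg).2 hdv)]; ring
    rw [if_pos (by rw [h6, zero_mul]), if_pos hdv]
    generalize (-(k * h) / (M : ℤ)).toNat = i at h6
    have h7 : (k : ℂ) * h + i * M = 0 := by exact_mod_cast h6
    have h8 : Complex.exp (2 * π * Complex.I * k * τ / M) * Function.Periodic.qParam h τ ^ i = 1 := by
      rw [Function.Periodic.qParam, ← Complex.exp_nat_mul, ← Complex.exp_add, ← Complex.exp_zero]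
      congr 1
      push_cast
      field_simp
      linear_combination 2 * π * Complex.I * τ * h7
    linear_combination (M * h * e : ℕ) * c k * PowerSeries.coeff i z * h8
  · rw [if_neg, if_neg hdv]
    · simp
    · intro h0
      rcases mul_eq_zero.1 h0 with h7 | h7
      · refine hdv ⟨-((-(k * ↑h) / (M : ℤ)).toNat : ℤ), ?_⟩
        simp only [] at h7
        linarith
      · exact absurd h7 (by exact_mod_cast he.ne')

lemma CuspExpansion.hasSum {lam : ℕ} {f : ℍ → ℂ} {σ : SL(2, ℤ)} {M : ℕ} {c : ℤ → ℂ}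
    (h : CuspExpansion ((lam : ℂ) + 1 / 2) f σ M c) (τ : ℍ) :
    HasSum (fun k : ℤ => c k * Complex.exp (2 * π * Complex.I * k * τ / M))
      ((rootFactor σ τ ^ (2 * lam + 1))⁻¹ * f (σ • τ)) := by
  have h1 := (h.2.2 τ.im τ.im_pos).2.tendsto_at (x := τ) (le_refl τ.im)
  have e : denomC σ τ ^ (-((lam : ℂ) + 1 / 2)) = (rootFactor σ τ ^ (2 * lam + 1))⁻¹ := by
    rw [Complex.cpow_neg, rootFactor, ← Complex.cpow_nat_mul]
    congr 2
    push_cast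
    ring
  rw [e] at h1
  exact h1

/-- The integral over a period of a Laurent expansion is its constant term. -/
lemma integral_eq_const_term {φ : ℍ → ℂ} {c : ℤ → ℂ} {M : ℕ} (hM : 0 < M)
    (hφ : ∀ τ : ℍ, HasSum (fun k : ℤ => c k * Complex.exp (2 * π * Complex.I * k * τ / M)) (φ τ))
    {n : ℕ} (hn : 0 < n) (hdvd : M ∣ n) (τ : ℍ) :
    ∫ t in (0 : ℝ)..n, φ (affMap 1 t τ) = n * c 0 := by
  obtain ⟨e, rfl⟩ := hdvd
  have he : 0 < e := Nat.pos_of_ne_zero fun h => by simp [h] at hn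
  have hM0 : (M : ℂ) ≠ 0 := Nat.cast_ne_zero.2 hM.ne'
  have he0 : (e : ℂ) ≠ 0 := Nat.cast_ne_zero.2 he.ne'
  have hterm : ∀ (k : ℤ) (t : ℝ),
      c k * Complex.exp (2 * π * Complex.I * k * (affMap 1 t τ) / M) =
      c k * Complex.exp (2 * π * Complex.I * k * τ / M) *
        Complex.exp (2 * π * Complex.I * ((k * e : ℤ) : ℂ) * t / (M * e : ℕ)) := fun k t => by
    rw [coe_affMap one_pos, mul_assoc (c k), ← Complex.exp_add]
    congr 2
    push_cast
    field_simp
  have h := hasSum_integral_exp (hφ τ).summable.norm (fun k : ℤ => k * e) hn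
    (F := fun t => φ (affMap 1 t τ)) fun t => by
      have := hφ (affMap 1 t τ)
      simp only [hterm] at this
      exact this
  have h2 := hasSum_single (f := fun k : ℤ => if k * (e : ℤ) = 0 then
      ((M * e : ℕ) : ℂ) * (c k * Complex.exp (2 * π * Complex.I * k * τ / M)) else 0) 0
    fun k hk => if_neg (mul_ne_zero hk (by exact_mod_cast he.ne'))
  rw [h.unique h2]
  simp

lemma fourierCoeff_zero_eq_zero {lam N : ℕ} {f : ℍ → ℂ} (hf : IsWeaklyHolo N lam f) {a : ℤ → ℂ}
    (ha : FourierAtInfty f a)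
    (hconst : ∀ σ M c, CuspExpansion ((lam : ℂ) + 1 / 2) f σ M c → c 0 = 0) : a 0 = 0 := by
  obtain ⟨M, c, hc⟩ := hf.cusp 1
  rw [Int.cast_natCast] at hc
  have h1 := integral_eq_const_term hc.1 hc.hasSum hc.1 dvd_rfl cornerPt
  have h2 := integral_eq_const_term (φ := f) (c := a) (M := 1) one_pos
    (fun τ => by simpa using ha τ) hc.1 (one_dvd M) cornerPt
  have e : ∀ τ, (rootFactor 1 τ ^ (2 * lam + 1))⁻¹ * f ((1 : SL(2, ℤ)) • τ) = f τ := fun τ => by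
    simp [rootFactor, denomC]
  simp only [e] at h1
  have hM0 : (M : ℂ) ≠ 0 := Nat.cast_ne_zero.2 hc.1.ne'
  rw [h1, hconst _ _ _ hc, mul_zero] at h2
  simpa [hM0] using h2.symm

lemma cusp_sum_mem {p m D q M : ℕ} {R : Subring ℂ} {ψ : ℂ →+ ℂ}
    (hψ : ∀ z ∈ R, ∀ w, ψ (z * w) = z * ψ w) {c : ℤ → ℂ} {s : ℤ} (hM : 0 < M)
    {z : PowerSeries ℂ} (hz : z ∈ sparseSeries p m q R)
    (hD : ∀ k ∈ Finset.Icc s 0, (p : ℂ) ^ D * ψ (c k) ∈ R) (hs : 16 * -s < q) (hDm : D ≤ m)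
    (hc : c 0 = 0) :
    ψ (∑ k ∈ Finset.Icc s 0, c k * if (M : ℤ) ∣ k * (16 : ℕ) then
      PowerSeries.coeff (-(k * (16 : ℕ)) / M).toNat z else 0) ∈ powIdeal p (m - D) R := by
  rw [map_sum]
  refine (powIdeal p (m - D) R).sum_mem fun k hk => ?_
  split_ifs with hdv
  swap
  · simp
  rcases eq_or_ne k 0 with rfl | hk0
  · simp [hc]
  have hk' := Finset.mem_Icc.1 hk
  obtain ⟨t, ht⟩ := hdv
  have hM' : (0 : ℤ) < M := by exact_mod_cast hM
  have e : -(k * (16 : ℕ)) / (M : ℤ) = -t := by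
    rw [ht, ← mul_neg, Int.mul_ediv_cancel_left _ hM'.ne']
  push_cast at ht
  have ht0 : t < 0 := by
    by_contra! h
    nlinarith [mul_nonneg hM'.le h, lt_of_le_of_ne hk'.2 hk0]
  have ht1 : -t ≤ 16 * -s := by nlinarith
  have hndvd : ¬ q ∣ (-t).toNat := fun h => by
    have h1 := Nat.le_of_dvd (by omega) h
    omega
  rw [e]
  obtain ⟨w, hw, hzw⟩ := mem_powIdeal.1 ((mem_sparseSeries.1 hz _).2 hndvd)
  have hzR := (mem_sparseSeries.1 hz (-t).toNat).1
  rw [mul_comm, hψ _ hzR, ← hzw]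
  refine mem_powIdeal.2 ⟨w * ((p : ℂ) ^ D * ψ (c k)), R.mul_mem hw (hD k hk), ?_⟩
  calc _ = (p : ℂ) ^ (m - D) * (p : ℂ) ^ D * w * ψ (c k) := by ring
    _ = _ := by rw [← pow_add, Nat.sub_add_cancel hDm]

/-- A uniform denominator bound and the resulting constraint on the coefficients at `∞` imposed by
the residue theorem, applied to the product of `f` with a test form. -/
lemma exists_coeff_relation {N r p ε lam : ℕ} {R : Subring ℂ} (hN : N * r = 4) (hp : p.Prime)
    (hp3 : 3 ≤ p) (hR : LocalRootClosed p R) {ψ : ℂ →+ ℂ}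
    (hψ : ∀ z ∈ R, ∀ w, ψ (z * w) = z * ψ w) (hψR : ∀ z ∈ R, ψ z = z)
    (hψD : ∀ w, ∃ D : ℕ, (p : ℂ) ^ D * ψ w ∈ R) {f : ℍ → ℂ} (hf : IsWeaklyHolo N (lam : ℤ) f)
    {a : ℤ → ℂ} (ha : FourierAtInfty f a) {n₀ : ℤ} (hvan : ∀ n < n₀, a n = 0) (haR : ∀ n, a n ∈ R)
    (hconst : ∀ σ M c, CuspExpansion ((lam : ℂ) + 1 / 2) f σ M c → c 0 = 0) :
    ∃ D B : ℕ, ∀ {m b b' n κ : ℕ}, D ≤ m → B < p ^ b' → b' + m ≤ b + 1 → ε ≤ r * n →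
      2 * κ + 2 * lam = 3 + ε * p ^ b → 2 ∣ κ → (∃ A x, SparseForm p m (p ^ b') R κ A x) →
      ∃ z, PowerSeries.coeff 0 z ≠ 0 ∧ (PowerSeries.coeff 0 z)⁻¹ ∈ R ∧
        z ∈ sparseSeries p 1 (p ^ b) R ∧ z ∈ sparseSeries p m (p ^ b') R ∧
        ∑ k ∈ Finset.Icc (n₀ - n * p ^ b) 0, a (k + n * p ^ b) * PowerSeries.coeff (-k).toNat z ∈
          powIdeal p (m - D) R := by
  have hN0 : 0 < N := Nat.pos_of_ne_zero (by rintro rfl; simp at hN)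
  have : NeZero (4 * N) := ⟨by omega⟩
  obtain ⟨S, hSΓ, hS⟩ := exists_residue_sum (Gamma0 (4 * N))
  choose M c hc using hf.cusp
  have hc' : ∀ σ, CuspExpansion ((lam : ℂ) + 1 / 2) f σ (M σ) (c σ) := fun σ => by
    have := hc σ
    rwa [Int.cast_natCast] at this
  choose s hs using fun σ => (hc' σ).2.1
  choose D hD using fun σ k => hψD (c σ k)
  refine ⟨S.sup fun σ => (Finset.Icc (s σ) 0).sup (D σ), S.sup fun σ => (16 * -s σ).toNat,
    fun {m b b' n κ} hDm hB hb hεn hκ hκ2 ⟨A, x, hA⟩ => ?_⟩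
  set D' := S.sup fun σ => (Finset.Icc (s σ) 0).sup (D σ) with hD'
  obtain ⟨g, hg, hginv, ⟨z, hzexp, hz0, hzinv, hz1, hz2⟩, hcusp⟩ :=
    exists_testForm hN hp hp3 hR (Nat.sub_add_cancel hεn) hκ hκ2 hb hA
  refine ⟨z, hz0, hzinv, hz1, hz2, ?_⟩
  have hFd : MDifferentiable 𝓘(ℂ) 𝓘(ℂ) fun τ => f τ * g τ := hf.holo.mul hg
  have hFinv : ∀ γ ∈ Gamma0 (4 * N), ∀ τ, f (γ • τ) * g (γ • τ) =
      denomC γ τ ^ 2 * (f τ * g τ) := fun γ hγ τ => by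
    have h1 := hf.transf γ hγ τ
    have e : (2 * (lam : ℤ) + 1) = ((2 * lam + 1 : ℕ) : ℤ) := by push_cast; ring
    rw [e, zpow_natCast] at h1
    rw [h1]
    linear_combination f τ * hginv γ hγ τ
  set n' : ℕ := 16 * ∏ σ ∈ S, M σ with hn'
  have hn'0 : 0 < n' := Nat.mul_pos (by norm_num) (Finset.prod_pos fun σ _ => (hc' σ).1)
  have hres := hS _ hFd hFinv n'
  choose! zσ hzσ G hG hGeq using hcusp
  have hσ : ∀ σ ∈ S, ∫ t in (0 : ℝ)..n', f (σ • affMap 1 t cornerPt) * g (σ • affMap 1 t cornerPt) /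
      denomC σ (affMap 1 t cornerPt) ^ 2 = n' * ∑ k ∈ Finset.Icc (s σ) 0, c σ k *
        if (M σ : ℤ) ∣ k * (16 : ℕ) then
          PowerSeries.coeff (-(k * (16 : ℕ)) / M σ).toNat (zσ σ) else 0 := fun σ hσ => by
    rw [← integral_mul_eq_sum (hs σ) (hc' σ).1 (by norm_num) (hc' σ).hasSum (hG σ (hSΓ σ hσ)) hn'0
      (by rw [hn', mul_comm]; exact mul_dvd_mul_left _ (Finset.dvd_prod_of_mem _ hσ)) cornerPt]
    refine intervalIntegral.integral_congr fun t _ => ?_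
    generalize affMap 1 t cornerPt = τ
    have hρ := rootFactor_ne_zero σ τ
    rw [← rootFactor_sq]
    field_simp
    linear_combination rootFactor σ τ * f (σ • τ) * hGeq σ (hSΓ σ hσ) τ
  have hinf : ∫ t in (0 : ℝ)..n', f (affMap 1 t cornerPt) * g (affMap 1 t cornerPt) =
      n' * ∑ k ∈ Finset.Icc (n₀ - n * p ^ b) 0,
        a (k + n * p ^ b) * PowerSeries.coeff (-k).toNat z := by
    have h1 := integral_mul_eq_sum (φ := fun τ => f τ * (Function.Periodic.qParam 1 τ ^ (n * p ^ b))⁻¹)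
      (c := fun k => a (k + n * p ^ b)) (s := n₀ - n * p ^ b) (M := 1) (h := 1)
      (fun k hk => hvan _ (by linarith)) one_pos one_pos (fun τ => by
        have h := ((Equiv.addRight ((n : ℤ) * p ^ b)).hasSum_iff.2 (ha τ)).mul_right
          (Function.Periodic.qParam 1 τ ^ (n * p ^ b))⁻¹
        refine (congrArg (fun F => HasSum F _) (funext fun k => ?_)).mpr h
        simp only [Function.comp_apply, Equiv.coe_addRight, Function.Periodic.qParam]
        rw [← Complex.exp_nat_mul, ← Complex.exp_neg, mul_assoc (a _), ← Complex.exp_add]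
        congr 2
        push_cast
        ring) hzexp hn'0 (by simp) cornerPt
    simp only [Nat.cast_one, mul_one, isUnit_one, IsUnit.dvd, if_true, Int.ediv_one] at h1
    rw [← h1]
    refine intervalIntegral.integral_congr fun t _ => ?_
    have hq : Function.Periodic.qParam 1 (affMap 1 t cornerPt : ℂ) ≠ 0 := Complex.exp_ne_zero _
    field_simp
  set T := ∑ k ∈ Finset.Icc (n₀ - n * p ^ b) 0,
        a (k + n * p ^ b) * PowerSeries.coeff (-k).toNat z with hT
  have hTR : T ∈ R := R.sum_mem fun k _ => R.mul_mem (haR _) (mem_sparseSeries.1 hz2 _).1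
  rw [hinf, Finset.sum_congr rfl hσ, ← Finset.mul_sum, ← mul_add, mul_eq_zero] at hres
  rw [← hψR T hTR, eq_neg_of_add_eq_zero_left
    (hres.resolve_left (Nat.cast_ne_zero.2 hn'0.ne')), map_neg, map_sum]
  refine neg_mem (sum_mem fun σ hσ => ?_)
  have hle : (16 * -s σ).toNat ≤ S.sup fun σ => (16 * -s σ).toNat :=
    Finset.le_sup (f := fun σ => (16 * -s σ).toNat) hσ
  refine cusp_sum_mem hψ (hc' σ).1 (hzσ σ (hSΓ σ hσ)) (fun k hk => ?_) (by omega) hDm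
    (hconst _ _ _ (hc' σ))
  have h1 : D σ k ≤ D' := (Finset.le_sup hk).trans
    (Finset.le_sup (f := fun σ => (Finset.Icc (s σ) 0).sup (D σ)) hσ)
  rw [← Nat.sub_add_cancel h1, pow_add, mul_assoc]
  exact R.mul_mem (R.pow_mem (natCast_mem R p) _) (hD σ k)

lemma exists_weight {p ε e lam : ℕ} (hp : p.Prime) (hp3 : 3 ≤ p) (hε : Odd ε) (he : 2 * e = 3 + ε)
    (hlam : lam ≡ e [MOD (p - 1) / 2]) :
    ∃ d : ℕ, ∀ c κ₀ : ℕ, 2 * κ₀ + 2 * lam ≤ p ^ (d + 2 * c) →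
      ∃ κ ≥ κ₀, 2 * κ + 2 * lam = 3 + ε * p ^ (d + 2 * c) ∧ p - 1 ∣ κ := by
  obtain ⟨t, rfl⟩ : Odd p := hp.odd_of_ne_two (by omega)
  have ht : (2 * t + 1 - 1) / 2 = t := by omega
  rw [ht] at hlam
  obtain ⟨s, hs⟩ := (Nat.modEq_iff_dvd.1 hlam)
  obtain ⟨u, hu⟩ := hε
  have hsq (c : ℕ) : (4 * t : ℤ) ∣ (2 * t + 1) ^ (2 * c) - 1 := by
    have h := sub_one_dvd_pow_sub_one ((2 * t + 1 : ℤ) ^ 2) c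
    rw [pow_mul]
    exact (Dvd.intro (t + 1 : ℤ) (by ring)).trans h
  obtain ⟨d, hd⟩ : ∃ d : ℕ, (4 * t : ℤ) ∣ 2 * (t * s) + ε * ((2 * t + 1) ^ d - 1) := by
    obtain ⟨v, rfl | rfl⟩ := Int.even_or_odd' s
    · exact ⟨0, v, by ring⟩
    · exact ⟨1, v + u + 1, by subst hu; push_cast; ring⟩
  refine ⟨d, fun c κ₀ hle => ?_⟩
  obtain ⟨v, hv⟩ := hd
  obtain ⟨w, hw⟩ := hsq c
  set q := (2 * t + 1) ^ (d + 2 * c) with hq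
  have hqz : (q : ℤ) = (2 * t + 1) ^ d * (2 * t + 1) ^ (2 * c) := by
    rw [hq, pow_add]; push_cast; rfl
  have heq : (3 + ε * q - 2 * lam : ℤ) = 2 * (2 * t * (v + ε * (2 * t + 1) ^ d * w)) := by
    have h1 : (2 * t + 1 : ℤ) ^ (2 * c) = 1 + 4 * t * w := by linarith
    have h2 : (2 * e : ℤ) = 3 + ε := by exact_mod_cast he
    rw [hqz, h1]
    linear_combination hv + 2 * hs - h2
  have hqε : q ≤ ε * q := Nat.le_mul_of_pos_left _ (by omega)
  have hqε' : (q : ℤ) ≤ ε * q := by exact_mod_cast hqε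
  have hle' : (2 * κ₀ + 2 * lam : ℤ) ≤ q := by exact_mod_cast hle
  have hκ : (κ₀ : ℤ) ≤ 2 * t * (v + ε * (2 * t + 1) ^ d * w) := by linarith
  refine ⟨(2 * t * (v + ε * (2 * t + 1) ^ d * w) : ℤ).toNat, by omega, ?_, ?_⟩
  · zify
    rw [Int.toNat_of_nonneg (by omega)]
    linarith
  · rw [← Int.natCast_dvd_natCast, Int.toNat_of_nonneg (by omega)]
    exact ⟨v + ε * (2 * t + 1) ^ d * w, by push_cast; ring⟩

/-- The induction on the index: if `a` is divisible by `p^m` on multiples of `p^b'`, then the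
coefficient relations force divisibility by `p^(m + 1)` on multiples of `p^b`. -/
lemma mem_powIdeal_succ_of_relation {p m m' b b' : ℕ} {R : Subring ℂ} {a : ℤ → ℂ} {n₀ : ℤ}
    (hvan : ∀ n < n₀, a n = 0) (h0 : a 0 = 0) (haR : ∀ n, a n ∈ R)
    (hb' : ∀ n : ℤ, a (p ^ b' * n) ∈ powIdeal p m R) (hm : m + 1 ≤ m') (hb : -n₀ < p ^ b)
    (hrel : ∀ n : ℕ, 1 ≤ n → ∃ z, PowerSeries.coeff 0 z ≠ 0 ∧ (PowerSeries.coeff 0 z)⁻¹ ∈ R ∧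
        z ∈ sparseSeries p 1 (p ^ b) R ∧ z ∈ sparseSeries p m' (p ^ b') R ∧
        ∑ k ∈ Finset.Icc (n₀ - n * p ^ b) 0, a (k + n * p ^ b) * PowerSeries.coeff (-k).toNat z ∈
          powIdeal p (m + 1) R) (hbb : b' ≤ b) (n : ℤ) :
    a (p ^ b * n) ∈ powIdeal p (m + 1) R := by
  have hneg (n : ℤ) (hn : n ≤ 0) : a (p ^ b * n) ∈ powIdeal p (m + 1) R := by
    obtain rfl | hn := hn.eq_or_lt
    · rw [mul_zero, h0]
      exact zero_mem _
    · have h1 := mul_le_mul_of_nonneg_left (show n ≤ -1 by omega)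
        (show (0 : ℤ) ≤ p ^ b by positivity)
      rw [hvan _ (by linarith)]
      exact zero_mem _
  have key (n : ℕ) : a (p ^ b * (n : ℤ)) ∈ powIdeal p (m + 1) R := by
    induction n using Nat.strong_induction_on with
    | _ n ih =>
    obtain rfl | hn := Nat.eq_zero_or_pos n
    · exact hneg _ le_rfl
    by_cases hlt : (p ^ b * (n : ℤ)) < n₀
    · rw [hvan _ hlt]
      exact zero_mem _
    obtain ⟨z, hz0, hzi, hz1, hz2, hsum⟩ := hrel n hn
    rw [mem_sparseSeries] at hz1 hz2
    have hmem : (0 : ℤ) ∈ Finset.Icc (n₀ - n * p ^ b) 0 := by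
      rw [Finset.mem_Icc]
      exact ⟨by linarith [mul_comm ((p : ℤ) ^ b) n], le_rfl⟩
    rw [← Finset.add_sum_erase _ _ hmem] at hsum
    have hrest : ∑ k ∈ (Finset.Icc (n₀ - n * p ^ b) 0).erase 0,
        a (k + n * p ^ b) * PowerSeries.coeff (-k).toNat z ∈ powIdeal p (m + 1) R := by
      refine sum_mem fun k hk => ?_
      obtain ⟨hk0, hk⟩ := Finset.mem_erase.1 hk
      have hk1 := (Finset.mem_Icc.1 hk).2
      obtain ⟨i, rfl⟩ : ∃ i : ℕ, k = -i := ⟨(-k).toNat, by omega⟩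
      have hi : (- -(i : ℤ)).toNat = i := by simp
      rw [hi]
      by_cases h1 : p ^ b ∣ i
      · obtain ⟨c, rfl⟩ := h1
        refine mul_mem_powIdeal_right ?_ (hz1 _).1
        have hc : c ≠ 0 := by rintro rfl; simp at hk0
        have he : (-((p ^ b * c : ℕ) : ℤ) + n * p ^ b : ℤ) = p ^ b * ((n : ℤ) - c) := by
          push_cast; ring
        rw [he]
        obtain hnc | hnc := le_total n c
        · exact hneg _ (by omega)
        · have := ih (n - c) (by omega)
          rwa [Nat.cast_sub hnc] at this
      by_cases h2 : p ^ b' ∣ i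
      · obtain ⟨c, rfl⟩ := h2
        refine mul_mem_powIdeal_add ?_ ((hz1 _).2 h1)
        have he : (-((p ^ b' * c : ℕ) : ℤ) + n * p ^ b : ℤ) =
            p ^ b' * (-c + n * p ^ (b - b')) := by
          obtain ⟨r, rfl⟩ := Nat.exists_eq_add_of_le hbb
          rw [Nat.add_sub_cancel_left]
          push_cast; ring
        rw [he]
        exact hb' _
      · exact mul_mem_powIdeal_left (haR _) (powIdeal_anti hm ((hz2 _).2 h2))
    have h := mul_mem_powIdeal_right ((add_mem_cancel_right hrest).1 hsum) hzi
    rwa [neg_zero, Int.toNat_zero, mul_assoc, mul_inv_cancel₀ hz0, mul_one, zero_add,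
      mul_comm] at h
  obtain hn | hn := le_total n 0
  · exact hneg n hn
  · lift n to ℕ using hn
    exact key n

lemma exists_mem_powIdeal {N r p ε e lam : ℕ} {R : Subring ℂ} (hN : N * r = 4) (hp : p.Prime)
    (hp3 : 3 ≤ p) (hR : LocalRootClosed p R) {ψ : ℂ →+ ℂ}
    (hψ : ∀ z ∈ R, ∀ w, ψ (z * w) = z * ψ w) (hψR : ∀ z ∈ R, ψ z = z)
    (hψD : ∀ w, ∃ D : ℕ, (p : ℂ) ^ D * ψ w ∈ R) {f : ℍ → ℂ} (hf : IsWeaklyHolo N (lam : ℤ) f)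
    {a : ℤ → ℂ} (ha : FourierAtInfty f a) {n₀ : ℤ} (hvan : ∀ n < n₀, a n = 0) (haR : ∀ n, a n ∈ R)
    (hconst : ∀ σ M c, CuspExpansion ((lam : ℂ) + 1 / 2) f σ M c → c 0 = 0)
    (hε : Odd ε) (hεr : ε ≤ r) (he : 2 * e = 3 + ε) (hlam : lam ≡ e [MOD (p - 1) / 2]) (m : ℕ) :
    ∃ b : ℕ, 0 < b ∧ ∀ n : ℤ, a (p ^ b * n) ∈ powIdeal p m R := by
  induction m with
  | zero => exact ⟨1, one_pos, fun n => mem_powIdeal_zero.2 (haR _)⟩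
  | succ m ih =>
    obtain ⟨b₁, -, hb₁⟩ := ih
    obtain ⟨D, B, hDB⟩ := exists_coeff_relation (r := r) (ε := ε) hN hp hp3 hR hψ hψR hψD hf ha
      hvan haR hconst
    obtain ⟨d, hd⟩ := exists_weight hp hp3 hε he hlam
    set b' := b₁ + B with hb'
    obtain ⟨κ₀, hκ₀⟩ := exists_sparseForm hp hp3 hR (m := m + 1 + D) (by omega) b'
    set c := b' + (m + 1 + D) + n₀.natAbs + 2 * κ₀ + 2 * lam with hc
    have hcb : d + 2 * c < p ^ (d + 2 * c) := Nat.lt_pow_self hp.one_lt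
    obtain ⟨κ, hκ, hκe, hκd⟩ := hd c κ₀ (by omega)
    have h2 : 2 ∣ κ := by
      have := hp.odd_of_ne_two (by omega)
      exact (this.tsub_odd odd_one).two_dvd.trans hκd
    have hB : B < p ^ b' :=
      (Nat.lt_pow_self hp.one_lt).trans_le (Nat.pow_le_pow_right hp.pos (by omega))
    refine ⟨d + 2 * c, by omega, mem_powIdeal_succ_of_relation (b' := b') hvan
      (fourierCoeff_zero_eq_zero hf ha hconst) haR (fun n => ?_) (m' := m + 1 + D) (by omega) ?_
      (fun n hn => ?_) (by omega)⟩
    · rw [hb', pow_add, mul_assoc]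
      exact hb₁ _
    · have : ((d + 2 * c : ℕ) : ℤ) < ((p ^ (d + 2 * c) : ℕ) : ℤ) := by exact_mod_cast hcb
      push_cast at this
      omega
    · have h := hDB (m := m + 1 + D) (b := d + 2 * c) (b' := b') (n := n) (κ := κ) (by omega) hB
        (by omega) (hεr.trans (Nat.le_mul_of_pos_right _ hn)) hκe h2 (hκ₀ κ hκ hκd)
      rwa [Nat.add_sub_cancel] at h

/-- Same setting with an odd prime `p ≥ 3`, `𝔭 ∣ p`, and
`λ ≡ 2 (mod (p-1)/2)` or (`N = 1` and `λ ≡ 3 (mod (p-1)/2)`). -/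
theorem statement1
    (N : ℕ) (hN : N = 1 ∨ N = 2 ∨ N = 4) (lam : ℕ)
    (p : ℕ) (hp : p.Prime) (hp3 : 3 ≤ p)
    (L : Subfield ℂ) [NumberField L]
    (P : Ideal (𝓞 L)) (hPprime : P.IsPrime) (hPp : (p : 𝓞 L) ∈ P)
    (f : ℍ → ℂ) (hf : IsWeaklyHolo N (lam : ℤ) f)
    (a : ℤ → ℂ) (ha : FourierAtInfty f a)
    (n₀ : ℤ) (hvan : ∀ n : ℤ, n < n₀ → a n = 0)
    (haL : ∀ n : ℤ, a n ∈ L)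
    (haInt : ∀ n : ℤ, PIntegral L P (a n))
    (hconst : ∀ (σ : SL(2, ℤ)) (M : ℕ) (c : ℤ → ℂ),
      CuspExpansion ((lam : ℂ) + 1 / 2) f σ M c → c 0 = 0)
    (hcong : lam ≡ 2 [MOD (p - 1) / 2] ∨ (N = 1 ∧ lam ≡ 3 [MOD (p - 1) / 2])) :
    ∀ j : ℕ, 0 < j → ∃ b : ℕ, 0 < b ∧ ∀ n : ℤ, CongMod L P j (a (p ^ b * n)) 0 := by
  intro j _
  obtain ⟨R, hR, hPR, hRP, ψ, hψ, hψR, hψD⟩ := exists_localRootClosed p hp L P hPprime hPp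
  obtain ⟨r, hr⟩ : ∃ r, N * r = 4 := by
    obtain rfl | rfl | rfl := hN
    exacts [⟨4, rfl⟩, ⟨2, rfl⟩, ⟨1, rfl⟩]
  obtain ⟨ε, e, hε, hεr, he, hlam⟩ : ∃ ε e, Odd ε ∧ ε ≤ r ∧ 2 * e = 3 + ε ∧
      lam ≡ e [MOD (p - 1) / 2] := by
    obtain h | ⟨rfl, h⟩ := hcong
    · refine ⟨1, 2, odd_one, Nat.one_le_iff_ne_zero.2 ?_, rfl, h⟩
      rintro rfl
      simp at hr
    · exact ⟨3, 3, by decide, by omega, rfl, h⟩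
  obtain ⟨b, hb, h⟩ := exists_mem_powIdeal hr hp hp3 hR hψ hψR hψD hf ha hvan
    (fun n => hPR _ (haInt n)) hconst hε hεr he hlam j
  exact ⟨b, hb, fun n => hRP _ (haL _) j (h n)⟩

end
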